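/- Let S be the decorated symmetrized SMART machine and Σ its conveyor-belt alphabet. Then the automorphism f_S belongs to the finitely generated group G_* ≤ Aut(Σ^ℤ), and there is a constant K > 0 such that for all n ≥ 2 the word norm of (f_S)^n in G_* is at most K·(log n)⁴. -/

import Mathlib

/-- The word norm of `g` with respect to the generating set `F`:
the least `n` such that `g` is a product of `n` elements of `F ∪ F⁻¹`. -/
noncomputable def wordNorm {G : Type*} [Group G] (F : Set G) (g : G) : ℕ :=
  sInf {n : ℕ | ∃ w : List G, w.length = n ∧ (∀ x ∈ w, x ∈ F ∨ x⁻¹ ∈ F) ∧ w.prod = g}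
/-! ### Turing machine symbols and local step functions -/

/-- Tape/head symbols: a plain tape letter, or a head `(q, a)` on top of letter `a`. -/
abbrev TSym (Q Γ : Type) : Type := Γ ⊕ (Q × Γ)

/-- The tape letter carried by a cell (under the head if the cell carries the head). -/
def tapeLetter {Q Γ : Type} : TSym Q Γ → Γ
  | Sum.inl a => a
  | Sum.inr (_, a) => a

/-- A complete deterministic machine is given by a head-step function: at `(q, a)` it either
rewrites the head in place (`.inl (q', b)`, a matching transition), or moves in direction
`δ ∈ {+1, -1}` into state `q'` (`.inr (δ, q')`, a move transition). -/
abbrev HeadStep (Q Γ : Type) : Type := Q → Γ → ((Q × Γ) ⊕ (ℤ × Q))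

/-- If the symbol `s` carries a head about to move in direction `d`, the state in which the
head arrives; `none` otherwise. -/
def arrivesAs {Q Γ : Type} (δ : HeadStep Q Γ) (s : TSym Q Γ) (d : ℤ) : Option Q :=
  match s with
  | Sum.inl _ => none
  | Sum.inr (q, a) =>
    match δ q a with
    | Sum.inl _ => none
    | Sum.inr (d', q') => if d' = d then some q' else none

/-- The local rule of the moving-head dynamics: the new symbol of a cell, given the symbols
`l, c, r` of its left neighbour, itself, and its right neighbour. -/
def localStep {Q Γ : Type} (δ : HeadStep Q Γ) (l c r : TSym Q Γ) : TSym Q Γ :=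
  match c with
  | Sum.inr (q, a) =>
    (match δ q a with
     | Sum.inl qb => Sum.inr qb
     | Sum.inr _ => Sum.inl a)
  | Sum.inl a =>
    (match arrivesAs δ l 1 with
     | some q' => Sum.inr (q', a)
     | none =>
       match arrivesAs δ r (-1) with
       | some q' => Sum.inr (q', a)
       | none => Sum.inl a)

/-- The moving-head action of a complete deterministic machine on bi-infinite tapes. -/
def stepZ {Q Γ : Type} (δ : HeadStep Q Γ) (x : ℤ → TSym Q Γ) : ℤ → TSym Q Γ :=
  fun i => localStep δ (x (i - 1)) (x i) (x (i + 1))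

/-- The action of a complete deterministic machine on cyclic tapes of length `ℓ`. -/
def stepC {Q Γ : Type} (δ : HeadStep Q Γ) (ℓ : ℕ) (w : ZMod ℓ → TSym Q Γ) :
    ZMod ℓ → TSym Q Γ :=
  fun i => localStep δ (w (i - 1)) (w i) (w (i + 1))

/-- A configuration has at most one head. -/
def AtMostOneHeadZ {Q Γ : Type} (x : ℤ → TSym Q Γ) : Prop :=
  ∀ i j : ℤ, (x i).isRight = true → (x j).isRight = true → i = j

/-- A cyclic configuration has at most one head. -/
def AtMostOneHeadC {Q Γ : Type} {ℓ : ℕ} (w : ZMod ℓ → TSym Q Γ) : Prop :=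
  ∀ i j : ZMod ℓ, (w i).isRight = true → (w j).isRight = true → i = j

/-! ### The SMART machine -/

/-- The four arrows `▶, ◀, ▷, ◁` (filled right/left, hollow right/left). -/
inductive Arrow : Type
  | rf  -- ▶ (filled right)
  | lf  -- ◀ (filled left)
  | rh  -- ▷ (hollow right)
  | lh  -- ◁ (hollow left)
deriving DecidableEq

/-- The SMART state set `Q̊`: an arrow with a subscript in `{1,2}`; the subscript `b`
is represented by the `Fin 2` value `b - 1`. -/
abbrev SQ : Type := Arrow × Fin 2

/-- The SMART tape alphabet `{0,1,2}`. -/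
abbrev Letter : Type := Fin 3

/-- The head-step function of the SMART machine.  States `q₂` (second component `1`) are
move states; states `q₁` (second component `0`) are matching states. -/
def smartStep : HeadStep SQ Letter := fun q a =>
  if q.2 = 1 then
    match q.1 with
    | .rf => Sum.inr (1, (.rf, 0))   -- (▶₂, +1, ▶₁)
    | .lf => Sum.inr (-1, (.lf, 0))  -- (◀₂, −1, ◀₁)
    | .rh => Sum.inr (1, (.rh, 0))   -- (▷₂, +1, ▷₁)
    | .lh => Sum.inr (-1, (.lh, 0))  -- (◁₂, −1, ◁₁)
  else
    match q.1 with
    | .rf => Sum.inl (if a = 0 then ((.lf, 1), 1) else if a = 1 then ((.lh, 1), 1) else ((.lh, 1), 2))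
    | .lf => Sum.inl (if a = 0 then ((.rf, 1), 1) else if a = 1 then ((.rh, 1), 1) else ((.rh, 1), 2))
    | .rh => Sum.inl (if a = 0 then ((.rf, 1), 2) else if a = 1 then ((.rf, 1), 0) else ((.lh, 1), 0))
    | .lh => Sum.inl (if a = 0 then ((.lf, 1), 2) else if a = 1 then ((.lf, 1), 0) else ((.rh, 1), 0))

/-! ### Conveyor belts -/

/-- The conveyor-belt alphabet `Σ = (Γ²×{±1}) ⊔ ((Q×Γ)×Γ) ⊔ (Γ×(Q×Γ))`: a headless cell
with top letter, bottom letter and conveyor bit (`true = +1`), or a cell carrying a head on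
the top resp. bottom track. -/
inductive BSym (Q Γ : Type) : Type
  | belt (a b : Γ) (s : Bool)
  | top (q : Q) (a : Γ) (b : Γ)
  | bot (a : Γ) (q : Q) (b : Γ)

namespace BSym

variable {Q Γ : Type}

/-- Whether the cell carries a head. -/
def isHead : BSym Q Γ → Bool
  | .belt _ _ _ => false
  | _ => true

/-- The top-track tape letter of a cell. -/
def topLetter : BSym Q Γ → Γ
  | .belt a _ _ => a
  | .top _ a _ => a
  | .bot a _ _ => a

/-- The bottom-track tape letter of a cell. -/
def botLetter : BSym Q Γ → Γ
  | .belt _ b _ => b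
  | .top _ _ b => b
  | .bot _ _ b => b

/-- The cell is in `Γ²×{+1}` or carries a head. -/
def plusOrHead : BSym Q Γ → Bool
  | .belt _ _ s => s
  | _ => true

/-- The cell is in `Γ²×{−1}` or carries a head. -/
def minusOrHead : BSym Q Γ → Bool
  | .belt _ _ s => !s
  | _ => true

/-- The top-track symbol of a cell, as a cell of a (cyclic) Turing machine tape. -/
def topSym : BSym Q Γ → TSym Q Γ
  | .belt a _ _ => Sum.inl a
  | .top q a _ => Sum.inr (q, a)
  | .bot a _ _ => Sum.inl a

/-- The bottom-track symbol of a cell, as a cell of a (cyclic) Turing machine tape. -/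
def botSym : BSym Q Γ → TSym Q Γ
  | .belt _ b _ => Sum.inl b
  | .top _ _ b => Sum.inl b
  | .bot _ q b => Sum.inr (q, b)

end BSym

variable {Q Γ : Type}

/-- The configuration `x` is cut between positions `i` and `i+1`. -/
def cutAfter (x : ℤ → BSym Q Γ) (i : ℤ) : Prop :=
  BSym.minusOrHead (x i) = true ∧ BSym.plusOrHead (x (i + 1)) = true

/-- `[s, e]` is a (finite) block of the configuration `x`. -/
def IsBlock (x : ℤ → BSym Q Γ) (s e : ℤ) : Prop :=
  s ≤ e ∧ cutAfter x (s - 1) ∧ cutAfter x e ∧ ∀ j : ℤ, s ≤ j → j < e → ¬ cutAfter x j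

/-- The block `[s, e]` of `x` contains a head. -/
def BlockHasHead (x : ℤ → BSym Q Γ) (s e : ℤ) : Prop :=
  ∃ j : ℤ, s ≤ j ∧ j ≤ e ∧ BSym.isHead (x j) = true

/-- Every position of `x` lies in a finite block. -/
def AllFiniteBlocks (x : ℤ → BSym Q Γ) : Prop :=
  ∀ i : ℤ, ∃ s e : ℤ, IsBlock x s e ∧ s ≤ i ∧ i ≤ e

/-- The cyclic tape obtained by unfolding the block `[s, e]` of `x` into its conveyor belt
of length `2(e−s+1)`: the word of top components followed by the reversed word of bottom
components. -/
def unfoldBlock (x : ℤ → BSym Q Γ) (s e : ℤ) :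
    ZMod (2 * (e - s + 1).toNat) → TSym Q Γ :=
  fun t =>
    if t.val < (e - s + 1).toNat then BSym.topSym (x (s + (t.val : ℤ)))
    else BSym.botSym (x (e - ((t.val - (e - s + 1).toNat : ℕ) : ℤ)))

/-- `y` is obtained from `x` by applying the `n`-th power of the machine with head-step
function `δ` to the conveyor belt of every head-containing block, refolding with conveyor
bits `+1` left of the head and `−1` right of it, and fixing head-free blocks. -/
def ActsAsBeltPower (δ : HeadStep Q Γ) (n : ℕ) (x y : ℤ → BSym Q Γ) : Prop :=
  ∀ s e : ℤ, IsBlock x s e →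
    (¬ BlockHasHead x s e → ∀ j : ℤ, s ≤ j → j ≤ e → y j = x j) ∧
    (BlockHasHead x s e →
      IsBlock y s e ∧
      unfoldBlock y s e =
        (stepC δ (2 * (e - s + 1).toNat))^[n] (unfoldBlock x s e) ∧
      (∀ j k : ℤ, s ≤ j → j ≤ e → s ≤ k → k ≤ e → BSym.isHead (y k) = true →
        ∀ a b : Γ, ∀ sg : Bool, y j = BSym.belt a b sg → (sg = true ↔ j < k)))

/-! ### The generators of the group of Turing machine instructions on conveyor belts -/

/-- Application of a permutation of head symbols to a cell (both tracks). -/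
def beltGateApply (g : Equiv.Perm (Q × Γ)) : BSym Q Γ → BSym Q Γ
  | .belt a b s => .belt a b s
  | .top q a b => .top (g (q, a)).1 (g (q, a)).2 b
  | .bot a q b => .bot a (g (q, b)).1 (g (q, b)).2

/-- Application of a permutation of head symbols to heads on the top track only. -/
def beltGateApplyUp (g : Equiv.Perm (Q × Γ)) : BSym Q Γ → BSym Q Γ
  | .belt a b s => .belt a b s
  | .top q a b => .top (g (q, a)).1 (g (q, a)).2 b
  | .bot a q b => .bot a q b

/-- Application of a permutation of head symbols to heads on the bottom track only. -/
def beltGateApplyDown (g : Equiv.Perm (Q × Γ)) : BSym Q Γ → BSym Q Γ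
  | .belt a b s => .belt a b s
  | .top q a b => .top q a b
  | .bot a q b => .bot a (g (q, b)).1 (g (q, b)).2

/-- `π` is the automorphism `f_g`, applying `g` to every head symbol. -/
def IsBeltGate (g : Equiv.Perm (Q × Γ)) (π : Equiv.Perm (ℤ → BSym Q Γ)) : Prop :=
  ∀ x i, π x i = beltGateApply g (x i)

/-- `π` is the automorphism `f_g^up`. -/
def IsBeltGateUp (g : Equiv.Perm (Q × Γ)) (π : Equiv.Perm (ℤ → BSym Q Γ)) : Prop :=
  ∀ x i, π x i = beltGateApplyUp g (x i)

/-- `π` is the automorphism `f_g^down`. -/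
def IsBeltGateDown (g : Equiv.Perm (Q × Γ)) (π : Equiv.Perm (ℤ → BSym Q Γ)) : Prop :=
  ∀ x i, π x i = beltGateApplyDown g (x i)

/-- Auxiliary: the cell is a top-track head in state `q` (about to move rightwards). -/
def fromLeftTop [DecidableEq Q] (q : Q) : BSym Q Γ → Bool
  | .top p _ _ => decide (p = q)
  | _ => false

/-- Auxiliary: the cell is a bottom-track head in state `q` (about to move leftwards). -/
def fromRightBot [DecidableEq Q] (q : Q) : BSym Q Γ → Bool
  | .bot _ p _ => decide (p = q)
  | _ => false

/-- The local rule of `ρ_q`: every head in state `q` moves one step forward along the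
cyclic tape of its own conveyor belt (rightwards on the top track, wrapping at the
block ends, leftwards on the bottom track). -/
def beltMoveFun [DecidableEq Q] (q : Q) (x : ℤ → BSym Q Γ) (i : ℤ) : BSym Q Γ :=
  match x i with
  | .top p a b =>
      if p = q then
        (if BSym.plusOrHead (x (i + 1)) = true then .bot a q b else .belt a b true)
      else .top p a b
  | .bot a p b =>
      if p = q then
        (if BSym.minusOrHead (x (i - 1)) = true then .top q a b else .belt a b false)
      else .bot a p b
  | .belt a b sg =>
      if sg = false ∧ fromLeftTop q (x (i - 1)) = true then .top q a b
      else if sg = true ∧ fromRightBot q (x (i + 1)) = true then .bot a q b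
      else .belt a b sg

/-- `π` is the automorphism `ρ_q`. -/
def IsBeltMove [DecidableEq Q] (q : Q) (π : Equiv.Perm (ℤ → BSym Q Γ)) : Prop :=
  ∀ x i, π x i = beltMoveFun q x i

/-- The generating set of the group `G` of Turing machine instructions on conveyor
belts. -/
def BeltGens (Q Γ : Type) [DecidableEq Q] : Set (Equiv.Perm (ℤ → BSym Q Γ)) :=
  {π | (∃ g, IsBeltGate g π) ∨ (∃ g, IsBeltGateUp g π) ∨ (∃ g, IsBeltGateDown g π) ∨
    (∃ q, IsBeltMove q π)}

/-- The sign of a cell: its conveyor bit if headless, else the sign component of the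
head's ghost (extracted by `sgn`). -/
def beltSign (sgn : Q → Bool) : BSym Q Γ → Bool
  | .belt _ _ s => s
  | .top q _ _ => sgn q
  | .bot _ q _ => sgn q

/-- The local rule of the automorphism `θ`, moving all heads one step to the right while
leaving all signs in place (`setSgn q s` replaces the sign component of the ghost of `q`
by `s`). -/
def thetaFun (sgn : Q → Bool) (setSgn : Q → Bool → Q) (x : ℤ → BSym Q Γ) (i : ℤ) :
    BSym Q Γ :=
  match x (i - 1) with
  | .top p _ _ =>
      .top (setSgn p (beltSign sgn (x i))) (BSym.topLetter (x i)) (BSym.botLetter (x i))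
  | .bot _ p _ =>
      .bot (BSym.topLetter (x i)) (setSgn p (beltSign sgn (x i))) (BSym.botLetter (x i))
  | .belt _ _ _ =>
      .belt (BSym.topLetter (x i)) (BSym.botLetter (x i)) (beltSign sgn (x i))

/-- `π` is the automorphism `θ`. -/
def IsTheta (sgn : Q → Bool) (setSgn : Q → Bool → Q)
    (π : Equiv.Perm (ℤ → BSym Q Γ)) : Prop :=
  ∀ x i, π x i = thetaFun sgn setSgn x i

/-- The generating set of the group `G_* = ⟨G ∪ {θ}⟩`. -/
def BeltGensStar (Q Γ : Type) [DecidableEq Q] (sgn : Q → Bool) (setSgn : Q → Bool → Q) :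
    Set (Equiv.Perm (ℤ → BSym Q Γ)) :=
  BeltGens Q Γ ∪ {π | IsTheta sgn setSgn π}

/-- The head-step function of the *reverse* of the SMART machine (the transition table with
all transitions reversed). -/
def smartStepBack : HeadStep SQ Letter := fun q a =>
  if q.2 = 0 then
    match q.1 with
    | .rf => Sum.inr (-1, (.rf, 1))  -- (▶₁, −1, ▶₂)
    | .lf => Sum.inr (1, (.lf, 1))   -- (◀₁, +1, ◀₂)
    | .rh => Sum.inr (-1, (.rh, 1))  -- (▷₁, −1, ▷₂)
    | .lh => Sum.inr (1, (.lh, 1))   -- (◁₁, +1, ◁₂)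
  else
    match q.1 with
    | .rf => Sum.inl (if a = 1 then ((.lf, 0), 0) else if a = 2 then ((.rh, 0), 0) else ((.rh, 0), 1))
    | .lf => Sum.inl (if a = 1 then ((.rf, 0), 0) else if a = 2 then ((.lh, 0), 0) else ((.lh, 0), 1))
    | .rh => Sum.inl (if a = 1 then ((.lf, 0), 1) else if a = 2 then ((.lf, 0), 2) else ((.lh, 0), 2))
    | .lh => Sum.inl (if a = 1 then ((.rf, 0), 1) else if a = 2 then ((.rf, 0), 2) else ((.rh, 0), 2))

/-- The state set of the decorated symmetrized SMART machine `S`: a SMART state, a duck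
`d ∈ {d_→, d_←}` (as `Fin 2`, `0 ↦ d_→`), and a ghost in `G = {0,…,5} ≃ {+1,−1}×{0,1,2}`
(as `Bool × Fin 3`). -/
abbrev QS : Type := SQ × Fin 2 × (Bool × Fin 3)

/-- The head-step function of the decorated symmetrized SMART machine: SMART forward in
time on duck `d_→`, backward in time on duck `d_←`, decorations carried unchanged. -/
def smartSymStep : HeadStep QS Letter := fun q a =>
  match (if q.2.1 = 0 then smartStep q.1 a else smartStepBack q.1 a) with
  | Sum.inl (q', b) => Sum.inl ((q', q.2), b)
  | Sum.inr (d, q') => Sum.inr (d, (q', q.2))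

/-- The sign component of the ghost of a state. -/
def sgnQS (q : QS) : Bool := q.2.2.1

/-- Replacing the sign component of the ghost of a state. -/
def setSgnQS (q : QS) (s : Bool) : QS := (q.1, q.2.1, (s, q.2.2.2))

/-! ### Heads on conveyor belts -/

namespace BSym

variable {Q Γ : Type}

/-- Exchange of the two tracks of a cell. -/
def flip : BSym Q Γ → BSym Q Γ
  | .belt a b s => .belt b a s
  | .top q a b => .bot b q a
  | .bot a q b => .top q b a

@[simp] theorem flip_flip (c : BSym Q Γ) : c.flip.flip = c := by
  cases c <;> rfl

@[simp] theorem plusOrHead_flip (c : BSym Q Γ) : c.flip.plusOrHead = c.plusOrHead := by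
  cases c <;> rfl

@[simp] theorem minusOrHead_flip (c : BSym Q Γ) : c.flip.minusOrHead = c.minusOrHead := by
  cases c <;> rfl

end BSym

section Realization

variable {Q Γ : Type}

/-- The inverse of the belt move of state `q`. -/
def beltBackFun [DecidableEq Q] (q : Q) (x : ℤ → BSym Q Γ) (i : ℤ) : BSym Q Γ :=
  (beltMoveFun q (fun j => (x j).flip) i).flip

set_option maxHeartbeats 2000000 in
theorem beltMove_beltBack [DecidableEq Q] (q : Q) (x : ℤ → BSym Q Γ) :
    beltMoveFun q (beltBackFun q x) = x := by
  funext i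
  have h1 : i + 1 - 1 = i := by ring
  have h2 : i - 1 + 1 = i := by ring
  rcases hi : x i with ⟨a, b, s⟩ | ⟨p, a, b⟩ | ⟨a, p, b⟩ <;>
  rcases hl : x (i - 1) with ⟨a1, b1, s1⟩ | ⟨p1, a1, b1⟩ | ⟨a1, p1, b1⟩ <;>
  rcases hr : x (i + 1) with ⟨a2, b2, s2⟩ | ⟨p2, a2, b2⟩ | ⟨a2, p2, b2⟩ <;>
  rcases hll : x (i - 1 - 1) with ⟨a3, b3, s3⟩ | ⟨p3, a3, b3⟩ | ⟨a3, p3, b3⟩ <;>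
  rcases hrr : x (i + 1 + 1) with ⟨a4, b4, s4⟩ | ⟨p4, a4, b4⟩ | ⟨a4, p4, b4⟩ <;>
  simp only [beltBackFun, beltMoveFun, BSym.flip, fromLeftTop, fromRightBot, BSym.plusOrHead,
    BSym.minusOrHead, hi, hl, hr, hll, hrr, h1, h2] <;>
  grind [BSym.flip, BSym.plusOrHead, BSym.minusOrHead, fromLeftTop, fromRightBot]

theorem beltBack_beltMove [DecidableEq Q] (q : Q) (x : ℤ → BSym Q Γ) :
    beltBackFun q (beltMoveFun q x) = x := by
  have h := beltMove_beltBack q (fun j => (x j).flip)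
  funext i
  have h' := congrFun h i
  have h2 : (fun j => (beltMoveFun q x j).flip) = beltBackFun q (fun j => (x j).flip) := by
    funext j
    simp [beltBackFun]
  rw [beltBackFun, h2, h', BSym.flip_flip]

/-- The belt move of state `q` as a permutation. -/
def beltMovePerm [DecidableEq Q] (q : Q) : Equiv.Perm (ℤ → BSym Q Γ) where
  toFun := beltMoveFun q
  invFun := beltBackFun q
  left_inv := beltBack_beltMove q
  right_inv := beltMove_beltBack q

theorem beltGateApply_inv (g : Equiv.Perm (Q × Γ)) (c : BSym Q Γ) :
    beltGateApply g⁻¹ (beltGateApply g c) = c := by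
  cases c <;> simp [beltGateApply]

/-- The belt gate of `g` as a permutation. -/
def beltGatePerm (g : Equiv.Perm (Q × Γ)) : Equiv.Perm (ℤ → BSym Q Γ) where
  toFun x i := beltGateApply g (x i)
  invFun x i := beltGateApply g⁻¹ (x i)
  left_inv x := by
    funext i
    exact beltGateApply_inv g (x i)
  right_inv x := by
    funext i
    simpa using beltGateApply_inv g⁻¹ (x i)

theorem cutAfter_beltMove [DecidableEq Q] (q : Q) {x : ℤ → BSym Q Γ} {i : ℤ}
    (h : cutAfter x i) : cutAfter (beltMoveFun q x) i := by
  have h1 : i + 1 - 1 = i := by ring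
  obtain ⟨ha, hb⟩ := h
  unfold cutAfter
  rcases hi : x i with ⟨a, b, s⟩ | ⟨p, a, b⟩ | ⟨a, p, b⟩ <;>
  rcases hr : x (i + 1) with ⟨a2, b2, s2⟩ | ⟨p2, a2, b2⟩ | ⟨a2, p2, b2⟩ <;>
  rw [hi] at ha <;> rw [hr] at hb <;>
  simp only [beltMoveFun, fromLeftTop, fromRightBot, BSym.plusOrHead,
    BSym.minusOrHead, hi, hr, h1] at ha hb ⊢ <;>
  grind [BSym.plusOrHead, BSym.minusOrHead]

theorem cutAfter_flip {x : ℤ → BSym Q Γ} {i : ℤ} :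
    cutAfter (fun j => (x j).flip) i ↔ cutAfter x i := by
  simp [cutAfter]

theorem cutAfter_beltBack [DecidableEq Q] (q : Q) {x : ℤ → BSym Q Γ} {i : ℤ}
    (h : cutAfter x i) : cutAfter (beltBackFun q x) i :=
  cutAfter_flip.2 (cutAfter_beltMove q (cutAfter_flip.2 h))

theorem cutAfter_beltGate (g : Equiv.Perm (Q × Γ)) {x : ℤ → BSym Q Γ} {i : ℤ}
    (h : cutAfter x i) : cutAfter (fun j => beltGateApply g (x j)) i := by
  obtain ⟨ha, hb⟩ := h
  unfold cutAfter
  cases hi : x i <;> cases hr : x (i + 1) <;>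
    simp_all [beltGateApply, BSym.plusOrHead, BSym.minusOrHead]

/-- The content of the cell `j` of a block `[s, e]` whose head is in state `q` at position `P`
of the belt, the letter at position `t` being `lam t`. -/
def beltCell (s e : ℤ) (q : Q) (P : ℤ) (lam : ℤ → Γ) (j : ℤ) : BSym Q Γ :=
  if j - s = P then .top q (lam (j - s)) (lam (2 * e - s + 1 - j))
  else if 2 * e - s + 1 - j = P then .bot (lam (j - s)) q (lam (2 * e - s + 1 - j))
  else .belt (lam (j - s)) (lam (2 * e - s + 1 - j))
    (decide (j - s < P ∧ P < 2 * e - s + 1 - j))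

/-- `[s, e]` is cut out of `x` and carries the belt with head in state `q` at position `P` and
letters `lam`. -/
structure BeltRep (x : ℤ → BSym Q Γ) (s e : ℤ) (q : Q) (P : ℤ) (lam : ℤ → Γ) : Prop where
  le : s ≤ e
  nonneg : 0 ≤ P
  lt : P < 2 * (e - s + 1)
  cutLeft : cutAfter x (s - 1)
  cutRight : cutAfter x e
  cell : ∀ j, s ≤ j → j ≤ e → x j = beltCell s e q P lam j

/-- `[s, e]` is a block of `x` without heads. -/
structure HeadlessBlock (x : ℤ → BSym Q Γ) (s e : ℤ) : Prop where
  isBlock : IsBlock x s e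
  headless : ∀ j, s ≤ j → j ≤ e → (x j).isHead = false

theorem BeltRep.isBlock {x : ℤ → BSym Q Γ} {s e : ℤ} {q : Q} {P : ℤ} {lam : ℤ → Γ}
    (h : BeltRep x s e q P lam) : IsBlock x s e := by
  refine ⟨h.le, h.cutLeft, h.cutRight, fun j hj hje hc => ?_⟩
  obtain ⟨ha, hb⟩ := hc
  rw [h.cell j hj hje.le] at ha
  rw [h.cell (j + 1) (by omega) (by omega)] at hb
  have h0 := h.nonneg
  have h1 := h.lt
  unfold beltCell at ha hb
  split_ifs at ha hb <;> simp_all [BSym.plusOrHead, BSym.minusOrHead] <;> omega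

theorem BeltRep.move [DecidableEq Q] {x : ℤ → BSym Q Γ} {s e : ℤ} {q : Q} {P : ℤ} {lam : ℤ → Γ}
    (h : BeltRep x s e q P lam) :
    BeltRep (beltMoveFun q x) s e q (if P = 2 * (e - s) + 1 then 0 else P + 1) lam := by
  have hle := h.le
  have h0 := h.nonneg
  have h1 := h.lt
  have hP' : P = 2 * (e - s) + 1 ∧ (if P = 2 * (e - s) + 1 then 0 else P + 1) = 0 ∨
      P < 2 * (e - s) + 1 ∧ (if P = 2 * (e - s) + 1 then 0 else P + 1) = P + 1 := by
    split_ifs <;> omega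
  generalize (if P = 2 * (e - s) + 1 then 0 else P + 1) = P' at hP'
  refine ⟨h.le, by omega, by omega, cutAfter_beltMove q h.cutLeft,
    cutAfter_beltMove q h.cutRight, ?_⟩
  intro j hj hje
  have hl : s ≤ j - 1 → x (j - 1) = beltCell s e q P lam (j - 1) :=
    fun h' => h.cell _ h' (by omega)
  have hr : j + 1 ≤ e → x (j + 1) = beltCell s e q P lam (j + 1) :=
    fun h' => h.cell _ (by omega) h'
  have cl : j = s → (x (j - 1)).minusOrHead = true := by
    rintro rfl
    exact h.cutLeft.1
  have cr : j = e → (x (j + 1)).plusOrHead = true := by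
    rintro rfl
    exact h.cutRight.2
  have hc := h.cell j hj hje
  by_cases hP : j - s = P
  · have hc' : x j = .top q (lam (j - s)) (lam (2 * e - s + 1 - j)) := by
      rw [hc, beltCell, if_pos hP]
    simp only [beltMoveFun, hc', if_true]
    by_cases hje' : j = e
    · rw [if_pos (cr hje'), beltCell, if_neg, if_pos]
      all_goals omega
    · have h2 : x (j + 1) = .belt (lam (j + 1 - s)) (lam (2 * e - s + 1 - (j + 1))) false := by
        rw [hr (by omega), beltCell, if_neg (by omega), if_neg (by omega)]
        congr 1
        simp
        omega
      rw [h2, if_neg (by simp [BSym.plusOrHead]), beltCell, if_neg, if_neg]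
      · congr 1
        symm
        simp only [decide_eq_true_eq]
        omega
      all_goals omega
  by_cases hP2 : 2 * e - s + 1 - j = P
  · have hc' : x j = .bot (lam (j - s)) q (lam (2 * e - s + 1 - j)) := by
      rw [hc, beltCell, if_neg hP, if_pos hP2]
    simp only [beltMoveFun, hc', if_true]
    by_cases hje' : j = s
    · rw [if_pos (cl hje'), beltCell, if_pos]
      omega
    · have h2 : x (j - 1) = .belt (lam (j - 1 - s)) (lam (2 * e - s + 1 - (j - 1))) true := by
        rw [hl (by omega), beltCell, if_neg (by omega), if_neg (by omega)]
        congr 1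
        simp
        omega
      rw [h2, if_neg (by simp [BSym.minusOrHead]), beltCell, if_neg, if_neg]
      · congr 1
        symm
        simp only [decide_eq_false_iff_not]
        omega
      all_goals omega
  have hc' : x j = .belt (lam (j - s)) (lam (2 * e - s + 1 - j))
      (decide (j - s < P ∧ P < 2 * e - s + 1 - j)) := by
    rw [hc, beltCell, if_neg hP, if_neg hP2]
  simp only [beltMoveFun, hc']
  by_cases h3 : j - s = P + 1
  · have h2 : x (j - 1) = .top q (lam (j - 1 - s)) (lam (2 * e - s + 1 - (j - 1))) := by
      rw [hl (by omega), beltCell, if_pos (by omega)]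
    rw [if_pos, beltCell, if_pos]
    · omega
    · simp [h2, fromLeftTop]
      omega
  by_cases h4 : 2 * e - s + 1 - j = P + 1
  · have h2 : x (j + 1) = .bot (lam (j + 1 - s)) q (lam (2 * e - s + 1 - (j + 1))) := by
      rw [hr (by omega), beltCell, if_neg (by omega), if_pos (by omega)]
    rw [if_neg, if_pos, beltCell, if_neg, if_pos]
    · omega
    · omega
    · simp [h2, fromRightBot]
      omega
    · simp
      omega
  rw [if_neg, if_neg, beltCell, if_neg, if_neg]
  · congr 1
    simp only [decide_eq_decide]
    omega
  · omega
  · omega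
  · rintro ⟨h5, h6⟩
    simp only [decide_eq_true_eq] at h5
    rw [hr (by omega), beltCell] at h6
    split_ifs at h6 <;> first | omega | simp [fromRightBot] at h6
  · rintro ⟨h5, h6⟩
    simp only [decide_eq_false_iff_not] at h5
    rw [hl (by omega), beltCell] at h6
    split_ifs at h6 <;> first | omega | simp [fromLeftTop] at h6

theorem BeltRep.move_of_ne [DecidableEq Q] {x : ℤ → BSym Q Γ} {s e : ℤ} {q q' : Q} {P : ℤ}
    {lam : ℤ → Γ} (h : BeltRep x s e q P lam) (hq : q ≠ q') :
    BeltRep (beltMoveFun q' x) s e q P lam := by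
  have hle := h.le
  have h0 := h.nonneg
  have h1 := h.lt
  refine ⟨h.le, h0, h1, cutAfter_beltMove q' h.cutLeft, cutAfter_beltMove q' h.cutRight, ?_⟩
  intro j hj hje
  have hl : s ≤ j - 1 → x (j - 1) = beltCell s e q P lam (j - 1) :=
    fun h' => h.cell _ h' (by omega)
  have hr : j + 1 ≤ e → x (j + 1) = beltCell s e q P lam (j + 1) :=
    fun h' => h.cell _ (by omega) h'
  rw [← h.cell j hj hje]
  have hc := h.cell j hj hje
  unfold beltMoveFun
  unfold beltCell at hc
  split_ifs at hc with h2 h3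
  · simp [hc, hq]
  · simp [hc, hq]
  · simp only [hc]
    rw [if_neg, if_neg]
    · rintro ⟨h5, h6⟩
      simp only [decide_eq_true_eq] at h5
      rw [hr (by omega), beltCell] at h6
      split_ifs at h6 <;> simp [fromRightBot, hq] at h6
    · rintro ⟨h5, h6⟩
      simp only [decide_eq_false_iff_not] at h5
      rw [hl (by omega), beltCell] at h6
      split_ifs at h6 <;> simp [fromLeftTop, hq] at h6

theorem BeltRep.flip {x : ℤ → BSym Q Γ} {s e : ℤ} {q : Q} {P : ℤ} {lam : ℤ → Γ}
    (h : BeltRep x s e q P lam) :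
    BeltRep (fun j => (x j).flip) s e q (2 * (e - s) + 1 - P)
      (fun t => lam (2 * (e - s) + 1 - t)) := by
  have hle := h.le
  have h0 := h.nonneg
  have h1 := h.lt
  refine ⟨h.le, by omega, by omega, cutAfter_flip.2 h.cutLeft, cutAfter_flip.2 h.cutRight, ?_⟩
  intro j hj hje
  have e1 : 2 * (e - s) + 1 - (j - s) = 2 * e - s + 1 - j := by ring
  have e2 : 2 * (e - s) + 1 - (2 * e - s + 1 - j) = j - s := by ring
  simp only [h.cell j hj hje, beltCell, e1, e2]
  split_ifs <;> first | omega | simp only [BSym.flip]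
  congr 1
  simp only [decide_eq_decide]
  omega

theorem BeltRep.congr {x : ℤ → BSym Q Γ} {s e : ℤ} {q : Q} {P P' : ℤ} {lam lam' : ℤ → Γ}
    (h : BeltRep x s e q P lam) (hP : P = P')
    (hlam : ∀ t, 0 ≤ t → t < 2 * (e - s + 1) → lam t = lam' t) :
    BeltRep x s e q P' lam' := by
  subst hP
  refine ⟨h.le, h.nonneg, h.lt, h.cutLeft, h.cutRight, fun j hj hje => ?_⟩
  rw [h.cell j hj hje, beltCell, beltCell, hlam _ (by omega) (by omega),
    hlam _ (by omega) (by omega)]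

theorem BeltRep.back [DecidableEq Q] {x : ℤ → BSym Q Γ} {s e : ℤ} {q : Q} {P : ℤ} {lam : ℤ → Γ}
    (h : BeltRep x s e q P lam) :
    BeltRep (beltBackFun q x) s e q (if P = 0 then 2 * (e - s) + 1 else P - 1) lam := by
  refine h.flip.move.flip.congr ?_ fun t _ _ => ?_
  · split_ifs <;> omega
  · simp

theorem BeltRep.back_of_ne [DecidableEq Q] {x : ℤ → BSym Q Γ} {s e : ℤ} {q q' : Q} {P : ℤ}
    {lam : ℤ → Γ} (h : BeltRep x s e q P lam) (hq : q ≠ q') :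
    BeltRep (beltBackFun q' x) s e q P lam := by
  refine (h.flip.move_of_ne hq).flip.congr ?_ fun t _ _ => ?_
  · omega
  · simp

theorem BeltRep.gate (g : Equiv.Perm (Q × Γ)) {x : ℤ → BSym Q Γ} {s e : ℤ} {q : Q} {P : ℤ}
    {lam : ℤ → Γ} (h : BeltRep x s e q P lam) :
    BeltRep (fun j => beltGateApply g (x j)) s e (g (q, lam P)).1 P
      (Function.update lam P (g (q, lam P)).2) := by
  have hle := h.le
  refine ⟨h.le, h.nonneg, h.lt, cutAfter_beltGate g h.cutLeft, cutAfter_beltGate g h.cutRight,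
    fun j hj hje => ?_⟩
  rw [h.cell j hj hje]
  unfold beltCell
  split_ifs with h1 h2
  · rw [h1, Function.update_self, Function.update_of_ne (by omega)]
    rfl
  · rw [h2, Function.update_self, Function.update_of_ne (by omega)]
    rfl
  · rw [Function.update_of_ne (by omega), Function.update_of_ne (by omega)]
    rfl

theorem HeadlessBlock.fixed {x y : ℤ → BSym Q Γ} {s e : ℤ} (h : HeadlessBlock x s e)
    (hy : ∀ j, s ≤ j → j ≤ e → y j = x j) (hl : cutAfter y (s - 1)) (hr : cutAfter y e) :
    HeadlessBlock y s e := by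
  refine ⟨⟨h.isBlock.1, hl, hr, fun j hj hje hc => h.isBlock.2.2.2 j hj hje ?_⟩, ?_⟩
  · rwa [cutAfter, hy j hj hje.le, hy (j + 1) (by omega) (by omega)] at hc
  · intro j hj hje
    rw [hy j hj hje, h.headless j hj hje]

theorem HeadlessBlock.move_eq [DecidableEq Q] (q : Q) {x : ℤ → BSym Q Γ} {s e : ℤ}
    (h : HeadlessBlock x s e) {j : ℤ} (hj : s ≤ j) (hje : j ≤ e) :
    beltMoveFun q x j = x j := by
  have hp := h.isBlock.2.1.2
  have hm := h.isBlock.2.2.1.1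
  rw [sub_add_cancel] at hp
  have h0 := h.headless j hj hje
  rcases hi : x j with ⟨a, b, sg⟩ | ⟨p, a, b⟩ | ⟨a, p, b⟩
  · simp only [beltMoveFun, hi]
    rw [if_neg, if_neg]
    · rintro ⟨rfl, h6⟩
      have : j ≠ e := by
        rintro rfl
        simp [hi, BSym.minusOrHead] at hm
      have h2 := h.headless (j + 1) (by omega) (by omega)
      cases h3 : x (j + 1) <;> simp_all [fromRightBot, BSym.isHead]
    · rintro ⟨rfl, h6⟩
      have : j ≠ s := by
        rintro rfl
        simp [hi, BSym.plusOrHead] at hp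
      have h2 := h.headless (j - 1) (by omega) (by omega)
      cases h3 : x (j - 1) <;> simp_all [fromLeftTop, BSym.isHead]
  · simp [hi, BSym.isHead] at h0
  · simp [hi, BSym.isHead] at h0

theorem HeadlessBlock.flip {x : ℤ → BSym Q Γ} {s e : ℤ} (h : HeadlessBlock x s e) :
    HeadlessBlock (fun j => (x j).flip) s e := by
  refine ⟨⟨h.isBlock.1, cutAfter_flip.2 h.isBlock.2.1, cutAfter_flip.2 h.isBlock.2.2.1,
    fun j hj hje hc => h.isBlock.2.2.2 j hj hje (cutAfter_flip.1 hc)⟩, fun j hj hje => ?_⟩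
  have := h.headless j hj hje
  cases h3 : x j <;> simp_all [BSym.flip, BSym.isHead]

theorem HeadlessBlock.back_eq [DecidableEq Q] (q : Q) {x : ℤ → BSym Q Γ} {s e : ℤ}
    (h : HeadlessBlock x s e) {j : ℤ} (hj : s ≤ j) (hje : j ≤ e) :
    beltBackFun q x j = x j := by
  rw [beltBackFun, h.flip.move_eq q hj hje, BSym.flip_flip]

theorem HeadlessBlock.gate_eq (g : Equiv.Perm (Q × Γ)) {x : ℤ → BSym Q Γ} {s e : ℤ}
    (h : HeadlessBlock x s e) {j : ℤ} (hj : s ≤ j) (hje : j ≤ e) :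
    beltGateApply g (x j) = x j := by
  have := h.headless j hj hje
  cases h3 : x j <;> simp_all [beltGateApply, BSym.isHead]

/-- Every block with a head carries a belt. -/
theorem exists_beltRep {x : ℤ → BSym Q Γ} {s e : ℤ} (hb : IsBlock x s e)
    (hh : BlockHasHead x s e) : ∃ q P lam, BeltRep x s e q P lam := by
  obtain ⟨hle, hcl, hcr, hno⟩ := hb
  obtain ⟨k, hk, hke, hkh⟩ := hh
  have right : ∀ n : ℕ, k + 1 + n ≤ e → ∃ a b, x (k + 1 + n) = .belt a b false := by
    intro n
    induction n with
    | zero =>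
      intro hn
      have h1 := hno k hk (by push_cast at hn; omega)
      cases h2 : x k <;> cases h3 : x (k + 1) <;>
        simp_all [cutAfter, BSym.isHead, BSym.plusOrHead, BSym.minusOrHead]
    | succ n ih =>
      intro hn
      push_cast at hn
      obtain ⟨a, b, h1⟩ := ih (by omega)
      have h2 := hno (k + 1 + n) (by omega) (by omega)
      have h4 : k + 1 + ((n + 1 : ℕ) : ℤ) = k + 1 + n + 1 := by push_cast; ring
      rw [h4]
      cases h3 : x (k + 1 + n + 1) <;>
        simp_all [cutAfter, BSym.plusOrHead, BSym.minusOrHead]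
  have left : ∀ n : ℕ, s ≤ k - 1 - n → ∃ a b, x (k - 1 - n) = .belt a b true := by
    intro n
    induction n with
    | zero =>
      intro hn
      have h1 := hno (k - 1) (by push_cast at hn; omega) (by omega)
      cases h2 : x k <;> cases h3 : x (k - 1) <;>
        simp_all [cutAfter, BSym.isHead, BSym.plusOrHead, BSym.minusOrHead]
    | succ n ih =>
      intro hn
      push_cast at hn
      obtain ⟨a, b, h1⟩ := ih (by omega)
      have h2 := hno (k - 1 - n - 1) (by omega) (by omega)
      have h4 : k - 1 - ((n + 1 : ℕ) : ℤ) = k - 1 - n - 1 := by push_cast; ring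
      rw [h4]
      cases h3 : x (k - 1 - n - 1) <;>
        simp_all [cutAfter, BSym.plusOrHead, BSym.minusOrHead]
  have hright : ∀ j, k < j → j ≤ e → ∃ a b, x j = .belt a b false := by
    intro j hj hje
    have := right (j - k - 1).toNat (by omega)
    rwa [show k + 1 + ((j - k - 1).toNat : ℤ) = j by omega] at this
  have hleft : ∀ j, j < k → s ≤ j → ∃ a b, x j = .belt a b true := by
    intro j hj hje
    have := left (k - 1 - j).toNat (by omega)
    rwa [show k - 1 - ((k - 1 - j).toNat : ℤ) = j by omega] at this
  let lam : ℤ → Γ := fun t =>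
    if t ≤ e - s then (x (s + t)).topLetter else (x (2 * e - s + 1 - t)).botLetter
  have lam1 : ∀ j, s ≤ j → j ≤ e → lam (j - s) = (x j).topLetter := by
    intro j hj hje
    simp only [lam]
    rw [if_pos (by omega)]
    congr 2
    ring
  have lam2 : ∀ j, s ≤ j → j ≤ e → lam (2 * e - s + 1 - j) = (x j).botLetter := by
    intro j hj hje
    simp only [lam]
    rw [if_neg (by omega)]
    congr 2
    ring
  have key : ∀ q P, 0 ≤ P → P < 2 * (e - s + 1) → (P = k - s ∨ P = 2 * e - s + 1 - k) →
      x k = beltCell s e q P lam k → BeltRep x s e q P lam := by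
    intro q P h0 h1 hP hx
    refine ⟨hle, h0, h1, hcl, hcr, fun j hj hje => ?_⟩
    rcases lt_trichotomy j k with h | rfl | h
    · obtain ⟨a, b, h2⟩ := hleft j h hj
      rw [beltCell, if_neg (by omega), if_neg (by omega), lam1 j hj hje, lam2 j hj hje, h2]
      simp only [BSym.topLetter, BSym.botLetter]
      congr 1
      simp
      omega
    · exact hx
    · obtain ⟨a, b, h2⟩ := hright j h hje
      rw [beltCell, if_neg (by omega), if_neg (by omega), lam1 j hj hje, lam2 j hj hje, h2]
      simp only [BSym.topLetter, BSym.botLetter]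
      congr 1
      simp
      omega
  rcases hi : x k with ⟨a, b, sg⟩ | ⟨p, a, b⟩ | ⟨a, p, b⟩
  · simp [hi, BSym.isHead] at hkh
  · refine ⟨p, k - s, lam, key _ _ (by omega) (by omega) (Or.inl rfl) ?_⟩
    rw [beltCell, if_pos rfl, lam1 k hk hke, lam2 k hk hke, hi]
    rfl
  · refine ⟨p, 2 * e - s + 1 - k, lam, key _ _ (by omega) (by omega) (Or.inr rfl) ?_⟩
    rw [beltCell, if_neg (by omega), if_pos rfl, lam1 k hk hke, lam2 k hk hke, hi]
    rfl

theorem BeltRep.sign {x : ℤ → BSym Q Γ} {s e : ℤ} {q : Q} {P : ℤ} {lam : ℤ → Γ}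
    (h : BeltRep x s e q P lam) (j k : ℤ) (hj : s ≤ j) (hje : j ≤ e) (hk : s ≤ k) (hke : k ≤ e)
    (hh : (x k).isHead = true) (a b : Γ) (sg : Bool) (hx : x j = .belt a b sg) :
    sg = true ↔ j < k := by
  rw [h.cell _ hk hke, beltCell] at hh
  rw [h.cell _ hj hje, beltCell] at hx
  split_ifs at hh hx <;> simp_all [BSym.isHead]
  all_goals obtain ⟨-, -, rfl⟩ := hx; simp; omega

/-- The cyclic word with letters `lam` and head in state `q` at position `P`. -/
def ringWord (ℓ : ℕ) (q : Q) (P : ℤ) (lam : ℤ → Γ) : ZMod ℓ → TSym Q Γ :=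
  fun t => if (t.val : ℤ) = P then Sum.inr (q, lam P) else Sum.inl (lam t.val)

theorem BeltRep.unfoldBlock {x : ℤ → BSym Q Γ} {s e : ℤ} {q : Q} {P : ℤ} {lam : ℤ → Γ}
    (h : BeltRep x s e q P lam) : unfoldBlock x s e = ringWord _ q P lam := by
  have hle := h.le
  funext t
  have : NeZero (2 * (e - s + 1).toNat) := ⟨by omega⟩
  have ht := ZMod.val_lt t
  unfold _root_.unfoldBlock ringWord
  split_ifs with h1 h2 h2
  · rw [h.cell _ (by omega) (by omega), beltCell, if_pos (by omega)]
    simp [BSym.topSym, ← h2]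
  · rw [h.cell _ (by omega) (by omega), beltCell, if_neg (by omega)]
    split_ifs <;> simp [BSym.topSym]
  · rw [h.cell _ (by omega) (by omega), beltCell, if_neg (by omega), if_pos (by omega)]
    simp only [BSym.botSym]
    congr 3
    omega
  · rw [h.cell _ (by omega) (by omega), beltCell]
    have h3 : 2 * e - s + 1 - (e - ((t.val - (e - s + 1).toNat : ℕ) : ℤ)) = t.val := by omega
    rw [h3, if_neg h2]
    split_ifs <;> rfl

end Realization

/-! ### Relative configurations -/

/-- A head state of the SMART machine, the word of its belt read from the head on, and the
position of the head. -/
abbrev Core : Type := SQ × List Letter × ℤ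

/-- The decorations: a duck and a ghost. -/
abbrev Decor : Type := Fin 2 × (Bool × Fin 3)

/-- A decorated relative configuration. -/
abbrev Conf : Type := Core × Decor

/-- The letter at position `t` of the belt with word `v` and head position `p`. -/
def ringLetter (v : List Letter) (p t : ℤ) : Letter :=
  v.getD ((t - p) % v.length).toNat 0

/-- The block `[s, e]` of `x` carries the belt `κ`. -/
structure CRep (x : ℤ → BSym QS Letter) (s e : ℤ) (κ : Conf) : Prop where
  length : (κ.1.2.1.length : ℤ) = 2 * (e - s + 1)
  beltRep : BeltRep x s e (κ.1.1, κ.2) (κ.1.2.2 % κ.1.2.1.length)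
    (ringLetter κ.1.2.1 κ.1.2.2)

/-- Rotation of a word by one letter to the left. -/
def rotL {α : Type*} : Equiv.Perm (List α) where
  toFun v := v.rotate 1
  invFun v := v.rotate (v.length - 1)
  left_inv v := by
    cases v with
    | nil => simp
    | cons a t =>
      beta_reduce
      rw [List.length_rotate, List.rotate_rotate]
      have : 1 + ((a :: t).length - 1) = (a :: t).length := by simp; omega
      rw [this, List.rotate_length]
  right_inv v := by
    cases v with
    | nil => simp
    | cons a t =>
      beta_reduce
      rw [List.rotate_rotate]
      have : ((a :: t).length - 1) + 1 = (a :: t).length := by simp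
      rw [this, List.rotate_length]

@[simp] theorem rotL_cons {α : Type*} (a : α) (t : List α) : rotL (a :: t) = t ++ [a] := by
  simp [rotL]

@[simp] theorem length_rotL {α : Type*} (v : List α) : (rotL v).length = v.length := by
  simp [rotL]

@[simp] theorem length_rotL_symm {α : Type*} (v : List α) :
    (rotL.symm v).length = v.length := by
  rw [← length_rotL (rotL.symm v), Equiv.apply_symm_apply]

@[simp] theorem rotL_symm_append {α : Type*} (t : List α) (a : α) :
    rotL.symm (t ++ [a]) = a :: t := by
  rw [Equiv.symm_apply_eq, rotL_cons]

/-- The move of all heads whose state lies in `A`. -/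
def mvS {X : Type*} (A : X → Prop) [DecidablePred A] : Equiv.Perm (X × List Letter × ℤ) where
  toFun κ := if A κ.1 then (κ.1, rotL κ.2.1, κ.2.2 + 1) else κ
  invFun κ := if A κ.1 then (κ.1, rotL.symm κ.2.1, κ.2.2 - 1) else κ
  left_inv κ := by
    by_cases h : A κ.1 <;> simp [h]
  right_inv κ := by
    by_cases h : A κ.1 <;> simp [h]

/-- The action of a permutation of pairs of a state and the letter under the head. -/
def gateS {X : Type*} (g : Equiv.Perm (X × Letter)) : Equiv.Perm (X × List Letter × ℤ) where
  toFun κ := match κ with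
    | (x, [], p) => (x, [], p)
    | (x, a :: t, p) => ((g (x, a)).1, (g (x, a)).2 :: t, p)
  invFun κ := match κ with
    | (x, [], p) => (x, [], p)
    | (x, a :: t, p) => ((g.symm (x, a)).1, (g.symm (x, a)).2 :: t, p)
  left_inv κ := by
    obtain ⟨x, _ | ⟨a, t⟩, p⟩ := κ <;> simp
  right_inv κ := by
    obtain ⟨x, _ | ⟨a, t⟩, p⟩ := κ <;> simp

@[simp] theorem gateS_cons {X : Type*} (g : Equiv.Perm (X × Letter)) (x : X) (a : Letter)
    (t : List Letter) (p : ℤ) :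
    gateS g (x, a :: t, p) = ((g (x, a)).1, (g (x, a)).2 :: t, p) := rfl

@[simp] theorem gateS_nil {X : Type*} (g : Equiv.Perm (X × Letter)) (x : X) (p : ℤ) :
    gateS g (x, [], p) = (x, [], p) := rfl

theorem gateS_inv {X : Type*} (g : Equiv.Perm (X × Letter)) :
    (gateS g)⁻¹ = gateS g⁻¹ := by
  ext κ : 1
  obtain ⟨x, _ | ⟨a, t⟩, p⟩ := κ <;> rfl

theorem mvS_pos {X : Type*} (A : X → Prop) [DecidablePred A] {x : X} (hx : A x)
    (v : List Letter) (p : ℤ) : mvS A (x, v, p) = (x, rotL v, p + 1) := if_pos hx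

theorem mvS_neg {X : Type*} (A : X → Prop) [DecidablePred A] {x : X} (hx : ¬ A x)
    (v : List Letter) (p : ℤ) : mvS A (x, v, p) = (x, v, p) := if_neg hx

theorem mvS_inv_pos {X : Type*} (A : X → Prop) [DecidablePred A] {x : X} (hx : A x)
    (v : List Letter) (p : ℤ) : (mvS A)⁻¹ (x, v, p) = (x, rotL.symm v, p - 1) := if_pos hx

theorem mvS_inv_neg {X : Type*} (A : X → Prop) [DecidablePred A] {x : X} (hx : ¬ A x)
    (v : List Letter) (p : ℤ) : (mvS A)⁻¹ (x, v, p) = (x, v, p) := if_neg hx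

/-- Regrouping of a decorated configuration. -/
def confEquiv : (QS × List Letter × ℤ) ≃ Conf where
  toFun κ := ((κ.1.1, κ.2), κ.1.2)
  invFun κ := ((κ.1.1, κ.2), κ.1.2)
  left_inv _ := rfl
  right_inv _ := rfl

/-- The gate of `g` on decorated configurations. -/
def gate (g : Equiv.Perm (QS × Letter)) : Equiv.Perm Conf := confEquiv.permCongr (gateS g)

/-- The move of the heads in states `A` on decorated configurations. -/
def move (A : QS → Prop) [DecidablePred A] : Equiv.Perm Conf := confEquiv.permCongr (mvS A)

theorem ringLetter_rotL (v : List Letter) (p t : ℤ) :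
    ringLetter (rotL v) (p + 1) t = ringLetter v p t := by
  rcases v with _ | ⟨a, w⟩
  · rfl
  set v := a :: w with hv
  have hpos : 0 < v.length := by simp [hv]
  have hpos' : (0 : ℤ) < v.length := by exact_mod_cast hpos
  have h1 := Int.emod_nonneg (t - (p + 1)) hpos'.ne'
  have h2 := Int.emod_lt_of_pos (t - (p + 1)) hpos'
  have h3 := Int.emod_nonneg (t - p) hpos'.ne'
  have h4 := Int.emod_lt_of_pos (t - p) hpos'
  unfold ringLetter
  rw [length_rotL, List.getD_eq_getElem _ _ (by rw [length_rotL]; omega),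
    List.getD_eq_getElem _ _ (by omega)]
  simp only [rotL, Equiv.coe_fn_mk, List.getElem_rotate]
  congr 1
  zify
  rw [Int.toNat_of_nonneg h1, Int.toNat_of_nonneg h3]
  have : t - p = t - (p + 1) + 1 := by ring
  rw [this, Int.emod_add_emod]

theorem CRep.of_modEq {x : ℤ → BSym QS Letter} {s e : ℤ} {q : SQ} {v : List Letter} {p p' : ℤ}
    {d : Decor} (h : CRep x s e ((q, v, p), d)) (hp : p ≡ p' [ZMOD v.length]) :
    CRep x s e ((q, v, p'), d) := by
  refine ⟨h.length, h.beltRep.congr hp fun t _ _ => ?_⟩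
  have : (t - p) % (v.length : ℤ) = (t - p') % (v.length : ℤ) := (Int.ModEq.refl t).sub hp
  simp only [ringLetter, this]

theorem CRep.move {x : ℤ → BSym QS Letter} {s e : ℤ} {q : SQ} {v : List Letter} {p : ℤ}
    {d : Decor} (h : CRep x s e ((q, v, p), d)) :
    CRep (beltMoveFun (q, d) x) s e ((q, rotL v, p + 1), d) := by
  have hl := h.length
  have hle := h.beltRep.le
  simp only at hl
  refine ⟨by simpa using h.length, h.beltRep.move.congr ?_ fun t _ _ => ?_⟩
  · simp only [length_rotL, hl]
    have h1 := Int.emod_nonneg p (b := 2 * (e - s + 1)) (by omega)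
    have h2 := Int.emod_lt_of_pos p (b := 2 * (e - s + 1)) (by omega)
    rw [Int.add_emod, Int.emod_eq_of_lt (a := 1) (by omega) (by omega)]
    split_ifs with h3
    · rw [h3, show 2 * (e - s) + 1 + 1 = 2 * (e - s + 1) by ring, Int.emod_self]
    · exact (Int.emod_eq_of_lt (by omega) (by omega)).symm
  · exact (ringLetter_rotL v p t).symm

theorem CRep.back {x : ℤ → BSym QS Letter} {s e : ℤ} {q : SQ} {v : List Letter} {p : ℤ}
    {d : Decor} (h : CRep x s e ((q, v, p), d)) :
    CRep (beltBackFun (q, d) x) s e ((q, rotL.symm v, p - 1), d) := by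
  have hl := h.length
  have hle := h.beltRep.le
  simp only at hl
  refine ⟨by simpa using h.length, h.beltRep.back.congr ?_ fun t _ _ => ?_⟩
  · simp only [length_rotL_symm, hl]
    have h1 := Int.emod_nonneg p (b := 2 * (e - s + 1)) (by omega)
    have h2 := Int.emod_lt_of_pos p (b := 2 * (e - s + 1)) (by omega)
    rw [Int.sub_emod, Int.emod_eq_of_lt (a := 1) (by omega) (by omega)]
    split_ifs with h3
    · rw [h3, ← Int.add_emod_right, Int.emod_eq_of_lt (by omega) (by omega)]
      ring
    · exact (Int.emod_eq_of_lt (by omega) (by omega)).symm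
  · have := ringLetter_rotL (rotL.symm v) (p - 1) t
    simpa using this

theorem CRep.gate {x : ℤ → BSym QS Letter} {s e : ℤ} {κ : Conf} (h : CRep x s e κ)
    (g : Equiv.Perm (QS × Letter)) :
    CRep (fun j => beltGateApply g (x j)) s e (gate g κ) := by
  obtain ⟨⟨q, v, p⟩, d⟩ := κ
  have hl := h.length
  have hle := h.beltRep.le
  simp only at hl
  rcases v with _ | ⟨a, w⟩
  · simp at hl
    omega
  have e1 : ringLetter (a :: w) p (p % (a :: w).length) = a := by
    unfold ringLetter
    rw [show (p % ((a :: w).length : ℤ) - p) % ((a :: w).length : ℤ) = 0 by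
      rw [Int.emod_sub_emod, sub_self, Int.zero_emod]]
    rfl
  have hb := h.beltRep.gate g
  simp only [e1] at hb
  refine ⟨by simpa [_root_.gate, confEquiv] using h.length, hb.congr ?_ fun t h0 h1 => ?_⟩
  · simp [_root_.gate, confEquiv]
  · simp only [_root_.gate, confEquiv, Equiv.permCongr_apply, Equiv.coe_fn_mk,
      Equiv.coe_fn_symm_mk, gateS_cons]
    by_cases ht : t = p % (a :: w).length
    · subst ht
      rw [Function.update_self]
      unfold ringLetter
      rw [show (p % ((a :: w).length : ℤ) - p) %
        (((g ((q, d), a)).2 :: w).length : ℤ) = 0 by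
        simp only [List.length_cons]
        rw [Int.emod_sub_emod, sub_self, Int.zero_emod]]
      rfl
    · rw [Function.update_of_ne ht]
      unfold ringLetter
      have hne : (t - p) % ((a :: w).length : ℤ) ≠ 0 := by
        intro h2
        apply ht
        have h3 : t % ((a :: w).length : ℤ) = p % (a :: w).length :=
          Int.emod_eq_emod_iff_emod_sub_eq_zero.2 h2
        rw [← h3, Int.emod_eq_of_lt h0 (by omega)]
      have h4 := Int.emod_nonneg (t - p) (b := ((a :: w).length : ℤ)) (by simp; omega)
      simp only [List.length_cons] at hne h4 ⊢
      obtain ⟨m, hm⟩ : ∃ m, ((t - p) % ((w.length + 1 : ℕ) : ℤ)).toNat = m + 1 :=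
        ⟨_, (Nat.succ_pred_eq_of_pos (by omega)).symm⟩
      rw [hm]
      rfl

theorem exists_rep {x : ℤ → BSym QS Letter} {s e : ℤ} (hb : IsBlock x s e)
    (hh : BlockHasHead x s e) : ∃ κ, CRep x s e κ := by
  obtain ⟨⟨q, d⟩, P, lam, h⟩ := exists_beltRep hb hh
  have hle := h.le
  have h0 := h.nonneg
  have h1 := h.lt
  obtain ⟨L, hL⟩ : ∃ L : ℕ, (L : ℤ) = 2 * (e - s + 1) := ⟨(2 * (e - s + 1)).toNat, by omega⟩
  refine ⟨((q, (List.range L).map (fun i : ℕ => lam ((P + (i : ℤ)) % L)), P), d), ?_, ?_⟩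
  · simpa using hL
  · refine h.congr ?_ fun t ht0 ht1 => ?_
    · simp only [List.length_map, List.length_range]
      rw [Int.emod_eq_of_lt h0 (by omega)]
    · simp only [ringLetter, List.length_map, List.length_range]
      have h2 := Int.emod_nonneg (t - P) (b := (L : ℤ)) (by omega)
      have h3 := Int.emod_lt_of_pos (t - P) (b := (L : ℤ)) (by omega)
      rw [List.getD_eq_getElem _ _ (by simp; omega)]
      simp only [List.getElem_map, List.getElem_range]
      rw [Int.toNat_of_nonneg h2, Int.add_emod_emod, show P + (t - P) = t by ring,
        Int.emod_eq_of_lt ht0 (by omega)]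

/-! ### Realization of permutations of configurations by words in the generators -/

/-- The permutation `π` acts on every finite block as `Φ` acts on configurations. -/
structure Sim (π : Equiv.Perm (ℤ → BSym QS Letter)) (Φ : Equiv.Perm Conf) : Prop where
  headless : ∀ x s e, HeadlessBlock x s e →
    HeadlessBlock (π x) s e ∧ ∀ j, s ≤ j → j ≤ e → π x j = x j
  rep : ∀ x s e κ, CRep x s e κ → CRep (π x) s e (Φ κ)

theorem Sim.one : Sim 1 1 := ⟨fun _ _ _ h => ⟨h, fun _ _ _ => rfl⟩, fun _ _ _ _ h => h⟩

theorem Sim.mul {π π' : Equiv.Perm (ℤ → BSym QS Letter)} {Φ Φ' : Equiv.Perm Conf}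
    (h : Sim π Φ) (h' : Sim π' Φ') : Sim (π * π') (Φ * Φ') := by
  refine ⟨fun x s e hx => ?_, fun x s e κ hx => h.rep _ _ _ _ (h'.rep _ _ _ _ hx)⟩
  obtain ⟨h1, h2⟩ := h'.headless x s e hx
  obtain ⟨h3, h4⟩ := h.headless _ s e h1
  exact ⟨h3, fun j hj hje => (h4 j hj hje).trans (h2 j hj hje)⟩

/-- The generators of the group. -/
abbrev starGens : Set (Equiv.Perm (ℤ → BSym QS Letter)) :=
  BeltGensStar QS Letter sgnQS setSgnQS

/-- `Φ` is realized by a word of length at most `n` in the generators and their inverses. -/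
def Wd (n : ℕ) (Φ : Equiv.Perm Conf) : Prop :=
  ∃ w : List (Equiv.Perm (ℤ → BSym QS Letter)), w.length ≤ n ∧
    (∀ g ∈ w, g ∈ starGens ∨ g⁻¹ ∈ starGens) ∧ Sim w.prod Φ ∧ Sim w.prod⁻¹ Φ⁻¹

theorem Wd.one : Wd 0 1 := ⟨[], by simp, by simp, by simpa using Sim.one, by simpa using Sim.one⟩

theorem Wd.mono {m n : ℕ} {Φ : Equiv.Perm Conf} (h : Wd m Φ) (hmn : m ≤ n) : Wd n Φ := by
  obtain ⟨w, h1, h2⟩ := h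
  exact ⟨w, h1.trans hmn, h2⟩

theorem Wd.mul {m n : ℕ} {Φ Ψ : Equiv.Perm Conf} (h : Wd m Φ) (h' : Wd n Ψ) :
    Wd (m + n) (Φ * Ψ) := by
  obtain ⟨w, h1, h2, h3, h4⟩ := h
  obtain ⟨w', h1', h2', h3', h4'⟩ := h'
  refine ⟨w ++ w', by simp; omega, ?_, ?_, ?_⟩
  · intro g hg
    rcases List.mem_append.1 hg with hg | hg
    exacts [h2 g hg, h2' g hg]
  · rw [List.prod_append]
    exact h3.mul h3'
  · rw [List.prod_append, mul_inv_rev, mul_inv_rev]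
    exact h4'.mul h4

theorem Wd.inv {n : ℕ} {Φ : Equiv.Perm Conf} (h : Wd n Φ) : Wd n Φ⁻¹ := by
  obtain ⟨w, h1, h2, h3, h4⟩ := h
  refine ⟨(w.map (·⁻¹)).reverse, by simpa using h1, ?_, ?_, ?_⟩
  · intro g hg
    simp only [List.mem_reverse, List.mem_map] at hg
    obtain ⟨g', hg', rfl⟩ := hg
    rw [inv_inv]
    exact (h2 g' hg').symm
  · rwa [← List.prod_inv_reverse]
  · rwa [← List.prod_inv_reverse, inv_inv, inv_inv]

theorem Wd.of_gen {π : Equiv.Perm (ℤ → BSym QS Letter)} (hπ : π ∈ starGens)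
    {Φ : Equiv.Perm Conf} (h : Sim π Φ) (h' : Sim π⁻¹ Φ⁻¹) : Wd 1 Φ :=
  ⟨[π], by simp, by simp [hπ], by simpa using h, by simpa using h'⟩

theorem sim_gate (g : Equiv.Perm (QS × Letter)) : Sim (beltGatePerm g) (gate g) :=
  ⟨fun _ _ _ h => ⟨h.fixed (fun _ hj hje => h.gate_eq g hj hje)
    (cutAfter_beltGate g h.isBlock.2.1) (cutAfter_beltGate g h.isBlock.2.2.1),
    fun _ hj hje => h.gate_eq g hj hje⟩, fun _ _ _ _ h => h.gate g⟩

theorem gate_inv (g : Equiv.Perm (QS × Letter)) : (gate g)⁻¹ = gate g⁻¹ := by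
  rw [gate, gate, ← gateS_inv]
  rfl

theorem wd_gate (g : Equiv.Perm (QS × Letter)) : Wd 1 (gate g) :=
  Wd.of_gen (Or.inl (Or.inl ⟨g, fun _ _ => rfl⟩)) (sim_gate g) (gate_inv g ▸ sim_gate g⁻¹)

theorem wd_move_single (q : QS) : Wd 1 (move (· = q)) := by
  refine Wd.of_gen (π := beltMovePerm q) (Or.inl (Or.inr (Or.inr (Or.inr ⟨q, fun _ _ => rfl⟩))))
    ?_ ?_
  · refine ⟨fun x s e h => ⟨h.fixed (fun _ hj hje => h.move_eq q hj hje)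
      (cutAfter_beltMove q h.isBlock.2.1) (cutAfter_beltMove q h.isBlock.2.2.1),
      fun _ hj hje => h.move_eq q hj hje⟩, ?_⟩
    rintro x s e ⟨⟨q', v, p⟩, d⟩ h
    by_cases hq : (q', d) = q
    · have : move (· = q) ((q', v, p), d) = ((q', rotL v, p + 1), d) := by
        subst hq
        simp [move, confEquiv, mvS]
      rw [this]
      subst hq
      exact h.move
    · have : move (· = q) ((q', v, p), d) = ((q', v, p), d) := by
        simp [move, confEquiv, mvS, hq]
      rw [this]
      exact ⟨h.length, h.beltRep.move_of_ne hq⟩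
  · refine ⟨fun x s e h => ⟨h.fixed (fun _ hj hje => h.back_eq q hj hje)
      (cutAfter_beltBack q h.isBlock.2.1) (cutAfter_beltBack q h.isBlock.2.2.1),
      fun _ hj hje => h.back_eq q hj hje⟩, ?_⟩
    rintro x s e ⟨⟨q', v, p⟩, d⟩ h
    by_cases hq : (q', d) = q
    · have : (move (· = q))⁻¹ ((q', v, p), d) = ((q', rotL.symm v, p - 1), d) := by
        rw [Equiv.Perm.inv_eq_iff_eq]
        subst hq
        simp [move, confEquiv, mvS]
      rw [this]
      subst hq
      exact h.back
    · have : (move (· = q))⁻¹ ((q', v, p), d) = ((q', v, p), d) := by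
        rw [Equiv.Perm.inv_eq_iff_eq]
        simp [move, confEquiv, mvS, hq]
      rw [this]
      exact ⟨h.length, h.beltRep.back_of_ne hq⟩

instance : Fintype Arrow :=
  ⟨{.rf, .lf, .rh, .lh}, fun a => by cases a <;> simp⟩

theorem wd_move_finset (A : Finset QS) : Wd A.card (move (· ∈ A)) := by
  induction A using Finset.induction_on with
  | empty =>
    have : move (· ∈ (∅ : Finset QS)) = 1 := by
      ext κ : 1
      simp [move, confEquiv, mvS]
    rw [this]
    exact Wd.one
  | insert q A hq ih =>
    rw [Finset.card_insert_of_notMem hq]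
    have : move (· ∈ insert q A) = move (· ∈ A) * move (· = q) := by
      ext κ : 1
      obtain ⟨⟨q', v, p⟩, d⟩ := κ
      by_cases h1 : (q', d) = q
      · simp [move, confEquiv, mvS, h1, hq]
      · simp [move, confEquiv, mvS, h1]
    rw [this]
    exact ih.mul (wd_move_single q)

theorem wd_move (A : QS → Prop) [DecidablePred A] : Wd 96 (move A) := by
  have h := wd_move_finset (Finset.univ.filter A)
  have h2 : move (· ∈ Finset.univ.filter A) = move A := by
    ext κ : 1
    simp [move, mvS]
  rw [h2] at h
  refine h.mono ((Finset.card_filter_le _ _).trans ?_)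
  decide

/-! ### The machine on relative configurations -/

/-- The in-place part of a step: matching transitions, and the change of state of move
transitions. -/
def smartGate : Equiv.Perm (SQ × Letter) where
  toFun qa := match smartStep qa.1 qa.2 with
    | Sum.inl r => r
    | Sum.inr (_, q') => (q', qa.2)
  invFun qa := match smartStepBack qa.1 qa.2 with
    | Sum.inl r => r
    | Sum.inr (_, q') => (q', qa.2)
  left_inv := by unfold Function.LeftInverse; decide
  right_inv := by unfold Function.RightInverse Function.LeftInverse; decide

/-- Whether an arrow points to the right. -/
def Arrow.isR : Arrow → Bool
  | .rf => true
  | .rh => true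
  | _ => false

/-- One step of the SMART machine. -/
def smartF : Equiv.Perm Core :=
  gateS smartGate * mvS (fun q : SQ => q.2 = 1 ∧ q.1.isR = true) *
    (mvS (fun q : SQ => q.2 = 1 ∧ q.1.isR = false))⁻¹

/-- The permutation acting as `P` on cores whose duck satisfies `D`. -/
def lift (D : Fin 2 → Bool) (P : Equiv.Perm Core) : Equiv.Perm Conf :=
  Equiv.prodCongrLeft fun d : Decor => if D d.1 = true then P else 1

theorem lift_apply (D : Fin 2 → Bool) (P : Equiv.Perm Core) (c : Core) (d : Decor) :
    lift D P (c, d) = (if D d.1 = true then P c else c, d) := by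
  simp only [lift, Equiv.prodCongrLeft_apply]
  split_ifs <;> rfl

/-- One step of the symmetrized machine. -/
def smartT : Equiv.Perm Conf :=
  lift (fun b => decide (b = 0)) smartF * lift (fun b => decide (b = 1)) smartF⁻¹

theorem smartT_zero (c : Core) (g : Bool × Fin 3) : smartT (c, 0, g) = (smartF c, 0, g) := by
  simp [smartT, lift_apply]

theorem smartT_one (c : Core) (g : Bool × Fin 3) : smartT (c, 1, g) = (smartF⁻¹ c, 1, g) := by
  simp [smartT, lift_apply]

theorem smartF_inv : smartF⁻¹ = mvS (fun q : SQ => q.2 = 1 ∧ q.1.isR = false) *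
    (mvS (fun q : SQ => q.2 = 1 ∧ q.1.isR = true))⁻¹ * gateS smartGate⁻¹ := by
  simp only [smartF, mul_inv_rev, inv_inv, gateS_inv]
  rfl

theorem smartF_match (x : Arrow) (a : Letter) (t : List Letter) (p : ℤ) :
    smartF ((x, 0), a :: t, p) =
      ((smartGate ((x, 0), a)).1, (smartGate ((x, 0), a)).2 :: t, p) := by
  rw [smartF, Equiv.Perm.mul_apply, Equiv.Perm.mul_apply, mvS_inv_neg _ (by simp),
    mvS_neg _ (by simp), gateS_cons]

theorem smartGate_one (x : Arrow) (a : Letter) : smartGate ((x, 1), a) = ((x, 0), a) := by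
  revert x a; decide

theorem smartGate_inv_one (x : Arrow) (a : Letter) : (smartGate⁻¹ ((x, 1), a)).1.2 = 0 := by
  revert x a; decide

theorem gateS_smartGate_one (x : Arrow) {v : List Letter} (hv : v ≠ []) (p : ℤ) :
    gateS smartGate ((x, 1), v, p) = ((x, 0), v, p) := by
  obtain ⟨a, t, rfl⟩ := List.exists_cons_of_ne_nil hv
  simp [smartGate_one]

theorem smartF_right {x : Arrow} (hx : x.isR = true) {v : List Letter} (hv : v ≠ []) (p : ℤ) :
    smartF ((x, 1), v, p) = ((x, 0), rotL v, p + 1) := by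
  have hv' : rotL v ≠ [] := by
    rw [Ne, ← List.length_eq_zero_iff, length_rotL, List.length_eq_zero_iff]
    exact hv
  rw [smartF, Equiv.Perm.mul_apply, Equiv.Perm.mul_apply, mvS_inv_neg _ (by simp [hx]),
    mvS_pos _ (by simp [hx]), gateS_smartGate_one x hv']

theorem smartF_left {x : Arrow} (hx : x.isR = false) {v : List Letter} (hv : v ≠ []) (p : ℤ) :
    smartF ((x, 1), v, p) = ((x, 0), rotL.symm v, p - 1) := by
  have hv' : rotL.symm v ≠ [] := by
    rw [Ne, ← List.length_eq_zero_iff, length_rotL_symm, List.length_eq_zero_iff]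
    exact hv
  rw [smartF, Equiv.Perm.mul_apply, Equiv.Perm.mul_apply, mvS_inv_pos _ (by simp [hx]),
    mvS_neg _ (by simp [hx]), gateS_smartGate_one x hv']

section Ring

variable {Q Γ : Type}

/-- The cyclic configuration with letters `lam` and head in state `q` at `P`. -/
def ringW (ℓ : ℕ) (q : Q) (P : ZMod ℓ) (lam : ZMod ℓ → Γ) : ZMod ℓ → TSym Q Γ :=
  fun t => if t = P then Sum.inr (q, lam t) else Sum.inl (lam t)

theorem stepC_match {δ : HeadStep Q Γ} {ℓ : ℕ} {q q' : Q} {P : ZMod ℓ}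
    {lam : ZMod ℓ → Γ} {b : Γ} (h : δ q (lam P) = Sum.inl (q', b)) :
    stepC δ ℓ (ringW ℓ q P lam) = ringW ℓ q' P (Function.update lam P b) := by
  have hn : ∀ d t, arrivesAs δ (ringW ℓ q P lam t) d = none := by
    intro d t
    unfold ringW
    split_ifs with ht
    · subst ht
      simp [arrivesAs, h]
    · rfl
  funext t
  simp only [stepC, localStep, hn]
  by_cases ht : t = P
  · subst ht
    simp [ringW, h]
  · simp [ringW, ht]

theorem stepC_right {δ : HeadStep Q Γ} {ℓ : ℕ} (hℓ : 2 ≤ ℓ) {q q' : Q} {P : ZMod ℓ}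
    {lam : ZMod ℓ → Γ} (h : δ q (lam P) = Sum.inr (1, q')) :
    stepC δ ℓ (ringW ℓ q P lam) = ringW ℓ q' (P + 1) lam := by
  have : Fact (1 < ℓ) := ⟨hℓ⟩
  have hn : ∀ t, arrivesAs δ (ringW ℓ q P lam t) 1 = if t = P then some q' else none := by
    intro t
    unfold ringW
    split_ifs with ht
    · subst ht
      simp [arrivesAs, h]
    · rfl
  have hn' : ∀ t, arrivesAs δ (ringW ℓ q P lam t) (-1) = none := by
    intro t
    unfold ringW
    split_ifs with ht
    · subst ht
      simp [arrivesAs, h]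
    · rfl
  funext t
  simp only [stepC, localStep, hn, hn']
  by_cases ht : t = P
  · subst ht
    simp [ringW, h]
  · by_cases ht' : t = P + 1
    · subst ht'
      simp [ringW]
    · have : t - 1 ≠ P := fun h2 => ht' (by rw [← h2]; ring)
      simp [ringW, ht, ht', this]

theorem stepC_left {δ : HeadStep Q Γ} {ℓ : ℕ} (hℓ : 2 ≤ ℓ) {q q' : Q} {P : ZMod ℓ}
    {lam : ZMod ℓ → Γ} (h : δ q (lam P) = Sum.inr (-1, q')) :
    stepC δ ℓ (ringW ℓ q P lam) = ringW ℓ q' (P - 1) lam := by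
  have : Fact (1 < ℓ) := ⟨hℓ⟩
  have hn : ∀ t, arrivesAs δ (ringW ℓ q P lam t) (-1) = if t = P then some q' else none := by
    intro t
    unfold ringW
    split_ifs with ht
    · subst ht
      simp [arrivesAs, h]
    · rfl
  have hn' : ∀ t, arrivesAs δ (ringW ℓ q P lam t) 1 = none := by
    intro t
    unfold ringW
    split_ifs with ht
    · subst ht
      simp [arrivesAs, h]
    · rfl
  funext t
  simp only [stepC, localStep, hn, hn']
  by_cases ht : t = P
  · subst ht
    have ht : t ≠ t - 1 := fun h => one_ne_zero (sub_eq_self.1 h.symm)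
    simp [ringW, h, ht]
  · by_cases ht' : t = P - 1
    · subst ht'
      simp [ringW]
    · have : t + 1 ≠ P := fun h2 => ht' (by rw [← h2]; ring)
      simp [ringW, ht, ht', this]

end Ring

/-- The cyclic word of a configuration. -/
def confWord (ℓ : ℕ) (κ : Conf) : ZMod ℓ → TSym QS Letter :=
  ringW ℓ (κ.1.1, κ.2) (κ.1.2.2 : ZMod ℓ) (fun t => ringLetter κ.1.2.1 κ.1.2.2 t.val)

theorem CRep.unfoldBlock {x : ℤ → BSym QS Letter} {s e : ℤ} {κ : Conf} (h : CRep x s e κ) :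
    unfoldBlock x s e = confWord _ κ := by
  have hl := h.length
  have hle := h.beltRep.le
  have hL : κ.1.2.1.length = 2 * (e - s + 1).toNat := by omega
  have : NeZero (2 * (e - s + 1).toNat) := ⟨by omega⟩
  rw [h.beltRep.unfoldBlock]
  funext t
  have hiff : ((t.val : ℤ) = κ.1.2.2 % κ.1.2.1.length) ↔ t = (κ.1.2.2 : ZMod _) := by
    rw [hL]
    constructor
    · intro h1
      have h2 := congrArg (fun z : ℤ => (z : ZMod (2 * (e - s + 1).toNat))) h1
      simp only [ZMod.intCast_mod, Int.cast_natCast, ZMod.natCast_zmod_val] at h2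
      exact h2
    · rintro rfl
      rw [ZMod.val_intCast]
  simp only [ringWord, confWord, ringW, hiff]
  split_ifs with h1
  · rw [← hiff.2 h1]
  · rfl

theorem ringLetter_head (a : Letter) (w : List Letter) (p : ℤ) (t : ZMod (a :: w).length)
    (ht : t = (p : ZMod (a :: w).length)) : ringLetter (a :: w) p t.val = a := by
  have : ((t.val : ℤ) - p) % ((a :: w).length : ℤ) = 0 := by
    subst ht
    rw [ZMod.val_intCast, Int.emod_sub_emod, sub_self, Int.zero_emod]
  unfold ringLetter
  rw [this]
  rfl

theorem ringLetter_tail (a b : Letter) (w : List Letter) (p : ℤ) (t : ZMod (a :: w).length)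
    (ht : t ≠ (p : ZMod (a :: w).length)) :
    ringLetter (a :: w) p t.val = ringLetter (b :: w) p t.val := by
  have h : ((t.val : ℤ) - p) % ((a :: w).length : ℤ) ≠ 0 := by
    intro h
    apply ht
    have h2 := (ZMod.intCast_zmod_eq_zero_iff_dvd ((t.val : ℤ) - p) _).2
      (Int.dvd_of_emod_eq_zero h)
    push_cast at h2
    rw [ZMod.natCast_zmod_val] at h2
    exact sub_eq_zero.1 h2
  have h4 := Int.emod_nonneg ((t.val : ℤ) - p) (b := ((a :: w).length : ℤ)) (by simp; omega)
  unfold ringLetter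
  simp only [List.length_cons] at h h4 ⊢
  obtain ⟨m, hm⟩ : ∃ m, (((t.val : ℤ) - p) % ((w.length + 1 : ℕ) : ℤ)).toNat = m + 1 :=
    ⟨_, (Nat.succ_pred_eq_of_pos (by omega)).symm⟩
  rw [hm]
  rfl

theorem confWord_head (x' : SQ) (d' : Decor) (a b : Letter) (w : List Letter) (p : ℤ) :
    ringW (a :: w).length (x', d') (p : ZMod (a :: w).length)
      (Function.update (fun t => ringLetter (a :: w) p t.val) (p : ZMod (a :: w).length) b) =
    confWord (a :: w).length ((x', b :: w, p), d') := by
  unfold confWord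
  congr 1
  funext t
  by_cases ht : t = (p : ZMod (a :: w).length)
  · rw [ht, Function.update_self]
    exact (ringLetter_head b w p _ rfl).symm
  · rw [Function.update_of_ne ht]
    exact ringLetter_tail a b w p t ht

theorem confWord_rotL (ℓ : ℕ) (q : SQ) (d : Decor) (v : List Letter) (p : ℤ) :
    confWord ℓ ((q, rotL v, p + 1), d) =
      ringW ℓ (q, d) ((p : ZMod ℓ) + 1) (fun t => ringLetter v p t.val) := by
  simp only [confWord, ringLetter_rotL]
  push_cast
  rfl

theorem confWord_rotL_symm (ℓ : ℕ) (q : SQ) (d : Decor) (v : List Letter) (p : ℤ) :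
    confWord ℓ ((q, rotL.symm v, p - 1), d) =
      ringW ℓ (q, d) ((p : ZMod ℓ) - 1) (fun t => ringLetter v p t.val) := by
  have h := fun t => ringLetter_rotL (rotL.symm v) (p - 1) t
  simp only [Equiv.apply_symm_apply, sub_add_cancel] at h
  simp only [confWord, ← h]
  push_cast
  rfl

theorem stepC_confWord (κ : Conf) (hκ : 2 ≤ κ.1.2.1.length) :
    stepC smartSymStep κ.1.2.1.length (confWord κ.1.2.1.length κ) =
      confWord κ.1.2.1.length (smartT κ) ∧ (smartT κ).1.2.1.length = κ.1.2.1.length := by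
  obtain ⟨⟨⟨x, i⟩, v, p⟩, dk, gh⟩ := κ
  rcases v with _ | ⟨a, w⟩
  · simp at hκ
  simp only at hκ ⊢
  have hne : a :: w ≠ [] := by simp
  have hlet := ringLetter_head a w p _ rfl
  obtain rfl | rfl : dk = 0 ∨ dk = 1 := by omega
  · rw [smartT_zero]
    obtain rfl | rfl : i = 0 ∨ i = 1 := by omega
    · rw [smartF_match]
      refine ⟨Eq.trans (stepC_match ?_) (confWord_head _ _ a _ w p), by simp⟩
      rw [hlet]
      cases x <;> fin_cases a <;> rfl
    · cases hx : x.isR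
      · rw [smartF_left hx hne, confWord_rotL_symm]
        refine ⟨stepC_left hκ ?_, by simp⟩
        cases x <;> first | rfl | simp [Arrow.isR] at hx
      · rw [smartF_right hx hne, confWord_rotL]
        refine ⟨stepC_right hκ ?_, by simp⟩
        cases x <;> first | rfl | simp [Arrow.isR] at hx
  · rw [smartT_one, smartF_inv, Equiv.Perm.mul_apply, Equiv.Perm.mul_apply, gateS_cons]
    obtain rfl | rfl : i = 0 ∨ i = 1 := by omega
    · have hg : smartGate⁻¹ ((x, 0), a) = ((x, 1), a) := by
        rw [Equiv.Perm.inv_eq_iff_eq, smartGate_one]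
      rw [hg]
      cases hx : x.isR
      · rw [mvS_inv_neg _ (by simp [hx]), mvS_pos _ (by simp [hx]), confWord_rotL]
        refine ⟨stepC_right hκ ?_, by simp⟩
        cases x <;> first | rfl | simp [Arrow.isR] at hx
      · rw [mvS_inv_pos _ (by simp [hx]), mvS_neg _ (by simp [hx]), confWord_rotL_symm]
        refine ⟨stepC_left hκ ?_, by simp⟩
        cases x <;> first | rfl | simp [Arrow.isR] at hx
    · have hg := smartGate_inv_one x a
      rw [mvS_inv_neg _ (fun h => by rw [hg] at h; exact absurd h.1 (by decide)),
        mvS_neg _ (fun h => by rw [hg] at h; exact absurd h.1 (by decide))]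
      refine ⟨Eq.trans (stepC_match ?_) (confWord_head _ _ a _ w p), by simp⟩
      rw [hlet]
      cases x <;> fin_cases a <;> rfl

theorem stepC_iterate_confWord (n : ℕ) (κ : Conf) (hκ : 2 ≤ κ.1.2.1.length) :
    (stepC smartSymStep κ.1.2.1.length)^[n] (confWord κ.1.2.1.length κ) =
      confWord κ.1.2.1.length ((smartT ^ n) κ) := by
  induction n generalizing κ with
  | zero => rfl
  | succ n ih =>
    obtain ⟨h1, h2⟩ := stepC_confWord κ hκ
    rw [Function.iterate_succ_apply, h1, pow_succ, Equiv.Perm.mul_apply]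
    have := ih (smartT κ) (by rw [h2]; exact hκ)
    rwa [h2] at this

/-- Equality of configurations on their belts. -/
def ConfEq (κ κ' : Conf) : Prop :=
  κ.1.1 = κ'.1.1 ∧ κ.1.2.1 = κ'.1.2.1 ∧ κ.1.2.2 ≡ κ'.1.2.2 [ZMOD κ.1.2.1.length] ∧ κ.2 = κ'.2

theorem CRep.of_confEq {x : ℤ → BSym QS Letter} {s e : ℤ} {κ κ' : Conf} (h : CRep x s e κ)
    (hκ : ConfEq κ κ') : CRep x s e κ' := by
  obtain ⟨⟨q, v, p⟩, d⟩ := κ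
  obtain ⟨⟨q', v', p'⟩, d'⟩ := κ'
  obtain ⟨rfl, rfl, h3, rfl⟩ := hκ
  exact h.of_modEq h3

theorem actsAsBeltPower_of_sim {π : Equiv.Perm (ℤ → BSym QS Letter)} {Φ : Equiv.Perm Conf}
    (hπ : Sim π Φ) {n : ℕ}
    (hΦ : ∀ κ : Conf, Even κ.1.2.1.length → 2 ≤ κ.1.2.1.length →
      ConfEq (Φ κ) ((smartT ^ n) κ)) (x : ℤ → BSym QS Letter) :
    ActsAsBeltPower smartSymStep n x (π x) := by
  intro s e hb
  refine ⟨fun hh j hj hje => ?_, fun hh => ?_⟩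
  · refine (hπ.headless x s e ⟨hb, fun i hi hie => ?_⟩).2 j hj hje
    by_contra h
    exact hh ⟨i, hi, hie, by simpa using h⟩
  · obtain ⟨κ, hκ⟩ := exists_rep hb hh
    have hle := hκ.beltRep.le
    have hl := hκ.length
    have hL : κ.1.2.1.length = 2 * (e - s + 1).toNat := by omega
    have h2 : 2 ≤ κ.1.2.1.length := by omega
    have h3 := (hπ.rep x s e κ hκ).of_confEq (hΦ κ ⟨(e - s + 1).toNat, by omega⟩ h2)
    refine ⟨h3.beltRep.isBlock, ?_, fun j k hj hje hk hke hh a b sg hy =>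
      h3.beltRep.sign j k hj hje hk hke hh a b sg hy⟩
    rw [h3.unfoldBlock, hκ.unfoldBlock]
    have := stepC_iterate_confWord n κ h2
    rw [hL] at this
    exact this.symm

theorem mem_closure_of_word {w : List (Equiv.Perm (ℤ → BSym QS Letter))}
    (hw : ∀ g ∈ w, g ∈ starGens ∨ g⁻¹ ∈ starGens) : w.prod ∈ Subgroup.closure starGens := by
  refine Subgroup.list_prod_mem _ fun g hg => ?_
  rcases hw g hg with h | h
  · exact Subgroup.subset_closure h
  · exact inv_inv g ▸ Subgroup.inv_mem _ (Subgroup.subset_closure h)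

theorem Wd.exists_perm {m n : ℕ} {Φ : Equiv.Perm Conf} (h : Wd m Φ)
    (hΦ : ∀ κ : Conf, Even κ.1.2.1.length → 2 ≤ κ.1.2.1.length →
      ConfEq (Φ κ) ((smartT ^ n) κ)) :
    ∃ π : Equiv.Perm (ℤ → BSym QS Letter),
      π ∈ Subgroup.closure starGens ∧
      (∀ x : ℤ → BSym QS Letter, AllFiniteBlocks x →
        ActsAsBeltPower smartSymStep n x (π x)) ∧ wordNorm starGens π ≤ m := by
  obtain ⟨w, h1, h2, h3, -⟩ := h
  refine ⟨w.prod, mem_closure_of_word h2, fun x _ => actsAsBeltPower_of_sim h3 hΦ x, ?_⟩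
  unfold wordNorm
  exact (Nat.sInf_le (show w.length ∈ {n : ℕ | ∃ w' : List (Equiv.Perm (ℤ → BSym QS Letter)),
    w'.length = n ∧ (∀ x ∈ w', x ∈ starGens ∨ x⁻¹ ∈ starGens) ∧ w'.prod = w.prod} from
      ⟨w, rfl, h2, rfl⟩)).trans h1

/-! ### Programs acting on cores -/

theorem lift_one (D : Fin 2 → Bool) : lift D 1 = 1 := by
  ext κ : 1
  obtain ⟨c, d⟩ := κ
  simp [lift_apply]

theorem lift_mul (D : Fin 2 → Bool) (P P' : Equiv.Perm Core) :
    lift D (P * P') = lift D P * lift D P' := by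
  ext κ : 1
  obtain ⟨c, d⟩ := κ
  by_cases h : D d.1 = true <;> simp [lift_apply, h]

theorem lift_inv (D : Fin 2 → Bool) (P : Equiv.Perm Core) : lift D P⁻¹ = (lift D P)⁻¹ := by
  rw [eq_inv_iff_mul_eq_one, ← lift_mul, inv_mul_cancel, lift_one]

/-- The length of the belt of a core. -/
def Core.len (c : Core) : ℕ := c.2.1.length

/-- `P` preserves the length of belts, and is realized with cost `n` on every set of ducks. -/
structure Prog (n : ℕ) (P : Equiv.Perm Core) : Prop where
  len : ∀ c, (P c).len = c.len
  wd : ∀ D : Fin 2 → Bool, Wd n (lift D P)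

theorem Prog.one : Prog 0 1 := ⟨fun _ => rfl, fun D => lift_one D ▸ Wd.one⟩

theorem Prog.mono {m n : ℕ} {P : Equiv.Perm Core} (h : Prog m P) (hmn : m ≤ n) : Prog n P :=
  ⟨h.len, fun D => (h.wd D).mono hmn⟩

theorem Prog.mul {m n : ℕ} {P P' : Equiv.Perm Core} (h : Prog m P) (h' : Prog n P') :
    Prog (m + n) (P * P') :=
  ⟨fun c => (h.len _).trans (h'.len c), fun D => lift_mul D P P' ▸ (h.wd D).mul (h'.wd D)⟩

theorem Prog.inv {n : ℕ} {P : Equiv.Perm Core} (h : Prog n P) : Prog n P⁻¹ :=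
  ⟨fun c => by simpa using (h.len (P⁻¹ c)).symm, fun D => lift_inv D P ▸ (h.wd D).inv⟩

theorem Prog.pow {n : ℕ} {P : Equiv.Perm Core} (h : Prog n P) (k : ℕ) :
    Prog (k * n) (P ^ k) := by
  induction k with
  | zero => simpa using Prog.one
  | succ k ih =>
    rw [pow_succ, Nat.succ_mul]
    exact ih.mul h

theorem Prog.zpow {n : ℕ} {P : Equiv.Perm Core} (h : Prog n P) (z : ℤ) :
    Prog (z.natAbs * n) (P ^ z) := by
  obtain ⟨k, rfl | rfl⟩ := z.eq_nat_or_neg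
  · simpa using h.pow k
  · simpa using (h.pow k).inv

/-- Regrouping of a head symbol. -/
def symEquiv : (SQ × Letter) × Decor ≃ QS × Letter where
  toFun y := ((y.1.1, y.2), y.1.2)
  invFun y := ((y.1.1, y.2), y.1.2)
  left_inv _ := rfl
  right_inv _ := rfl

/-- The gate acting as `h` on the decorations satisfying `X`. -/
def gateOn (X : Decor → Bool) (h : Equiv.Perm (SQ × Letter)) : Equiv.Perm Conf :=
  gate (symEquiv.permCongr
    (Equiv.prodCongrLeft fun d : Decor => if X d = true then h else 1))

theorem gateOn_apply (X : Decor → Bool) (h : Equiv.Perm (SQ × Letter)) (c : Core) (d : Decor) :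
    gateOn X h (c, d) = (if X d = true then gateS h c else c, d) := by
  obtain ⟨q, _ | ⟨a, t⟩, p⟩ := c
  · simp [gateOn, gate, confEquiv]
  · by_cases hd : X d = true <;> simp [gateOn, gate, confEquiv, symEquiv, hd]

theorem length_gateS (h : Equiv.Perm (SQ × Letter)) (c : Core) :
    Core.len (gateS h c) = c.len := by
  obtain ⟨q, _ | ⟨a, t⟩, p⟩ := c <;> rfl

theorem prog_gateS (h : Equiv.Perm (SQ × Letter)) : Prog 1 (gateS h) := by
  refine ⟨length_gateS h, fun D => ?_⟩
  have : lift D (gateS h) = gateOn (fun d => D d.1) h := by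
    ext κ : 1
    rw [lift_apply, gateOn_apply]
  rw [this]
  exact wd_gate _

theorem prog_mvS (A : SQ → Prop) [DecidablePred A] : Prog 96 (mvS A) := by
  refine ⟨fun c => ?_, fun D => ?_⟩
  · by_cases h : A c.1 <;> simp [mvS, h, Core.len]
  · have : lift D (mvS A) = move (fun q : QS => A q.1 ∧ D q.2.1 = true) := by
      ext κ : 1
      obtain ⟨c, d⟩ := κ
      rw [lift_apply]
      by_cases hd : D d.1 = true <;> by_cases h : A c.1 <;> simp [move, confEquiv, mvS, h, hd]
    rw [this]
    exact wd_move _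

theorem prog_smartF : Prog 200 smartF :=
  (((prog_gateS _).mul (prog_mvS _)).mul (prog_mvS _).inv).mono (by norm_num)

/-- The unconditional move. -/
abbrev mvT : Equiv.Perm Core := mvS fun _ : SQ => True

theorem prog_mvT : Prog 96 mvT := prog_mvS _

theorem mvT_apply (q : SQ) (v : List Letter) (p : ℤ) : mvT (q, v, p) = (q, rotL v, p + 1) :=
  mvS_pos _ trivial _ _

theorem mvT_inv_apply (q : SQ) (v : List Letter) (p : ℤ) :
    mvT⁻¹ (q, v, p) = (q, rotL.symm v, p - 1) :=
  mvS_inv_pos _ trivial _ _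

theorem mvT_pow_append (q : SQ) (u w : List Letter) (p : ℤ) :
    (mvT ^ u.length) (q, u ++ w, p) = (q, w ++ u, p + u.length) := by
  induction u generalizing w p with
  | nil => simp
  | cons a u ih =>
    rw [List.length_cons, pow_succ, Equiv.Perm.mul_apply, List.cons_append, mvT_apply, rotL_cons,
      List.append_assoc, ih, List.append_assoc]
    congr 2
    push_cast
    ring

/-! ### Controlled changes of the decoration -/

/-- The change of the decoration by a permutation that depends on the core. -/
def dec (φ : Core → Equiv.Perm Decor) : Equiv.Perm Conf := Equiv.prodCongrRight φ

@[simp] theorem dec_apply (φ : Core → Equiv.Perm Decor) (c : Core) (d : Decor) :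
    dec φ (c, d) = (c, φ c d) := rfl

theorem dec_mul (φ ψ : Core → Equiv.Perm Decor) :
    dec φ * dec ψ = dec fun c => φ c * ψ c := by
  ext κ : 1
  rfl

theorem dec_inv (φ : Core → Equiv.Perm Decor) : (dec φ)⁻¹ = dec fun c => (φ c)⁻¹ := by
  rw [inv_eq_iff_mul_eq_one, dec_mul]
  ext κ : 1
  obtain ⟨c, d⟩ := κ
  simp

theorem Prog.conj_dec {n m : ℕ} {P : Equiv.Perm Core} (h : Prog n P)
    {φ : Core → Equiv.Perm Decor} (hφ : Wd m (dec φ)) :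
    Wd (m + 2 * n) (dec fun c => φ (P c)) := by
  have h1 := h.wd fun _ => true
  have : (dec fun c => φ (P c)) =
      (lift (fun _ => true) P)⁻¹ * dec φ * lift (fun _ => true) P := by
    rw [← lift_inv]
    ext κ : 1
    obtain ⟨c, d⟩ := κ
    simp [lift_apply]
  rw [this]
  exact ((h1.inv.mul hφ).mul h1).mono (by omega)

/-- The decoration gate: the change of decoration depends on the state and on the letter under
the head. -/
theorem wd_dec_gate (φ : SQ × Letter → Equiv.Perm Decor) :
    Wd 1 (dec fun c => match c.2.1 with | [] => 1 | a :: _ => φ (c.1, a)) := by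
  have : (dec fun c => match c.2.1 with | [] => 1 | a :: _ => φ (c.1, a)) =
      gate (symEquiv.permCongr (Equiv.prodCongrRight φ)) := by
    ext κ : 1
    obtain ⟨⟨q, _ | ⟨a, t⟩, p⟩, d⟩ := κ
    · rfl
    · rfl
  rw [this]
  exact wd_gate _

open Classical in
/-- The change of decoration by `σ` on the nonempty cores in `E`. -/
noncomputable def ctl (E : Set Core) (σ : Equiv.Perm Decor) : Equiv.Perm Conf :=
  dec fun c => if c ∈ E ∧ c.2.1 ≠ [] then σ else 1

theorem ctl_pos {E : Set Core} {σ : Equiv.Perm Decor} {c : Core} (hc : c ∈ E) (hn : c.2.1 ≠ [])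
    (d : Decor) : ctl E σ (c, d) = (c, σ d) := by
  simp [ctl, hc, hn]

theorem ctl_neg {E : Set Core} {σ : Equiv.Perm Decor} {c : Core} (hc : c ∉ E) (d : Decor) :
    ctl E σ (c, d) = (c, d) := by
  simp [ctl, hc]

theorem ctl_nil {E : Set Core} {σ : Equiv.Perm Decor} {c : Core} (hc : c.2.1 = []) (d : Decor) :
    ctl E σ (c, d) = (c, d) := by
  simp [ctl, hc]

theorem ctl_congr {E E' : Set Core} (σ : Equiv.Perm Decor)
    (h : ∀ c : Core, c.2.1 ≠ [] → (c ∈ E ↔ c ∈ E')) : ctl E σ = ctl E' σ := by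
  unfold ctl
  congr 1
  funext c
  by_cases hn : c.2.1 = []
  · simp [hn]
  · have := h c hn
    by_cases h1 : c ∈ E
    · simp [h1, this.1 h1]
    · simp [h1, mt this.2 h1]

theorem ctl_mul (E : Set Core) (σ τ : Equiv.Perm Decor) :
    ctl E (σ * τ) = ctl E σ * ctl E τ := by
  simp only [ctl, dec_mul]
  congr 1
  funext c
  split_ifs <;> simp

theorem ctl_one (E : Set Core) : ctl E 1 = 1 := by
  ext κ : 1
  obtain ⟨c, d⟩ := κ
  simp [ctl]

theorem ctl_inv (E : Set Core) (σ : Equiv.Perm Decor) : ctl E σ⁻¹ = (ctl E σ)⁻¹ := by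
  rw [eq_inv_iff_mul_eq_one, ← ctl_mul, inv_mul_cancel, ctl_one]

/-- Every change of decoration by a three-cycle controlled by `E` has cost at most `n`. -/
def Ctl (n : ℕ) (E : Set Core) : Prop :=
  ∀ σ : Equiv.Perm Decor, σ.IsThreeCycle → Wd n (ctl E σ)

theorem Ctl.mono {m n : ℕ} {E : Set Core} (h : Ctl m E) (hmn : m ≤ n) : Ctl n E :=
  fun σ hσ => (h σ hσ).mono hmn

theorem Ctl.congr {n : ℕ} {E E' : Set Core} (h : Ctl n E)
    (hE : ∀ c : Core, c.2.1 ≠ [] → (c ∈ E ↔ c ∈ E')) : Ctl n E' :=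
  fun σ hσ => ctl_congr σ hE ▸ h σ hσ

theorem isThreeCycle_eq_commutator {σ : Equiv.Perm Decor} (hσ : σ.IsThreeCycle) :
    ∃ α β : Equiv.Perm Decor, α.IsThreeCycle ∧ β.IsThreeCycle ∧ σ = α * β * α⁻¹ * β⁻¹ := by
  let a : Decor := (0, false, 0)
  let b : Decor := (0, false, 1)
  let c : Decor := (0, false, 2)
  let d : Decor := (1, false, 0)
  let e : Decor := (1, false, 1)
  have hα : (Equiv.swap a b * Equiv.swap a c).IsThreeCycle :=
    Equiv.Perm.isThreeCycle_swap_mul_swap_same (by decide) (by decide) (by decide)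
  have hβ : (Equiv.swap a d * Equiv.swap a e).IsThreeCycle :=
    Equiv.Perm.isThreeCycle_swap_mul_swap_same (by decide) (by decide) (by decide)
  obtain ⟨x, y, z, hxy, hxz, hyz, hc⟩ : ∃ x y z : Decor, x ≠ y ∧ x ≠ z ∧ y ≠ z ∧
      (Equiv.swap a b * Equiv.swap a c) * (Equiv.swap a d * Equiv.swap a e) *
      (Equiv.swap a b * Equiv.swap a c)⁻¹ * (Equiv.swap a d * Equiv.swap a e)⁻¹ =
      Equiv.swap x y * Equiv.swap x z := by
    refine ⟨a, e, c, by decide, by decide, by decide, ?_⟩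
    decide
  have hγ' : ((Equiv.swap a b * Equiv.swap a c) * (Equiv.swap a d * Equiv.swap a e) *
      (Equiv.swap a b * Equiv.swap a c)⁻¹ * (Equiv.swap a d * Equiv.swap a e)⁻¹).IsThreeCycle := by
    rw [hc]
    exact Equiv.Perm.isThreeCycle_swap_mul_swap_same hxy hxz hyz
  obtain ⟨τ, hτ⟩ := isConj_iff.1 (Equiv.Perm.isConj_iff_cycleType_eq.2
    ((show _ = _ from hγ').trans (show _ = _ from hσ).symm))
  generalize Equiv.swap a b * Equiv.swap a c = α at *
  generalize Equiv.swap a d * Equiv.swap a e = β at *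
  refine ⟨τ * α * τ⁻¹, τ * β * τ⁻¹, ?_, ?_, ?_⟩
  · rw [Equiv.Perm.IsThreeCycle, Equiv.Perm.cycleType_conj]
    exact hα
  · rw [Equiv.Perm.IsThreeCycle, Equiv.Perm.cycleType_conj]
    exact hβ
  · rw [← hτ]
    group

theorem Ctl.inter {m n : ℕ} {E E' : Set Core} (h : Ctl m E) (h' : Ctl n E') :
    Ctl (2 * m + 2 * n) (E ∩ E') := by
  intro σ hσ
  obtain ⟨α, β, hα, hβ, rfl⟩ := isThreeCycle_eq_commutator hσ
  have : ctl (E ∩ E') (α * β * α⁻¹ * β⁻¹) =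
      ctl E α * ctl E' β * (ctl E α)⁻¹ * (ctl E' β)⁻¹ := by
    rw [← ctl_inv, ← ctl_inv]
    ext κ : 1
    simp only [ctl, dec_mul]
    congr 2
    funext c
    by_cases h1 : c ∈ E <;> by_cases h2 : c ∈ E' <;> by_cases h3 : c.2.1 = [] <;>
      simp [h1, h2, h3]
  rw [this]
  exact ((((h α hα).mul (h' β hβ)).mul (h α hα).inv).mul (h' β hβ).inv).mono (by omega)

theorem Ctl.head (B : SQ → Letter → Prop) :
    Ctl 1 {c : Core | ∃ a ∈ c.2.1.head?, B c.1 a} := by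
  classical
  intro σ _
  have := wd_dec_gate fun y => if B y.1 y.2 then σ else 1
  convert this using 1
  unfold ctl
  congr 1
  funext c
  obtain ⟨q, _ | ⟨a, t⟩, p⟩ := c <;> simp

theorem ctl_univ (σ : Equiv.Perm Decor) : Wd 1 (ctl Set.univ σ) := by
  classical
  have := wd_dec_gate fun _ => σ
  convert this using 1
  unfold ctl
  congr 1
  funext c
  obtain ⟨q, _ | ⟨a, t⟩, p⟩ := c <;> simp

theorem Ctl.univ : Ctl 1 Set.univ := fun σ _ => ctl_univ σ

theorem ctl_union {E E' : Set Core} (h : Disjoint E E') (σ : Equiv.Perm Decor) :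
    ctl (E ∪ E') σ = ctl E σ * ctl E' σ := by
  simp only [ctl, dec_mul]
  congr 1
  funext c
  by_cases h1 : c ∈ E
  · have h2 : c ∉ E' := Set.disjoint_left.1 h h1
    simp [h1, h2]
  · by_cases h2 : c ∈ E' <;> simp [h1, h2]

theorem Ctl.compl {n : ℕ} {E : Set Core} (h : Ctl n E) : Ctl (n + 1) Eᶜ := by
  intro σ hσ
  have : ctl Eᶜ σ = (ctl E σ)⁻¹ * ctl Set.univ σ := by
    rw [eq_inv_mul_iff_mul_eq, ← ctl_union disjoint_compl_right, Set.union_compl_self]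
  rw [this]
  exact (h σ hσ).inv.mul (ctl_univ σ)

theorem Ctl.preimage {n m : ℕ} {E : Set Core} (h : Ctl n E) {P : Equiv.Perm Core}
    (hP : Prog m P) : Ctl (n + 2 * m) (P ⁻¹' E) := by
  classical
  intro σ hσ
  have := hP.conj_dec (h σ hσ)
  convert this using 1
  unfold ctl
  congr 1
  funext c
  have h1 : (P c).2.1 ≠ [] ↔ c.2.1 ≠ [] := by
    have := hP.len c
    simp only [Core.len] at this
    rw [← List.length_pos_iff, ← List.length_pos_iff, this]
  simp only [h1, Set.mem_preimage]

theorem exists_alternating_cost {σ : Equiv.Perm Decor} (hσ : Equiv.Perm.sign σ = 1) :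
    ∃ k : ℕ, ∀ (n : ℕ) (E : Set Core), Ctl n E → Wd (k * n) (ctl E σ) := by
  have hmem : σ ∈ Subgroup.closure {σ : Equiv.Perm Decor | σ.IsThreeCycle} := by
    rw [Equiv.Perm.closure_three_cycles_eq_alternating]
    exact Equiv.Perm.mem_alternatingGroup.2 hσ
  clear hσ
  induction hmem using Subgroup.closure_induction with
  | mem σ h => exact ⟨1, fun n E hE => by simpa using hE σ h⟩
  | one => exact ⟨0, fun n E _ => by simpa [ctl_one] using Wd.one⟩
  | mul σ τ _ _ h1 h2 =>
    obtain ⟨k, hk⟩ := h1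
    obtain ⟨l, hl⟩ := h2
    exact ⟨k + l, fun n E hE => by
      rw [ctl_mul, add_mul]
      exact (hk n E hE).mul (hl n E hE)⟩
  | inv σ _ h1 =>
    obtain ⟨k, hk⟩ := h1
    exact ⟨k, fun n E hE => ctl_inv E σ ▸ (hk n E hE).inv⟩

/-- The flip of the duck. -/
def flipDuck : Equiv.Perm Decor where
  toFun d := (d.1 + 1, d.2)
  invFun d := (d.1 + 1, d.2)
  left_inv := by unfold Function.LeftInverse; decide
  right_inv := by unfold Function.RightInverse Function.LeftInverse; decide

/-- The flip of the sign of the ghost. -/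
def flipSign : Equiv.Perm Decor where
  toFun d := (d.1, !d.2.1, d.2.2)
  invFun d := (d.1, !d.2.1, d.2.2)
  left_inv := by unfold Function.LeftInverse; decide
  right_inv := by unfold Function.RightInverse Function.LeftInverse; decide

theorem sign_eq_one_of_sq {σ ρ : Equiv.Perm Decor} (h : σ = ρ ^ 2) : Equiv.Perm.sign σ = 1 := by
  rw [h, map_pow, Int.units_sq]

theorem sign_flipDuck : Equiv.Perm.sign flipDuck = 1 :=
  sign_eq_one_of_sq (ρ :=
    { toFun := fun d => if d.2.1 then (d.1, false, d.2.2) else (d.1 + 1, true, d.2.2)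
      invFun := fun d => if d.2.1 then (d.1 + 1, false, d.2.2) else (d.1, true, d.2.2)
      left_inv := by unfold Function.LeftInverse; decide
      right_inv := by unfold Function.RightInverse Function.LeftInverse; decide })
    (Equiv.ext (by decide))

theorem sign_flipSign : Equiv.Perm.sign flipSign = 1 :=
  sign_eq_one_of_sq (ρ :=
    { toFun := fun d => if d.1 = 0 then (1, d.2) else (0, !d.2.1, d.2.2)
      invFun := fun d => if d.1 = 0 then (1, !d.2.1, d.2.2) else (0, d.2)
      left_inv := by unfold Function.LeftInverse; decide
      right_inv := by unfold Function.RightInverse Function.LeftInverse; decide })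
    (Equiv.ext (by decide))

theorem exists_flip_cost : ∃ k : ℕ, ∀ (n : ℕ) (E : Set Core), Ctl n E →
    Wd (k * n) (ctl E flipDuck) ∧ Wd (k * n) (ctl E flipSign) := by
  obtain ⟨k, hk⟩ := exists_alternating_cost sign_flipDuck
  obtain ⟨l, hl⟩ := exists_alternating_cost sign_flipSign
  refine ⟨k + l, fun n E hE => ⟨(hk n E hE).mono ?_, (hl n E hE).mono ?_⟩⟩ <;>
    exact Nat.mul_le_mul_right _ (by omega)

/-- The cost of a controlled flip. -/
noncomputable def flipCost : ℕ := exists_flip_cost.choose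

theorem Ctl.flipDuck {n : ℕ} {E : Set Core} (h : Ctl n E) : Wd (flipCost * n) (ctl E flipDuck) :=
  (exists_flip_cost.choose_spec n E h).1

theorem Ctl.flipSign {n : ℕ} {E : Set Core} (h : Ctl n E) : Wd (flipCost * n) (ctl E flipSign) :=
  (exists_flip_cost.choose_spec n E h).2

/-! ### Controlled gates -/

open Classical in
/-- The involution `H` restricted to the largest `H`-invariant subset of `E`. -/
noncomputable def condPerm (E : Set Core) (H : Equiv.Perm Core) (hH : ∀ c, H (H c) = c) :
    Equiv.Perm Core where
  toFun c := if c ∈ E ∧ H c ∈ E then H c else c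
  invFun c := if c ∈ E ∧ H c ∈ E then H c else c
  left_inv c := by
    by_cases h : c ∈ E ∧ H c ∈ E <;> simp [h, hH]
  right_inv c := by
    by_cases h : c ∈ E ∧ H c ∈ E <;> simp [h, hH]

theorem condPerm_apply_of_mem {E : Set Core} {H : Equiv.Perm Core} (hH : ∀ c, H (H c) = c)
    {c : Core} (h : c ∈ E) (h' : H c ∈ E) : condPerm E H hH c = H c := by
  simp [condPerm, h, h']

theorem condPerm_apply_of_notMem {E : Set Core} {H : Equiv.Perm Core} (hH : ∀ c, H (H c) = c)
    {c : Core} (h : c ∉ E) : condPerm E H hH c = c := by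
  simp [condPerm, h]

theorem gateS_gateS {h : Equiv.Perm (SQ × Letter)} (hh : ∀ y, h (h y) = y) (c : Core) :
    gateS h (gateS h c) = c := by
  obtain ⟨q, _ | ⟨a, t⟩, p⟩ := c
  · rfl
  · simp [hh]

theorem Ctl.condGate {n : ℕ} {E : Set Core} (hE : Ctl n E) {h : Equiv.Perm (SQ × Letter)}
    (hh : ∀ y, h (h y) = y) :
    Prog (2 * (flipCost * (4 * n + 4)) + 2) (condPerm E (gateS h) (gateS_gateS hh)) := by
  set H : Equiv.Perm Core := gateS h with hHdef
  have hH : ∀ c, H (H c) = c := gateS_gateS hh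
  set E' : Set Core := E ∩ H ⁻¹' E with hE'
  have hmem : ∀ c, H c ∈ E' ↔ c ∈ E' := fun c => by
    simp only [hE', Set.mem_inter_iff, Set.mem_preimage, hH, and_comm]
  have hc : Ctl (4 * n + 4) E' :=
    (hE.inter (hE.preimage (prog_gateS h))).mono (by omega)
  have hf := hc.flipSign
  refine ⟨fun c => ?_, fun D => ?_⟩
  · simp only [condPerm, Equiv.coe_fn_mk]
    split_ifs
    · exact length_gateS h c
    · rfl
  · have key : lift D (condPerm E H hH) =
        ctl E' _root_.flipSign * gateOn (fun d => d.2.1 && D d.1) h * ctl E' _root_.flipSign *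
          gateOn (fun d => d.2.1 && D d.1) h := by
      ext κ : 1
      obtain ⟨c, d, s, t⟩ := κ
      have hG : ∀ (c : Core) (d : Decor), gateOn (fun d => d.2.1 && D d.1) h (c, d) =
          (if (d.2.1 && D d.1) = true then H c else c, d) := fun c d => gateOn_apply _ _ _ _
      have hfs : ∀ d s t, _root_.flipSign (d, s, t) = (d, !s, t) := fun _ _ _ => rfl
      rw [Equiv.Perm.mul_apply, Equiv.Perm.mul_apply, Equiv.Perm.mul_apply, lift_apply]
      by_cases hn : c.2.1 = []
      · have hHc : H c = c := by
          obtain ⟨q, v, p⟩ := c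
          simp only at hn
          subst hn
          rfl
        have h1 : condPerm E H hH c = c := by
          simp [condPerm, hHc]
        simp only [h1, hHc, hG, ite_self, ctl_nil hn]
      have hn' : (H c).2.1 ≠ [] := by
        have := length_gateS h c
        rw [← hHdef] at this
        simp only [Core.len] at this
        rwa [Ne, ← List.length_eq_zero_iff, this, List.length_eq_zero_iff]
      by_cases hcE : c ∈ E'
      · have hcE' := (hmem c).2 hcE
        rw [condPerm_apply_of_mem hH hcE.1 hcE.2]
        cases hD : D d <;> cases s <;>
          simp [hD, hG, hfs, ctl_pos hcE hn, ctl_pos hcE' hn']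
      · have hcE' := mt (hmem c).1 hcE
        have h1 : condPerm E H hH c = c := by
          simp only [condPerm, Equiv.coe_fn_mk]
          exact if_neg hcE
        rw [h1]
        cases hD : D d <;> cases s <;>
          simp [hD, hG, ctl_neg hcE, ctl_neg hcE', hH]
    rw [key]
    exact (((hf.mul (wd_gate _)).mul hf).mul (wd_gate _)).mono (by omega)

/-! ### Patterns of cells -/

/-- The letter under the head satisfies `B`. -/
def headSet (B : Letter → Prop) : Set Core := {c | ∃ a ∈ c.2.1.head?, B a}

theorem mem_headSet_cons {B : Letter → Prop} {q : SQ} {a : Letter} {t : List Letter} {p : ℤ} :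
    ((q, a :: t, p) : Core) ∈ headSet B ↔ B a := by
  simp [headSet]

theorem ctl_headSet (B : Letter → Prop) : Ctl 1 (headSet B) := Ctl.head fun _ => B

/-- The letters from the head on satisfy the given list of conditions. -/
def cellPat : List (Letter → Prop) → Set Core
  | [] => Set.univ
  | B :: l => headSet B ∩ mvT ⁻¹' cellPat l

theorem cellPat_append (l l' : List (Letter → Prop)) :
    cellPat (l ++ l') = cellPat l ∩ ⇑(mvT ^ l.length) ⁻¹' cellPat l' := by
  induction l with
  | nil => simp [cellPat]
  | cons B l ih =>
    rw [List.cons_append, cellPat, ih, cellPat, List.length_cons, pow_succ]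
    ext c
    simp [and_assoc]

theorem mem_cellPat (l : List (Letter → Prop)) (q : SQ) (u w : List Letter) (p : ℤ)
    (h : u.length = l.length) :
    ((q, u ++ w, p) : Core) ∈ cellPat l ↔ List.Forall₂ (fun B a => B a) l u := by
  induction l generalizing u w p with
  | nil =>
    rw [List.length_nil, List.length_eq_zero_iff] at h
    subst h
    simp [cellPat]
  | cons B l ih =>
    obtain _ | ⟨a, u⟩ := u
    · simp at h
    simp only [List.length_cons, Nat.add_right_cancel_iff] at h
    rw [List.forall₂_cons, cellPat, List.cons_append]
    simp only [Set.mem_inter_iff, Set.mem_preimage, mem_headSet_cons, mvT_apply, rotL_cons,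
      List.append_assoc]
    rw [ih u (w ++ [a]) (p + 1) h]

theorem ctl_cellPat_aux (m : ℕ) (l : List (Letter → Prop)) (hl : l.length = m + 1) :
    ∃ n, Ctl n (cellPat l) ∧ n + 900 * (m + 1) ≤ 1000 * (m + 1) ^ 2 := by
  induction m using Nat.strong_induction_on generalizing l with
  | _ m ih =>
    obtain rfl | hm := Nat.eq_zero_or_pos m
    · obtain ⟨B, rfl⟩ := List.length_eq_one_iff.1 hl
      refine ⟨1, (ctl_headSet B).congr fun c _ => ?_, by norm_num⟩
      simp [cellPat]
    · have h1 : (l.take ((m + 1) / 2)).length = (m + 1) / 2 := by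
        rw [List.length_take, hl]
        omega
      have h2 : (l.drop ((m + 1) / 2)).length = (m + 1) - (m + 1) / 2 := by
        rw [List.length_drop, hl]
      obtain ⟨r, hr⟩ : ∃ r, (m + 1) / 2 = r + 1 := ⟨(m + 1) / 2 - 1, by omega⟩
      obtain ⟨r', hr'⟩ : ∃ r', (m + 1) - (m + 1) / 2 = r' + 1 :=
        ⟨(m + 1) - (m + 1) / 2 - 1, by omega⟩
      obtain ⟨n, hn, hnb⟩ := ih r (by omega) _ (h1.trans hr)
      obtain ⟨n', hn', hnb'⟩ := ih r' (by omega) _ (h2.trans hr')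
      have h3 := hn.inter (hn'.preimage (prog_mvT.pow (l.take ((m + 1) / 2)).length))
      rw [← cellPat_append, List.take_append_drop, h1, hr] at h3
      refine ⟨_, h3, ?_⟩
      have : m + 1 = r + r' + 2 := by omega
      have h4 : r' = r ∨ r' = r + 1 := by omega
      rw [this]
      rcases h4 with rfl | rfl <;> nlinarith

theorem ctl_cellPat (l : List (Letter → Prop)) : Ctl (1000 * (l.length + 1) ^ 2) (cellPat l) := by
  obtain h | ⟨m, hm⟩ : l.length = 0 ∨ ∃ m, l.length = m + 1 := by
    cases l <;> simp
  · rw [List.length_eq_zero_iff] at h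
    subst h
    exact Ctl.univ.mono (by norm_num)
  · obtain ⟨n, hn, hnb⟩ := ctl_cellPat_aux m l hm
    refine hn.mono ?_
    rw [hm]
    nlinarith

/-! ### Local programs on two cells -/

/-- The permutation `h` of states and pairs of letters is realized by a program. -/
def Local2 (h : Equiv.Perm (SQ × Letter × Letter)) : Prop :=
  ∃ (n : ℕ) (P : Equiv.Perm Core), Prog n P ∧ ∀ q a b t p,
    P (q, a :: b :: t, p) = ((h (q, a, b)).1, (h (q, a, b)).2.1 :: (h (q, a, b)).2.2 :: t, p)

/-- The group of permutations realized on two cells. -/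
def local2Group : Subgroup (Equiv.Perm (SQ × Letter × Letter)) where
  carrier := {h | Local2 h}
  one_mem' := ⟨0, 1, Prog.one, fun _ _ _ _ _ => rfl⟩
  mul_mem' := by
    rintro h h' ⟨n, P, hP, h1⟩ ⟨n', P', hP', h1'⟩
    exact ⟨_, _, hP.mul hP', fun q a b t p => by simp [h1', h1]⟩
  inv_mem' := by
    rintro h ⟨n, P, hP, h1⟩
    refine ⟨_, _, hP.inv, fun q a b t p => ?_⟩
    rw [Equiv.Perm.inv_eq_iff_eq, h1]
    simp

theorem swap_mem_of_head (q q' : SQ) (a a' b : Letter) :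
    Equiv.swap (q, a, b) (q', a', b) ∈ local2Group := by
  refine ⟨_, _, ((ctl_headSet (· = b)).preimage prog_mvT).condGate
    (h := Equiv.swap (q, a) (q', a')) (by simp), fun x c d t p => ?_⟩
  by_cases hd : d = b
  · subst hd
    rw [condPerm_apply_of_mem _ (by simp [mvT_apply, mem_headSet_cons])
      (by simp [mvT_apply, mem_headSet_cons]), gateS_cons]
    simp only [Equiv.swap_apply_def, Prod.mk.injEq]
    by_cases h1 : x = q ∧ c = a
    · simp [h1]
    · by_cases h2 : x = q' ∧ c = a'
      · simp [h2]
        split_ifs <;> simp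
      · simp only [h1, h2, if_false]
        rw [if_neg (by tauto), if_neg (by tauto)]
        simp
  · rw [condPerm_apply_of_notMem _ (by simp [mvT_apply, mem_headSet_cons, hd]),
      Equiv.swap_apply_of_ne_of_ne (by simp [hd]) (by simp [hd])]

theorem swap_mem_of_tail (q : SQ) (a b b' : Letter) :
    Equiv.swap (q, a, b) (q, a, b') ∈ local2Group := by
  refine ⟨_, _, (prog_mvT.inv.mul (((ctl_headSet (· = a)).preimage prog_mvT.inv).condGate
    (h := Equiv.swap (q, b) (q, b')) (by simp))).mul prog_mvT, fun x c d t p => ?_⟩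
  rw [Equiv.Perm.mul_apply, Equiv.Perm.mul_apply, mvT_apply, rotL_cons, Equiv.Perm.inv_eq_iff_eq,
    mvT_apply, rotL_cons]
  by_cases hc : c = a
  · subst hc
    have h2 : ∀ (y : SQ) (d' : Letter),
        ((y, d' :: t ++ [c], p + 1) : Core) ∈ ⇑(mvT⁻¹) ⁻¹' headSet (· = c) := by
      intro y d'
      rw [Set.mem_preimage, mvT_inv_apply, rotL_symm_append, mem_headSet_cons]
    rw [condPerm_apply_of_mem _ (h2 _ _) (by
      rw [List.cons_append, gateS_cons]
      exact h2 _ _), List.cons_append, gateS_cons]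
    simp only [Equiv.swap_apply_def, Prod.mk.injEq, true_and]
    split_ifs <;> simp
  · rw [condPerm_apply_of_notMem _ (by
      rw [Set.mem_preimage, mvT_inv_apply, rotL_symm_append, mem_headSet_cons]
      exact hc),
      Equiv.swap_apply_of_ne_of_ne (by simp [hc]) (by simp [hc])]

theorem local2_all (h : Equiv.Perm (SQ × Letter × Letter)) : Local2 h := by
  have hs : ∀ y y' : SQ × Letter × Letter, Equiv.swap y y' ∈ local2Group := by
    rintro ⟨q, a, b⟩ ⟨q', a', b'⟩
    exact SubmonoidClass.swap_mem_trans _ (swap_mem_of_head q q' a a' b)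
      (swap_mem_of_tail q' a' b b')
  suffices h ∈ local2Group from this
  induction h using Equiv.Perm.swap_induction_on with
  | one => exact one_mem _
  | swap_mul f x y _ hf => exact mul_mem (hs x y) hf

/-- A program realizing `h` on the first two cells. -/
noncomputable def loc (h : Equiv.Perm (SQ × Letter × Letter)) : Equiv.Perm Core :=
  (local2_all h).choose_spec.choose

/-- The cost of the program `loc h`. -/
noncomputable def locCost (h : Equiv.Perm (SQ × Letter × Letter)) : ℕ := (local2_all h).choose

theorem prog_loc (h : Equiv.Perm (SQ × Letter × Letter)) : Prog (locCost h) (loc h) :=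
  (local2_all h).choose_spec.choose_spec.1

theorem loc_apply (h : Equiv.Perm (SQ × Letter × Letter)) (q : SQ) (a b : Letter)
    (t : List Letter) (p : ℤ) : loc h (q, a :: b :: t, p) =
      ((h (q, a, b)).1, (h (q, a, b)).2.1 :: (h (q, a, b)).2.2 :: t, p) :=
  (local2_all h).choose_spec.choose_spec.2 q a b t p

/-! ### Control by the length of the belt -/

theorem mvT_pow_apply (n : ℕ) (q : SQ) (v : List Letter) (p : ℤ) :
    (mvT ^ n) (q, v, p) = (q, v.rotate n, p + n) := by
  induction n generalizing v p with
  | zero => simp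
  | succ n ih =>
    rw [pow_succ, Equiv.Perm.mul_apply, mvT_apply, ih]
    have : rotL v = v.rotate 1 := rfl
    rw [this, List.rotate_rotate, add_comm 1 n]
    push_cast
    congr 2
    ring

/-- The change of all letters under the head to the next one. -/
def letterSucc : Equiv.Perm (SQ × Letter) := Equiv.prodCongr (Equiv.refl _) (Equiv.addRight 1)

theorem isThreeCycle_pow_three {σ : Equiv.Perm Decor} (hσ : σ.IsThreeCycle) : σ ^ 3 = 1 := by
  rw [← hσ.orderOf, pow_orderOf_eq_one]

theorem isThreeCycle_zpow {σ : Equiv.Perm Decor} (hσ : σ.IsThreeCycle) (z : ℤ) :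
    σ ^ z = 1 ∨ (σ ^ z).IsThreeCycle := by
  have h3 : σ ^ z = σ ^ (z % 3) := by
    have h := isThreeCycle_pow_three hσ
    conv_lhs => rw [← Int.emod_add_mul_ediv z 3]
    rw [zpow_add, zpow_mul, show σ ^ (3 : ℤ) = 1 from mod_cast h]
    simp
  obtain h | h | h : z % 3 = 0 ∨ z % 3 = 1 ∨ z % 3 = 2 := by omega
  · left; rw [h3, h, zpow_zero]
  · right; rw [h3, h, zpow_one]; exact hσ
  · right
    rw [h3, h, show σ ^ (2 : ℤ) = σ * σ from sq σ]
    exact hσ.isThreeCycle_sq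

theorem wd_ctl_dvd (N : ℕ) {σ : Equiv.Perm Decor} (hσ : σ.IsThreeCycle) :
    Wd (400 * N + 10) (ctl {c | c.len ∣ N} σ) := by
  classical
  set φ : Core → Equiv.Perm Decor :=
    fun c => match c.2.1 with | [] => 1 | a :: _ => σ ^ (a : ℕ) with hφ
  have hφ' : ∀ (q : SQ) (v : List Letter) (p : ℤ) (b : Letter), v.head? = some b →
      φ (q, v, p) = σ ^ (b : ℕ) := by
    rintro q (_ | ⟨a, t⟩) p b h
    · simp at h
    · simp at h
      subst h
      rfl
  have h1 : Wd 1 (dec φ) := wd_dec_gate fun y => σ ^ (y.2 : ℕ)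
  have h2 := (prog_mvT.pow N).conj_dec h1
  have h3 := (prog_gateS letterSucc).conj_dec h2
  have h4 := h3.mul h2.inv
  rw [dec_inv, dec_mul] at h4
  have : ctl {c | c.len ∣ N} σ =
      dec fun c => φ ((mvT ^ N) (gateS letterSucc c)) * (φ ((mvT ^ N) c))⁻¹ := by
    unfold ctl
    congr 1
    funext c
    obtain ⟨q, _ | ⟨a, t⟩, p⟩ := c
    · rw [if_neg (by simp), gateS_nil, mul_inv_cancel]
    · have hg : gateS letterSucc (q, a :: t, p) = (q, (a + 1) :: t, p) := rfl
      rw [hg, mvT_pow_apply, mvT_pow_apply]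
      by_cases hd : (a :: t).length ∣ N
      · rw [if_pos ⟨hd, by simp⟩, ← List.rotate_mod, ← List.rotate_mod (a :: t)]
        simp only [List.length_cons] at hd ⊢
        rw [Nat.mod_eq_zero_of_dvd hd, List.rotate_zero, List.rotate_zero,
          hφ' q ((a + 1) :: t) (p + N) (a + 1) rfl, hφ' q (a :: t) (p + N) a rfl,
          eq_mul_inv_iff_mul_eq]
        have h5 := isThreeCycle_pow_three hσ
        fin_cases a
        · simp
        · simp [← sq]
        · simpa [← pow_succ'] using h5
      · rw [if_neg (fun h => hd h.1), ← List.rotate_mod, ← List.rotate_mod (a :: t)]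
        simp only [List.length_cons] at hd ⊢
        have hlt : N % (t.length + 1) < t.length + 1 := Nat.mod_lt _ (by omega)
        obtain ⟨m, hm⟩ : ∃ m, N % (t.length + 1) = m + 1 :=
          ⟨N % (t.length + 1) - 1, by
            have := mt Nat.dvd_of_mod_eq_zero hd
            omega⟩
        have hmt : m < t.length := by omega
        rw [hm, hφ' q _ _ t[m], hφ' q _ _ t[m], mul_inv_cancel]
        · rw [List.head?_rotate (by simp; omega)]
          simp [hmt]
        · rw [List.head?_rotate (by simp; omega)]
          simp [hmt]
  rw [this]
  exact h4.mono (by omega)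

theorem wd_len_zpow (K : ℕ) (g : ℕ → ℤ) (hg : ∀ L, K ≤ L → g L = 0) {σ : Equiv.Perm Decor}
    (hσ : σ.IsThreeCycle) :
    Wd (400 * K ^ 2) (dec fun c => if c.2.1 ≠ [] then σ ^ g c.len else 1) := by
  induction K generalizing g with
  | zero =>
    have : (dec fun c => if c.2.1 ≠ [] then σ ^ g c.len else 1) = 1 := by
      ext κ : 1
      obtain ⟨c, d⟩ := κ
      simp [hg _ (Nat.zero_le _)]
    rw [this]
    exact Wd.one
  | succ K ih =>
    obtain rfl | hK := Nat.eq_zero_or_pos K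
    · have : (dec fun c => if c.2.1 ≠ [] then σ ^ g c.len else 1) = 1 := by
        ext κ : 1
        obtain ⟨c, d⟩ := κ
        by_cases hc : c.2.1 = []
        · simp [hc]
        · rw [dec_apply, hg c.len (List.length_pos_iff.2 hc)]
          simp
      rw [this]
      exact Wd.one.mono (Nat.zero_le _)
    · have h1 := ih (fun L => g L - if L ∣ K then g K else 0) (fun L hL => by
        obtain rfl | hL := hL.eq_or_lt
        · simp
        · simp [hg L hL, Nat.not_dvd_of_pos_of_lt hK hL])
      have h2 : Wd (400 * K + 10) (ctl {c | c.len ∣ K} (σ ^ g K)) := by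
        rcases isThreeCycle_zpow hσ (g K) with h | h
        · rw [h, ctl_one]
          exact Wd.one.mono (Nat.zero_le _)
        · exact wd_ctl_dvd K h
      have h3 := h1.mul h2
      have : (dec fun c => if c.2.1 ≠ [] then σ ^ g c.len else 1) =
          (dec fun c => if c.2.1 ≠ [] then σ ^ (g c.len - if c.len ∣ K then g K else 0) else 1) *
          ctl {c | c.len ∣ K} (σ ^ g K) := by
        rw [ctl, dec_mul]
        congr 1
        funext c
        by_cases hc : c.2.1 = []
        · simp [hc]
        · by_cases hd : c.len ∣ K <;> simp [hc, hd, ← zpow_add]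
      rw [this]
      exact h3.mono (by nlinarith)

theorem ctl_len_lt (K : ℕ) (Z : ℕ → Prop) : Ctl (400 * K ^ 2) {c | c.len < K ∧ Z c.len} := by
  classical
  intro σ hσ
  have h := wd_len_zpow K (fun L => if L < K ∧ Z L then 1 else 0)
    (fun L hL => if_neg fun h => absurd h.1 (by omega)) hσ
  convert h using 1
  unfold ctl
  congr 1
  funext c
  by_cases hc : c.2.1 = [] <;> by_cases hd : c.len < K ∧ Z c.len
  · simp [hc]
  · simp [hc]
  · simp only [Set.mem_ofPred_eq, hc, hd, ne_eq, not_false_eq_true, and_self, if_true, zpow_one]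
  · simp only [Set.mem_ofPred_eq, hc, hd, ne_eq, not_false_eq_true, and_true, if_true, if_false,
      zpow_zero]

theorem ctl_len_eq (L : ℕ) : Ctl (400 * (L + 1) ^ 2) {c | c.len = L} :=
  (ctl_len_lt (L + 1) (· = L)).congr fun c _ => by simp; omega

theorem ctl_len_ge (K : ℕ) : Ctl (400 * K ^ 2 + 1) {c | K ≤ c.len} :=
  (ctl_len_lt K fun _ => True).compl.congr fun c _ => by simp

/-! ### Reversal of the duck -/

/-- The permutation acting as `F` on cores with forward ducks, and as `F⁻¹` on cores with
backward ducks. -/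
def symT (F : Equiv.Perm Core) : Equiv.Perm Conf :=
  lift (fun b => decide (b = 0)) F * lift (fun b => decide (b = 1)) F⁻¹

theorem symT_zero (F : Equiv.Perm Core) (c : Core) (g : Bool × Fin 3) :
    symT F (c, 0, g) = (F c, 0, g) := by
  simp [symT, lift_apply]

theorem symT_one (F : Equiv.Perm Core) (c : Core) (g : Bool × Fin 3) :
    symT F (c, 1, g) = (F⁻¹ c, 1, g) := by
  simp [symT, lift_apply]

theorem symT_zpow_add (F : Equiv.Perm Core) (m n : ℤ) (κ : Conf) :
    symT (F ^ (m + n)) κ = symT (F ^ m) (symT (F ^ n) κ) := by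
  obtain ⟨c, d, g⟩ := κ
  obtain rfl | rfl : d = 0 ∨ d = 1 := by omega
  · simp only [symT_zero, zpow_add, Equiv.Perm.mul_apply]
  · simp only [symT_one, add_comm m n, zpow_add, mul_inv_rev, Equiv.Perm.mul_apply]

theorem smartT_pow (n : ℕ) : smartT ^ n = symT (smartF ^ (n : ℤ)) := by
  induction n with
  | zero =>
    ext κ : 1
    simp [symT, lift_one]
  | succ n ih =>
    ext κ : 1
    rw [pow_succ, ih, Equiv.Perm.mul_apply, Nat.cast_succ, symT_zpow_add, zpow_one]
    rfl

/-- The involution exchanging `c` with a forward duck and `F c` with a backward duck, for the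
nonempty cores `c` in `E`. -/
noncomputable def duckSwap (F : Equiv.Perm Core) (E : Set Core) : Equiv.Perm Conf :=
  lift (fun b => decide (b = 1)) F * ctl E flipDuck * (lift (fun b => decide (b = 1)) F)⁻¹

theorem flipDuck_zero (g : Bool × Fin 3) : flipDuck (0, g) = (1, g) := rfl

theorem flipDuck_one (g : Bool × Fin 3) : flipDuck (1, g) = (0, g) := rfl

theorem duckSwap_zero_pos {F : Equiv.Perm Core} {E : Set Core} {c : Core} (hc : c ∈ E)
    (hn : c.2.1 ≠ []) (g : Bool × Fin 3) : duckSwap F E (c, 0, g) = (F c, 1, g) := by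
  simp [duckSwap, ← lift_inv, lift_apply, ctl_pos hc hn, flipDuck_zero]

theorem duckSwap_zero_neg {F : Equiv.Perm Core} {E : Set Core} {c : Core}
    (hc : ¬ (c ∈ E ∧ c.2.1 ≠ [])) (g : Bool × Fin 3) :
    duckSwap F E (c, 0, g) = (c, 0, g) := by
  have : ctl E flipDuck (c, 0, g) = (c, 0, g) := by
    by_cases h : c ∈ E
    · exact ctl_nil (by tauto) _
    · exact ctl_neg h _
  simp [duckSwap, ← lift_inv, lift_apply, this]

theorem duckSwap_one_pos {F : Equiv.Perm Core} {E : Set Core} {c : Core} (hc : F⁻¹ c ∈ E)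
    (hn : (F⁻¹ c).2.1 ≠ []) (g : Bool × Fin 3) : duckSwap F E (c, 1, g) = (F⁻¹ c, 0, g) := by
  have := ctl_pos (σ := flipDuck) hc hn (1, g)
  rw [flipDuck_one] at this
  have h0 : lift (fun b => decide (b = 1)) F⁻¹ (c, 1, g) = (F⁻¹ c, 1, g) := by simp [lift_apply]
  rw [duckSwap, ← lift_inv, Equiv.Perm.mul_apply, Equiv.Perm.mul_apply, h0, this, lift_apply,
    if_neg (by simp)]

theorem duckSwap_one_neg {F : Equiv.Perm Core} {E : Set Core} {c : Core}
    (hc : ¬ (F⁻¹ c ∈ E ∧ (F⁻¹ c).2.1 ≠ [])) (g : Bool × Fin 3) :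
    duckSwap F E (c, 1, g) = (c, 1, g) := by
  have : ctl E flipDuck (F⁻¹ c, 1, g) = (F⁻¹ c, 1, g) := by
    by_cases h : F⁻¹ c ∈ E
    · exact ctl_nil (by tauto) _
    · exact ctl_neg h _
  have h0 : lift (fun b => decide (b = 1)) F⁻¹ (c, 1, g) = (F⁻¹ c, 1, g) := by simp [lift_apply]
  rw [duckSwap, ← lift_inv, Equiv.Perm.mul_apply, Equiv.Perm.mul_apply, h0, this, lift_apply,
    if_pos (by simp), Equiv.Perm.coe_inv, Equiv.apply_symm_apply]

theorem duckSwap_congr {F P : Equiv.Perm Core} {E : Set Core}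
    (h : ∀ c ∈ E, c.2.1 ≠ [] → P c = F c) : duckSwap F E = duckSwap P E := by
  ext κ : 1
  obtain ⟨c, d, g⟩ := κ
  obtain rfl | rfl : d = 0 ∨ d = 1 := by omega
  · by_cases hc : c ∈ E ∧ c.2.1 ≠ []
    · rw [duckSwap_zero_pos hc.1 hc.2, duckSwap_zero_pos hc.1 hc.2, h c hc.1 hc.2]
    · rw [duckSwap_zero_neg hc, duckSwap_zero_neg hc]
  · by_cases hc : F⁻¹ c ∈ E ∧ (F⁻¹ c).2.1 ≠ []
    · have h1 : F⁻¹ c = P⁻¹ c := by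
        rw [Equiv.Perm.eq_inv_iff_eq, h _ hc.1 hc.2]
        exact F.apply_symm_apply c
      rw [duckSwap_one_pos hc.1 hc.2, duckSwap_one_pos (h1 ▸ hc.1) (h1 ▸ hc.2), h1]
    · have hc' : ¬ (P⁻¹ c ∈ E ∧ (P⁻¹ c).2.1 ≠ []) := by
        intro h2
        have h1 := h _ h2.1 h2.2
        rw [Equiv.Perm.coe_inv, Equiv.apply_symm_apply, eq_comm, ← Equiv.Perm.eq_inv_iff_eq] at h1
        exact hc (h1 ▸ h2)
      rw [duckSwap_one_neg hc, duckSwap_one_neg hc']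

theorem Prog.wd_duckSwap {m n : ℕ} {P F : Equiv.Perm Core} {E : Set Core} (hP : Prog m P)
    (hE : Ctl n E) (h : ∀ c ∈ E, c.2.1 ≠ [] → P c = F c) :
    Wd (2 * m + flipCost * n) (duckSwap F E) := by
  rw [duckSwap_congr h]
  exact (((hP.wd _).mul hE.flipDuck).mul (hP.wd _).inv).mono (by omega)

theorem duckSwap_union {F : Equiv.Perm Core} {E E' : Set Core} (h : Disjoint E E') :
    duckSwap F (E ∪ E') = duckSwap F E * duckSwap F E' := by
  simp only [duckSwap, ctl_union h]
  group

theorem duckSwap_empty (F : Equiv.Perm Core) : duckSwap F ∅ = 1 := by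
  have : ctl ∅ flipDuck = 1 := by
    ext κ : 1
    exact ctl_neg (Set.notMem_empty _) _
  simp [duckSwap, this]

theorem wd_duckSwap_of_key {ι : Type*} [Fintype ι] {n : ℕ} {F : Equiv.Perm Core} {E : Set Core}
    (key : Core → ι) (h : ∀ i, Wd n (duckSwap F {c | c ∈ E ∧ key c = i})) :
    Wd (Fintype.card ι * n) (duckSwap F E) := by
  classical
  have hs : ∀ s : Finset ι, Wd (s.card * n) (duckSwap F {c | c ∈ E ∧ key c ∈ s}) := by
    intro s
    induction s using Finset.induction_on with
    | empty =>
      simpa [duckSwap_empty] using Wd.one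
    | insert i s hi ih =>
      have : {c | c ∈ E ∧ key c ∈ insert i s} =
          {c | c ∈ E ∧ key c = i} ∪ {c | c ∈ E ∧ key c ∈ s} := by
        ext c
        simp only [Finset.mem_insert, Set.mem_ofPred_eq, Set.mem_union]
        tauto
      rw [this, duckSwap_union, Finset.card_insert_of_notMem hi]
      · exact ((h i).mul ih).mono (by rw [Nat.succ_mul]; omega)
      · rw [Set.disjoint_left]
        rintro c ⟨-, rfl⟩ ⟨-, h2⟩
        exact hi h2
  have := hs Finset.univ
  simpa using this

open Classical in
/-- The symmetrized power of the machine is realized with cost `n`, with an exponent depending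
on the length of the belt. -/
def Acts (n : ℕ) (e : ℕ → ℤ) : Prop :=
  ∃ Φ, Wd n Φ ∧ ∀ κ : Conf, κ.1.2.1 ≠ [] → Φ κ = symT (smartF ^ e κ.1.len) κ

theorem len_symT_smartF (z : ℤ) (κ : Conf) : (symT (smartF ^ z) κ).1.len = κ.1.len := by
  have h := prog_smartF.zpow z
  obtain ⟨c, d, g⟩ := κ
  obtain rfl | rfl : d = 0 ∨ d = 1 := by omega
  · rw [symT_zero]
    exact h.len c
  · rw [symT_one]
    exact h.inv.len c

theorem Acts.mono {m n : ℕ} {e : ℕ → ℤ} (h : Acts m e) (hmn : m ≤ n) : Acts n e := by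
  obtain ⟨Φ, h1, h2⟩ := h
  exact ⟨Φ, h1.mono hmn, h2⟩

theorem Acts.zero : Acts 0 0 :=
  ⟨1, Wd.one, fun κ _ => by simp [symT, lift_one]⟩

theorem Acts.add {m n : ℕ} {e e' : ℕ → ℤ} (h : Acts m e) (h' : Acts n e') :
    Acts (m + n) (e + e') := by
  obtain ⟨Φ, h1, h2⟩ := h
  obtain ⟨Φ', h1', h2'⟩ := h'
  refine ⟨Φ * Φ', h1.mul h1', fun κ hκ => ?_⟩
  have hl := len_symT_smartF (e' κ.1.len) κ
  rw [Equiv.Perm.mul_apply, h2' κ hκ, h2 _ (by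
    rw [← List.length_pos_iff] at hκ ⊢
    exact hκ.trans_eq hl.symm), hl, Pi.add_apply, symT_zpow_add]

theorem Acts.nsmul {n : ℕ} {e : ℕ → ℤ} (h : Acts n e) (k : ℕ) : Acts (k * n) (k • e) := by
  induction k with
  | zero => simpa using Acts.zero
  | succ k ih =>
    rw [succ_nsmul, Nat.succ_mul]
    exact ih.add h

open Classical in
theorem acts_of_duckSwap {m n : ℕ} (Z : ℕ → Prop) (z : ℤ)
    (h : Wd m (duckSwap (smartF ^ z) {c | Z c.len})) (hZ : Ctl n {c : Core | Z c.len}) :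
    Acts (m + flipCost * n) (fun L => if Z L then z else 0) := by
  refine ⟨ctl {c : Core | Z c.len} flipDuck * duckSwap (smartF ^ z) {c | Z c.len},
    (hZ.flipDuck.mul h).mono (by omega), ?_⟩
  have hF := prog_smartF.zpow z
  have hne : ∀ {P : Equiv.Perm Core} {c : Core}, (P c).len = c.len → c.2.1 ≠ [] →
      (P c).2.1 ≠ [] := by
    intro P c hP hc
    rw [← List.length_pos_iff] at hc ⊢
    exact hc.trans_eq hP.symm
  rintro ⟨c, d, g⟩ hκ
  obtain rfl | rfl : d = 0 ∨ d = 1 := by omega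
  · rw [symT_zero, Equiv.Perm.mul_apply]
    by_cases hc : Z c.len
    · have h1 : (smartF ^ z) c ∈ {c : Core | Z c.len} := by
        rw [Set.mem_ofPred_eq, hF.len]
        exact hc
      rw [duckSwap_zero_pos (show c ∈ {c : Core | Z c.len} from hc) hκ,
        ctl_pos h1 (hne (hF.len c) hκ), flipDuck_one]
      simp only [hc, if_true]
    · rw [duckSwap_zero_neg (fun h => hc h.1), ctl_neg (show c ∉ {c : Core | Z c.len} from hc)]
      simp [hc]
  · rw [symT_one, Equiv.Perm.mul_apply]
    have hl := hF.inv.len c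
    by_cases hc : Z c.len
    · have h1 : (smartF ^ z)⁻¹ c ∈ {c : Core | Z c.len} := by
        rw [Set.mem_ofPred_eq, hl]
        exact hc
      rw [duckSwap_one_pos h1 (hne hl hκ), ctl_pos h1 (hne hl hκ), flipDuck_zero]
      simp only [hc, if_true]
    · rw [duckSwap_one_neg (fun h => hc (by have := h.1; rwa [Set.mem_ofPred_eq, hl] at this)),
        ctl_neg (show c ∉ {c : Core | Z c.len} from hc)]
      simp [hc]

/-! ### The gap machine -/

/-- A head between two cells of a cyclic word: the arrow, the word read from the cell to the
left of the gap on, and the position of that cell. -/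
abbrev Gap : Type := Arrow × List Letter × ℤ

/-- The matching table of the SMART machine. -/
def matchT : Arrow → Letter → Arrow × Letter
  | .rf, 0 => (.lf, 1)
  | .rf, 1 => (.lh, 1)
  | .rf, 2 => (.lh, 2)
  | .lf, 0 => (.rf, 1)
  | .lf, 1 => (.rh, 1)
  | .lf, 2 => (.rh, 2)
  | .rh, 0 => (.rf, 2)
  | .rh, 1 => (.rf, 0)
  | .rh, 2 => (.lh, 0)
  | .lh, 0 => (.lf, 2)
  | .lh, 1 => (.lf, 0)
  | .lh, 2 => (.rh, 0)

theorem smartGate_zero (x : Arrow) (a : Letter) :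
    smartGate ((x, 0), a) = (((matchT x a).1, 1), (matchT x a).2) := by
  revert x a; decide

/-- One step of the gap machine. -/
def micro : Gap → Gap
  | (x, d :: c :: w, p) =>
    if x.isR = true then
      if (matchT x c).1.isR = true then
        ((matchT x c).1, rotL (d :: (matchT x c).2 :: w), p + 1)
      else ((matchT x c).1, d :: (matchT x c).2 :: w, p)
    else
      if (matchT x d).1.isR = true then ((matchT x d).1, (matchT x d).2 :: c :: w, p)
      else ((matchT x d).1, rotL.symm ((matchT x d).2 :: c :: w), p - 1)
  | Y => Y

/-- The arrow of a gap, the letter to its left, the two letters to its right, and the second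
letter to its left. -/
abbrev Win : Type := Arrow × Letter × Letter × Letter × Letter

/-- The window of a gap. -/
def win (Y : Gap) : Win :=
  (Y.1, Y.2.1.getD 0 0, Y.2.1.getD 1 0, Y.2.1.getD 2 0, Y.2.1.getLastD 0)

/-- The arrows `▶` and `◁`. -/
def Arrow.outer : Arrow → Bool
  | .rf => true
  | .lh => true
  | _ => false

/-- The type of an arrow: `0` for the filled ones, `1` for the hollow ones. -/
def Arrow.hol : Arrow → ℤ
  | .rf => 0
  | .lf => 0
  | _ => 1

/-- The windows occurring as starts of renormalized steps. -/
def Win.valid : Win → Bool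
  | (x, d, c, _, _) => if x.outer = true then decide (d ≠ 0) else decide (c ≠ 0)

/-- The number of steps of the gap machine in a renormalized step. -/
def Win.cnt : Win → ℕ
  | (.lh, d, c, _, e) => if d = 1 then if e = 0 then 2 else 3 else if c = 0 then 2 else 1
  | (.rh, d, c, r, _) => if c = 1 then if r = 0 then 2 else 3 else if d = 0 then 2 else 1
  | _ => 1

/-- The correction of the duration of a renormalized step. -/
def Win.corr : Win → ℤ
  | (.rf, _, c, _, _) => if c = 0 then 0 else 1
  | (.lf, d, _, _, _) => if d = 0 then 0 else 1
  | (.lh, d, _, _, e) => if d = 1 ∧ e ≠ 0 then 1 else 0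
  | (.rh, _, c, r, _) => if c = 1 ∧ r ≠ 0 then 1 else 0

/-- The change of the type of the arrow in a renormalized step. -/
def Win.turn (W : Win) : ℤ := 1 + W.corr - W.cnt

/-- A renormalized step. -/
def bigStep (Y : Gap) : Gap := micro^[(win Y).cnt] Y

/-- The table of the insertion of a digit. -/
def colT : Arrow → Letter → Letter → Arrow × Letter × Letter
  | .rf, 0, o => (.rf, o, 0)
  | .rf, 1, o => (.lf, o, 1)
  | .rf, 2, o => (.rh, o, 1)
  | .lh, 0, o => (.lf, o, 2)
  | .lh, 1, o => (.rh, o, 2)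
  | .lh, 2, o => (.lh, o, 0)
  | .lf, 0, o => (.lf, 0, o)
  | .lf, 1, o => (.rf, 1, o)
  | .lf, 2, o => (.lh, 1, o)
  | .rh, 0, o => (.rf, 2, o)
  | .rh, 1, o => (.lh, 2, o)
  | .rh, 2, o => (.rh, 0, o)

/-- Insertion of a digit at the gap. -/
def col : Gap → Letter → Gap
  | (x, a :: b :: w, p), j =>
    if x.outer = true then
      ((colT x j a).1, (colT x j a).2.1 :: (colT x j a).2.2 :: b :: w, p - 1)
    else ((colT x j b).1, (colT x j b).2.1 :: (colT x j b).2.2 :: (w ++ [a]), p)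
  | Y, _ => Y

theorem rotL_symm_cons (a b c e : Letter) (M : List Letter) :
    rotL.symm (a :: b :: c :: (M ++ [e])) = e :: a :: b :: c :: M := by
  rw [Equiv.symm_apply_eq]; simp

theorem rotL_symm_cons' (a b c d e : Letter) (M : List Letter) :
    rotL.symm (a :: b :: c :: (M ++ [e, d])) = d :: a :: b :: c :: (M ++ [e]) := by
  rw [Equiv.symm_apply_eq]; simp

theorem rotL_symm_cons₂ (a b d e : Letter) (M : List Letter) :
    rotL.symm (a :: b :: (M ++ [e, d])) = d :: a :: b :: (M ++ [e]) := by
  rw [Equiv.symm_apply_eq]; simp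

theorem rotL_symm_cons₃ (a b c d e : Letter) (M : List Letter) :
    rotL.symm (a :: b :: (M ++ [e, d, c])) = c :: a :: b :: (M ++ [e, d]) := by
  rw [Equiv.symm_apply_eq]; simp

theorem rotL_symm_cons₄ (a b c d e : Letter) (M : List Letter) :
    rotL.symm (a :: b :: c :: d :: (M ++ [e])) = e :: a :: b :: c :: d :: M := by
  rw [Equiv.symm_apply_eq]; simp

theorem exists_window {u : List Letter} (hu : 4 ≤ u.length) :
    ∃ d c r e M, u = d :: c :: r :: (M ++ [e]) := by
  obtain _ | ⟨d, _ | ⟨c, _ | ⟨r, t⟩⟩⟩ := u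
  · simp at hu
  · simp at hu
  · simp at hu
  · obtain ⟨M, e, rfl⟩ := List.eq_nil_or_concat t |>.resolve_left (by rintro rfl; simp at hu)
    exact ⟨d, c, r, e, M, by simp⟩

theorem win_window (x : Arrow) (d c r e : Letter) (M : List Letter) (p : ℤ) :
    win (x, d :: c :: r :: (M ++ [e]), p) = (x, d, c, r, e) := by
  simp [win, List.getLast?_cons]

theorem bigStep_window (x : Arrow) (d c r e : Letter) (M : List Letter) (p : ℤ)
    (h : Win.valid (x, d, c, r, e) = true) :
    Win.valid (win (bigStep (x, d :: c :: r :: (M ++ [e]), p))) = true ∧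
    (bigStep (x, d :: c :: r :: (M ++ [e]), p)).1.hol = x.hol + Win.turn (x, d, c, r, e) := by
  rw [bigStep, win_window]
  cases x <;> fin_cases d <;> fin_cases c <;> first
    | (exfalso; revert h; simp [Win.valid, Arrow.outer]; done)
    | (simp [Win.cnt, micro, matchT, Arrow.isR, win, Win.valid,
        Arrow.outer, Arrow.hol, Win.turn, Win.corr]; done)
    | (fin_cases r <;> simp [Win.cnt, micro, matchT, Arrow.isR, rotL_symm_cons₂, win, Win.valid,
        Arrow.outer, Arrow.hol, Win.turn, Win.corr]; done)
    | (fin_cases e <;> simp [Win.cnt, micro, matchT, Arrow.isR, rotL_symm_cons, win, Win.valid,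
        Arrow.outer, Arrow.hol, Win.turn, Win.corr])

theorem col_window (x : Arrow) (d c r e j : Letter) (M : List Letter) (p : ℤ)
    (h : Win.valid (x, d, c, r, e) = true) :
    Win.valid (win (col (x, d :: c :: r :: (M ++ [e]), p) j)) = true := by
  cases x <;> fin_cases j <;> simp_all [col, colT, Arrow.outer, win, Win.valid]

theorem bigStep_col_zero (x : Arrow) (d c r e : Letter) (M : List Letter) (p : ℤ)
    (h : Win.valid (x, d, c, r, e) = true) :
    bigStep (col (x, d :: c :: r :: (M ++ [e]), p) 0) =
      col (x, d :: c :: r :: (M ++ [e]), p) 1 := by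
  cases x <;> fin_cases d <;> fin_cases c <;> first
    | (exfalso; revert h; simp [Win.valid, Arrow.outer]; done)
    | (simp [bigStep, win, Win.cnt, col, colT, micro, matchT, Arrow.isR, Arrow.outer])

theorem bigStep_col_one (x : Arrow) (d c r e : Letter) (M : List Letter) (p : ℤ)
    (h : Win.valid (x, d, c, r, e) = true) :
    bigStep (col (x, d :: c :: r :: (M ++ [e]), p) 1) =
      col (x, d :: c :: r :: (M ++ [e]), p) 2 := by
  cases x <;> fin_cases d <;> fin_cases c <;> first
    | (exfalso; revert h; simp [Win.valid, Arrow.outer]; done)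
    | (simp [bigStep, win, Win.cnt, col, colT, micro, matchT, Arrow.isR, Arrow.outer])

set_option maxHeartbeats 1000000 in
theorem bigStep_col_two (x : Arrow) (d c r e : Letter) (M : List Letter) (p : ℤ)
    (h : Win.valid (x, d, c, r, e) = true) :
    bigStep (col (x, d :: c :: r :: (M ++ [e]), p) 2) =
      col (bigStep (x, d :: c :: r :: (M ++ [e]), p)) 0 := by
  cases x <;> fin_cases d <;> fin_cases c <;> first
    | (exfalso; revert h; simp [Win.valid, Arrow.outer]; done)
    | (simp [bigStep, win, Win.cnt, col, colT, micro, matchT, Arrow.isR, Arrow.outer,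
        rotL_symm_cons']; done)
    | (fin_cases r <;> simp [bigStep, win, Win.cnt, col, colT, micro, matchT, Arrow.isR,
        Arrow.outer, rotL_symm_cons₂, rotL_symm_cons₃]; done)
    | (fin_cases e <;> simp [bigStep, win, Win.cnt, col, colT, micro, matchT, Arrow.isR,
        Arrow.outer, rotL_symm_cons, rotL_symm_cons', rotL_symm_cons₄, List.getLast?_cons])

theorem corr_col (x : Arrow) (d c r e : Letter) (M : List Letter) (p : ℤ)
    (h : Win.valid (x, d, c, r, e) = true) :
    (win (col (x, d :: c :: r :: (M ++ [e]), p) 0)).corr = x.hol ∧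
    (win (col (x, d :: c :: r :: (M ++ [e]), p) 1)).corr = 1 - x.hol ∧
    (win (col (x, d :: c :: r :: (M ++ [e]), p) 2)).corr = Win.corr (x, d, c, r, e) := by
  cases x <;> fin_cases d <;> fin_cases c <;> first
    | (exfalso; revert h; simp [Win.valid, Arrow.outer]; done)
    | (simp [win, Win.corr, col, colT, Arrow.outer, Arrow.hol, List.getLast?_cons])

theorem hol_col (x : Arrow) (d c r e : Letter) (M : List Letter) (p : ℤ) :
    (col (x, d :: c :: r :: (M ++ [e]), p) 0).1.hol = 0 ∧
    (col (x, d :: c :: r :: (M ++ [e]), p) 1).1.hol = x.hol ∧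
    (col (x, d :: c :: r :: (M ++ [e]), p) 2).1.hol = 1 := by
  cases x <;> simp [col, colT, Arrow.outer, Arrow.hol]

theorem exists_col (x : Arrow) (d c r s e : Letter) (M : List Letter) (p : ℤ)
    (h : Win.valid (x, d, c, r, e) = true) :
    ∃ Y : Gap, ∃ j, Win.valid (win Y) = true ∧ 4 ≤ Y.2.1.length ∧
      col Y j = (x, d :: c :: r :: s :: (M ++ [e]), p) := by
  have key : ∀ (x : Arrow) (d c : Letter), Win.valid (x, d, c, r, e) = true →
      ∃ (y : Arrow) (j o : Letter), o ≠ 0 ∧ colT y j o = (x, d, c) := by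
    simp only [Win.valid]
    decide
  obtain ⟨y, j, o, ho, hy⟩ := key x d c h
  by_cases hyo : y.outer = true
  · refine ⟨(y, o :: r :: s :: (M ++ [e]), p + 1), j, ?_, by simp, ?_⟩
    · simp [win, Win.valid, hyo, ho]
    · simp [col, hyo, hy]
  · refine ⟨(y, e :: o :: r :: s :: M, p), j, ?_, by simp, ?_⟩
    · simp [win, Win.valid, hyo, ho]
    · simp [col, hyo, hy]

/-- A gap from which renormalized steps start. -/
structure Good (Y : Gap) : Prop where
  valid : Win.valid (win Y) = true
  length : 4 ≤ Y.2.1.length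

theorem Good.exists_window {Y : Gap} (h : Good Y) : ∃ x d c r e M p,
    Y = (x, d :: c :: r :: (M ++ [e]), p) ∧ win Y = (x, d, c, r, e) ∧
      Win.valid (x, d, c, r, e) = true := by
  obtain ⟨x, u, p⟩ := Y
  obtain ⟨d, c, r, e, M, rfl⟩ := _root_.exists_window h.length
  have h1 := h.valid
  rw [win_window] at h1
  exact ⟨x, d, c, r, e, M, p, rfl, win_window .., h1⟩

theorem length_micro (Y : Gap) : (micro Y).2.1.length = Y.2.1.length := by
  obtain ⟨x, _ | ⟨d, _ | ⟨c, w⟩⟩, p⟩ := Y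
  · rfl
  · rfl
  · rw [micro]
    split_ifs <;> simp

theorem length_micro_iterate (n : ℕ) (Y : Gap) : (micro^[n] Y).2.1.length = Y.2.1.length := by
  induction n generalizing Y with
  | zero => rfl
  | succ n ih => rw [Function.iterate_succ_apply, ih, length_micro]

theorem length_bigStep (Y : Gap) : (bigStep Y).2.1.length = Y.2.1.length :=
  length_micro_iterate _ _

theorem length_col {Y : Gap} (h : 2 ≤ Y.2.1.length) (j : Letter) :
    (col Y j).2.1.length = Y.2.1.length + 1 := by
  obtain ⟨x, _ | ⟨d, _ | ⟨c, w⟩⟩, p⟩ := Y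
  · simp at h
  · simp at h
  · rw [col]
    split_ifs <;> simp

theorem Good.bigStep {Y : Gap} (h : Good Y) : Good (bigStep Y) := by
  refine ⟨?_, (length_bigStep Y).symm ▸ h.length⟩
  obtain ⟨x, d, c, r, e, M, p, rfl, -, h2⟩ := h.exists_window
  exact (bigStep_window x d c r e M p h2).1

theorem Good.hol_bigStep {Y : Gap} (h : Good Y) :
    (_root_.bigStep Y).1.hol = Y.1.hol + (win Y).turn := by
  obtain ⟨x, d, c, r, e, M, p, rfl, h1, h2⟩ := h.exists_window
  rw [h1]
  exact (bigStep_window x d c r e M p h2).2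

theorem Good.col {Y : Gap} (h : Good Y) (j : Letter) : Good (col Y j) := by
  refine ⟨?_, by rw [length_col (by have := h.length; omega)]; have := h.length; omega⟩
  obtain ⟨x, d, c, r, e, M, p, rfl, -, h2⟩ := h.exists_window
  exact col_window x d c r e j M p h2

theorem Good.bigStep_col {Y : Gap} (h : Good Y) :
    _root_.bigStep (_root_.col Y 0) = _root_.col Y 1 ∧
    _root_.bigStep (_root_.col Y 1) = _root_.col Y 2 ∧
    _root_.bigStep (_root_.col Y 2) = _root_.col (_root_.bigStep Y) 0 := by
  obtain ⟨x, d, c, r, e, M, p, rfl, -, h2⟩ := h.exists_window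
  exact ⟨bigStep_col_zero x d c r e M p h2, bigStep_col_one x d c r e M p h2,
    bigStep_col_two x d c r e M p h2⟩

theorem Good.corr_col {Y : Gap} (h : Good Y) :
    (win (_root_.col Y 0)).corr = Y.1.hol ∧ (win (_root_.col Y 1)).corr = 1 - Y.1.hol ∧
    (win (_root_.col Y 2)).corr = (win Y).corr := by
  obtain ⟨x, d, c, r, e, M, p, rfl, h1, h2⟩ := h.exists_window
  rw [h1]
  exact _root_.corr_col x d c r e M p h2

theorem Good.hol_col {Y : Gap} (h : Good Y) :
    (_root_.col Y 0).1.hol = 0 ∧ (_root_.col Y 1).1.hol = Y.1.hol ∧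
    (_root_.col Y 2).1.hol = 1 := by
  obtain ⟨x, d, c, r, e, M, p, rfl, h1, h2⟩ := h.exists_window
  exact _root_.hol_col x d c r e M p

theorem Good.exists_col {Y : Gap} (h : Good Y) (h5 : 5 ≤ Y.2.1.length) :
    ∃ Y' j, Good Y' ∧ _root_.col Y' j = Y := by
  obtain ⟨x, d, c, r, e, M, p, rfl, h1, h2⟩ := h.exists_window
  obtain _ | ⟨s, M⟩ := M
  · simp at h5
  · obtain ⟨Y', j, h3, h4, h6⟩ := _root_.exists_col x d c r s e M p h2
    exact ⟨Y', j, ⟨h3, h4⟩, h6⟩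

/-- Translation of the position of a gap. -/
def Gap.shift (s : ℤ) (Y : Gap) : Gap := (Y.1, Y.2.1, Y.2.2 + s)

theorem micro_shift (s : ℤ) (Y : Gap) : micro (Y.shift s) = (micro Y).shift s := by
  obtain ⟨x, _ | ⟨d, _ | ⟨c, w⟩⟩, p⟩ := Y
  · rfl
  · rfl
  · simp only [Gap.shift, micro]
    split_ifs
    · simp only [Prod.mk.injEq, true_and]; ring
    · rfl
    · rfl
    · simp only [Prod.mk.injEq, true_and]; ring

theorem micro_iterate_shift (n : ℕ) (s : ℤ) (Y : Gap) :
    micro^[n] (Y.shift s) = (micro^[n] Y).shift s := by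
  induction n generalizing Y with
  | zero => rfl
  | succ n ih => rw [Function.iterate_succ_apply, micro_shift, ih, Function.iterate_succ_apply]

/-! ### Programs for the gap machine -/

theorem exists_perm_extend {α : Type*} [Fintype α] (s : Set α) (f : α → α) (h : s.InjOn f) :
    ∃ g : Equiv.Perm α, ∀ i ∈ s, g i = f i := by
  classical
  obtain ⟨g, hg⟩ := Set.MapsTo.exists_equiv_extend_of_card_eq (t := Finset.univ) (s := s) (f := f)
    (by simp) (by simp [Set.MapsTo]) h
  refine ⟨Equiv.ofBijective (fun i => (g i : α)) ?_, fun i hi => hg i hi⟩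
  rw [← Finite.injective_iff_bijective]
  exact Subtype.val_injective.comp g.injective

theorem mvS_pow_append (A : SQ → Prop) [DecidablePred A] {q : SQ} (hq : A q)
    (u w : List Letter) (p : ℤ) :
    (mvS A ^ u.length) (q, u ++ w, p) = (q, w ++ u, p + u.length) := by
  induction u generalizing w p with
  | nil => simp
  | cons a u ih =>
    rw [List.length_cons, pow_succ, Equiv.Perm.mul_apply, List.cons_append, mvS_pos A hq,
      rotL_cons, List.append_assoc, ih, List.append_assoc]
    congr 2
    push_cast
    ring

/-- The exchange of two letters in the states of `A`. -/
def swapOn (A : SQ → Prop) [DecidablePred A] : Equiv.Perm (SQ × Letter × Letter) where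
  toFun y := if A y.1 then (y.1, y.2.2, y.2.1) else y
  invFun y := if A y.1 then (y.1, y.2.2, y.2.1) else y
  left_inv y := by by_cases h : A y.1 <;> simp [h]
  right_inv y := by by_cases h : A y.1 <;> simp [h]

theorem loc_swapOn_pos (A : SQ → Prop) [DecidablePred A] {q : SQ} (hq : A q) (a b : Letter)
    (t : List Letter) (p : ℤ) : loc (swapOn A) (q, a :: b :: t, p) = (q, b :: a :: t, p) := by
  simp [loc_apply, swapOn, hq]

theorem loc_swapOn_neg (A : SQ → Prop) [DecidablePred A] {q : SQ} (hq : ¬ A q) (a b : Letter)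
    (t : List Letter) (p : ℤ) : loc (swapOn A) (q, a :: b :: t, p) = (q, a :: b :: t, p) := by
  simp [loc_apply, swapOn, hq]

theorem carry_pow (A : SQ → Prop) [DecidablePred A] {q : SQ} (hq : A q) (e : Letter)
    (z w : List Letter) (p : ℤ) :
    ((mvS A * loc (swapOn A)) ^ z.length) (q, e :: (z ++ w), p) =
      (q, e :: (w ++ z), p + z.length) := by
  induction z generalizing w p with
  | nil => simp
  | cons a z ih =>
    rw [List.length_cons, pow_succ, Equiv.Perm.mul_apply, Equiv.Perm.mul_apply, List.cons_append,
      loc_swapOn_pos A hq, mvS_pos A hq, rotL_cons, List.cons_append, List.append_assoc, ih,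
      List.append_assoc]
    congr 2
    push_cast
    ring

/-- In the states of `A`, the letter on the other side of a zone of `m` letters to the left of
the head is carried over that zone to the head. -/
noncomputable def fetch (A : SQ → Prop) [DecidablePred A] (m : ℕ) : Equiv.Perm Core :=
  (mvS A * loc (swapOn A)) ^ m * (mvS A ^ (m + 1))⁻¹

theorem fetch_pos (A : SQ → Prop) [DecidablePred A] {q : SQ} (hq : A q) {m : ℕ}
    {z : List Letter} (hz : z.length = m) (u : List Letter) (e : Letter) (p : ℤ) :
    fetch A m (q, u ++ e :: z, p) = (q, e :: (u ++ z), p - 1) := by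
  subst hz
  have h1 : (mvS A ^ (z.length + 1))⁻¹ (q, u ++ e :: z, p) =
      (q, e :: (z ++ u), p - (z.length + 1 : ℕ)) := by
    rw [Equiv.Perm.inv_eq_iff_eq]
    have := mvS_pow_append A hq (e :: z) u (p - (z.length + 1 : ℕ))
    rw [List.length_cons, List.cons_append] at this
    rw [this]
    simp
  rw [fetch, Equiv.Perm.mul_apply, h1, carry_pow A hq]
  congr 2
  push_cast
  ring

theorem pow_apply_eq_self {α : Type*} {P : Equiv.Perm α} {c : α} (h : P c = c) (n : ℕ) :
    (P ^ n) c = c := by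
  induction n with
  | zero => rfl
  | succ n ih => rw [pow_succ, Equiv.Perm.mul_apply, h, ih]

theorem fetch_neg (A : SQ → Prop) [DecidablePred A] {q : SQ} (hq : ¬ A q) (m : ℕ)
    (a b : Letter) (t : List Letter) (p : ℤ) :
    fetch A m (q, a :: b :: t, p) = (q, a :: b :: t, p) := by
  have h1 : (mvS A) (q, a :: b :: t, p) = (q, a :: b :: t, p) := mvS_neg A hq _ _
  rw [fetch, Equiv.Perm.mul_apply, Equiv.Perm.inv_eq_iff_eq.2 (pow_apply_eq_self h1 _).symm]
  exact pow_apply_eq_self (by rw [Equiv.Perm.mul_apply, loc_swapOn_neg A hq, h1]) _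

theorem exists_prog_fetch (A : SQ → Prop) [DecidablePred A] :
    ∃ n, ∀ m, Prog (n * (m + 1)) (fetch A m) := by
  refine ⟨96 + locCost (swapOn A) + 96, fun m => ?_⟩
  refine ((((prog_mvS A).mul (prog_loc (swapOn A))).pow m).mul
    ((prog_mvS A).pow (m + 1)).inv).mono ?_
  nlinarith

/-- A gap with a zone of digits to the left. -/
def emb (Y : Gap) (z : List Letter) : Core := ((Y.1, 0), Y.2.1 ++ z, Y.2.2)

theorem exists_insertion : ∃ h : Equiv.Perm (SQ × Letter × Letter), ∀ (x : Arrow) (j o : Letter),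
    o ≠ 0 → h ((x, 0), j, o) = (((colT x j o).1, 0), (colT x j o).2) := by
  have key : ∀ (x : Arrow) (j o : Letter), o ≠ 0 → ∀ (x' : Arrow) (j' o' : Letter), o' ≠ 0 →
      colT x j o = colT x' j' o' → x = x' ∧ j = j' ∧ o = o' := by
    decide +kernel
  obtain ⟨h, hh⟩ := exists_perm_extend {y : SQ × Letter × Letter | y.1.2 = 0 ∧ y.2.2 ≠ 0}
    (fun y => (((colT y.1.1 y.2.1 y.2.2).1, 0), (colT y.1.1 y.2.1 y.2.2).2)) (by
      rintro ⟨⟨x, s⟩, j, o⟩ ⟨hs, ho⟩ ⟨⟨x', s'⟩, j', o'⟩ ⟨hs', ho'⟩ he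
      simp only at hs ho hs' ho'
      subst hs hs'
      simp only [Prod.mk.injEq, and_true] at he
      obtain ⟨rfl, rfl, rfl⟩ := key x j o ho x' j' o' ho' (Prod.ext he.1 he.2)
      rfl)
  exact ⟨h, fun x j o ho => hh ((x, 0), j, o) ⟨rfl, ho⟩⟩

/-- The insertion of a digit on two cells. -/
noncomputable def insertion : Equiv.Perm (SQ × Letter × Letter) := exists_insertion.choose

theorem insertion_apply (x : Arrow) (j : Letter) {o : Letter} (ho : o ≠ 0) :
    insertion ((x, 0), j, o) = (((colT x j o).1, 0), (colT x j o).2) :=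
  exists_insertion.choose_spec x j o ho

theorem loc_insertion_inv (x : Arrow) (j : Letter) {o : Letter} (ho : o ≠ 0) (t : List Letter)
    (p : ℤ) : (loc insertion)⁻¹
      (((colT x j o).1, 0), (colT x j o).2.1 :: (colT x j o).2.2 :: t, p) =
      ((x, 0), j :: o :: t, p) := by
  rw [Equiv.Perm.inv_eq_iff_eq, loc_apply, insertion_apply x j ho]

/-- The extraction of a digit, which is added to the zone of `k` digits. -/
noncomputable def extract (k : ℕ) : Equiv.Perm Core :=
  fetch (fun q => q.1.outer = false) (k + 1) * mvT * (loc insertion)⁻¹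

theorem extract_emb {k : ℕ} {Y : Gap} (hY : Good Y) {z : List Letter} (hz : z.length = k)
    (j : Letter) : extract k (emb (col Y j) z) = emb Y (z ++ [j]) := by
  obtain ⟨x, d, c, r, e, M, p, rfl, -, h⟩ := hY.exists_window
  rw [extract, Equiv.Perm.mul_apply, Equiv.Perm.mul_apply]
  by_cases hx : x.outer = true
  · have hd : d ≠ 0 := by simpa [Win.valid, hx] using h
    have h1 : emb (col (x, d :: c :: r :: (M ++ [e]), p) j) z =
        (((colT x j d).1, 0), (colT x j d).2.1 :: (colT x j d).2.2 ::
          (c :: r :: (M ++ [e]) ++ z), p - 1) := by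
      simp [emb, col, hx]
    rw [h1, loc_insertion_inv x j hd, mvT_apply, rotL_cons]
    simp only [List.cons_append]
    rw [fetch_neg _ (by simp [hx])]
    simp [emb]
  · have hc : c ≠ 0 := by simpa [Win.valid, hx] using h
    have h1 : emb (col (x, d :: c :: r :: (M ++ [e]), p) j) z =
        (((colT x j c).1, 0), (colT x j c).2.1 :: (colT x j c).2.2 ::
          (r :: (M ++ [e]) ++ [d] ++ z), p) := by
      simp [emb, col, hx]
    rw [h1, loc_insertion_inv x j hc, mvT_apply, rotL_cons]
    have h2 : c :: (r :: (M ++ [e]) ++ [d] ++ z) ++ [j] =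
        (c :: r :: (M ++ [e])) ++ d :: (z ++ [j]) := by simp
    rw [h2, fetch_pos _ (by simpa using hx) (by simp [hz])]
    simp [emb]

theorem exists_prog_extract : ∃ n, ∀ k, Prog (n * (k + 1)) (extract k) := by
  obtain ⟨n, hn⟩ := exists_prog_fetch fun q => q.1.outer = false
  refine ⟨2 * n + 96 + locCost insertion, fun k => ?_⟩
  refine (((hn (k + 1)).mul prog_mvT).mul (prog_loc insertion).inv).mono ?_
  nlinarith

/-- The predicate selecting the states whose head is to the right of the gap. -/
abbrev SQ.ahead (q : SQ) : Prop := q.2 = 0 ∧ q.1.isR = true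

/-- The extraction of `k` digits. -/
noncomputable def renorm : ℕ → Equiv.Perm Core
  | 0 => (mvS SQ.ahead)⁻¹
  | k + 1 => extract k * renorm k

theorem exists_prog_renorm : ∃ n, ∀ k, Prog (n * (k + 1) ^ 2) (renorm k) := by
  obtain ⟨n, hn⟩ := exists_prog_extract
  refine ⟨n + 96, fun k => ?_⟩
  induction k with
  | zero => exact (prog_mvS _).inv.mono (by omega)
  | succ k ih =>
    refine ((hn k).mul ih).mono ?_
    nlinarith

/-- The table of a step of the gap machine on two cells; the second component of the state
records whether the gap has to move. -/
def stepT (y : SQ × Letter × Letter) : SQ × Letter × Letter :=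
  if y.1.1.isR = true then
    (((matchT y.1.1 y.2.2).1, if (matchT y.1.1 y.2.2).1.isR = true then 1 else 0),
      y.2.1, (matchT y.1.1 y.2.2).2)
  else
    (((matchT y.1.1 y.2.1).1, if (matchT y.1.1 y.2.1).1.isR = true then 0 else 1),
      (matchT y.1.1 y.2.1).2, y.2.2)

theorem exists_stepT : ∃ h : Equiv.Perm (SQ × Letter × Letter), ∀ (x : Arrow) (d c : Letter),
    h ((x, 0), d, c) = stepT ((x, 0), d, c) := by
  have key : ∀ (x : Arrow) (d c : Letter) (x' : Arrow) (d' c' : Letter),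
      stepT ((x, 0), d, c) = stepT ((x', 0), d', c') → x = x' ∧ d = d' ∧ c = c' := by
    decide +kernel
  obtain ⟨h, hh⟩ := exists_perm_extend {y : SQ × Letter × Letter | y.1.2 = 0} stepT (by
      rintro ⟨⟨x, s⟩, d, c⟩ hs ⟨⟨x', s'⟩, d', c'⟩ hs' he
      simp only [Set.mem_ofPred_eq] at hs hs'
      subst hs hs'
      obtain ⟨rfl, rfl, rfl⟩ := key _ _ _ _ _ _ he
      rfl)
  exact ⟨h, fun x d c => hh ((x, 0), d, c) rfl⟩

/-- The cells around the gap after a step, with the record of the move. -/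
def moved (y : SQ × Letter × Letter) : Prop :=
  y.1.2 = 1 ↔ (y.1.1 = .rf ∧ y.2.1 ≠ 1) ∨ (y.1.1 = .lf ∧ y.2.2 ≠ 1)

theorem exists_clear : ∃ h : Equiv.Perm (SQ × Letter × Letter), ∀ y, moved y →
    h y = ((y.1.1, 0), y.2) := by
  refine exists_perm_extend {y | moved y} (fun y => ((y.1.1, 0), y.2)) ?_
  rintro ⟨⟨x, s⟩, y⟩ h ⟨⟨x', s'⟩, y'⟩ h' he
  simp only [Prod.mk.injEq, and_true] at he
  obtain ⟨rfl, rfl⟩ := he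
  have h1 : s = 1 ↔ s' = 1 := Iff.trans h h'.symm
  obtain rfl : s = s' := by omega
  rfl

/-- The motion of the gap by the recorded move, next to a zone of `k` digits. -/
noncomputable def gapMove (k : ℕ) : Equiv.Perm Core :=
  loc exists_clear.choose * fetch (· = (.lf, 1)) k * (fetch (· = (.rf, 1)) k)⁻¹

theorem loc_clear {q : SQ} {a b : Letter} (h : moved (q, a, b)) (t : List Letter) (p : ℤ) :
    loc exists_clear.choose (q, a :: b :: t, p) = ((q.1, 0), a :: b :: t, p) := by
  rw [loc_apply, exists_clear.choose_spec _ h]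

theorem gapMove_right {k : ℕ} {z : List Letter} (hz : z.length = k) (a : Letter) {b : Letter}
    (hb : b ≠ 1) (t : List Letter) (p : ℤ) :
    gapMove k ((.rf, 1), a :: b :: (t ++ z), p) = ((.rf, 0), b :: (t ++ a :: z), p + 1) := by
  have h1 : (fetch (· = ((.rf, 1) : SQ)) k)⁻¹ ((.rf, 1), a :: b :: (t ++ z), p) =
      ((.rf, 1), b :: (t ++ a :: z), p + 1) := by
    rw [Equiv.Perm.inv_eq_iff_eq, ← List.cons_append (as := t) (bs := a :: z),
      fetch_pos (· = ((.rf, 1) : SQ)) rfl hz]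
    simp
  obtain ⟨e, t', ht⟩ : ∃ e t', t ++ a :: z = e :: t' := List.exists_cons_of_ne_nil (by simp)
  rw [gapMove, Equiv.Perm.mul_apply, Equiv.Perm.mul_apply, h1, ht,
    fetch_neg (· = ((.lf, 1) : SQ)) (by decide), loc_clear (by simp [moved, hb])]

theorem gapMove_left {k : ℕ} {z : List Letter} (hz : z.length = k) {a : Letter} (b e : Letter)
    (ha : a ≠ 1) (t : List Letter) (p : ℤ) :
    gapMove k ((.lf, 1), a :: b :: (t ++ e :: z), p) =
      ((.lf, 0), e :: a :: b :: (t ++ z), p - 1) := by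
  have h1 : (fetch (· = ((.rf, 1) : SQ)) k)⁻¹ ((.lf, 1), a :: b :: (t ++ e :: z), p) =
      ((.lf, 1), a :: b :: t ++ e :: z, p) := by
    rw [Equiv.Perm.inv_eq_iff_eq, List.cons_append, List.cons_append,
      fetch_neg (· = ((.rf, 1) : SQ)) (by decide)]
  rw [gapMove, Equiv.Perm.mul_apply, Equiv.Perm.mul_apply, h1,
    fetch_pos (· = ((.lf, 1) : SQ)) rfl hz, List.cons_append, List.cons_append,
    loc_clear (by simp [moved, ha])]

theorem gapMove_stay (k : ℕ) {y : Arrow} {a b : Letter} (h : moved ((y, 0), a, b))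
    (t : List Letter) (p : ℤ) :
    gapMove k ((y, 0), a :: b :: t, p) = ((y, 0), a :: b :: t, p) := by
  have h1 : (fetch (· = ((.rf, 1) : SQ)) k)⁻¹ ((y, 0), a :: b :: t, p) =
      ((y, 0), a :: b :: t, p) := by
    rw [Equiv.Perm.inv_eq_iff_eq, fetch_neg (· = ((.rf, 1) : SQ)) (by simp)]
  rw [gapMove, Equiv.Perm.mul_apply, Equiv.Perm.mul_apply, h1,
    fetch_neg (· = ((.lf, 1) : SQ)) (by simp), loc_clear h]

/-- A step of the gap machine next to a zone of `k` digits. -/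
noncomputable def gapStep (k : ℕ) : Equiv.Perm Core := gapMove k * loc exists_stepT.choose

theorem exists_prog_gapStep : ∃ n, ∀ k, Prog (n * (k + 1)) (gapStep k) := by
  obtain ⟨n, hn⟩ := exists_prog_fetch (· = (.lf, 1))
  obtain ⟨m, hm⟩ := exists_prog_fetch (· = (.rf, 1))
  refine ⟨locCost exists_clear.choose + n + m + locCost exists_stepT.choose, fun k => ?_⟩
  refine ((((prog_loc _).mul (hn k)).mul (hm k).inv).mul (prog_loc _)).mono ?_
  nlinarith

theorem gapStep_emb {k : ℕ} {Y : Gap} (hY : 3 ≤ Y.2.1.length) {z : List Letter}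
    (hz : z.length = k) : gapStep k (emb Y z) = emb (micro Y) z := by
  obtain ⟨x, _ | ⟨d, _ | ⟨c, w⟩⟩, p⟩ := Y
  · simp at hY
  · simp at hY
  obtain ⟨M, e, rfl⟩ := List.eq_nil_or_concat w |>.resolve_left (by rintro rfl; simp at hY)
  have h0 : emb (x, d :: c :: M.concat e, p) z = ((x, 0), d :: c :: (M ++ e :: z), p) := by
    simp [emb]
  rw [gapStep, Equiv.Perm.mul_apply, h0, loc_apply, exists_stepT.choose_spec x d c]
  have hl : ∀ a b : Letter, rotL.symm (a :: b :: M.concat e) = e :: a :: b :: M := by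
    intro a b
    rw [Equiv.symm_apply_eq]
    simp
  by_cases hx : x.isR = true
  · by_cases hy : (matchT x c).1.isR = true
    · obtain ⟨h1, h2⟩ : (matchT x c).1 = .rf ∧ (matchT x c).2 ≠ 1 := by
        clear h0 hl hY
        revert x c
        decide
      simp only [stepT, micro, hx, hy, if_true, emb]
      rw [h1]
      have := gapMove_right hz d h2 (M ++ [e]) p
      simp only [List.append_assoc, List.singleton_append] at this
      rw [this]
      simp
    · simp only [stepT, micro, hx, hy, if_true, emb]
      simp only [Bool.false_eq_true, if_false]
      rw [gapMove_stay]
      · simp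
      · clear h0 hl hY
        unfold moved
        revert d x c
        decide
  · by_cases hy : (matchT x d).1.isR = true
    · simp only [stepT, micro, hx, hy, if_true, emb]
      simp only [Bool.false_eq_true, if_false]
      rw [gapMove_stay]
      · simp
      · clear h0 hl hY
        unfold moved
        revert d x c
        decide
    · obtain ⟨h1, h2⟩ : (matchT x d).1 = .lf ∧ (matchT x d).2 ≠ 1 := by
        clear h0 hl hY
        revert x d
        decide
      simp only [stepT, micro, hx, hy, emb]
      simp only [Bool.false_eq_true, if_false, h1]
      rw [gapMove_left hz _ _ h2, hl]
      simp

theorem gapStep_pow_emb {k : ℕ} {Y : Gap} (hY : 3 ≤ Y.2.1.length) {z : List Letter}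
    (hz : z.length = k) (n : ℕ) : (gapStep k ^ n) (emb Y z) = emb (micro^[n] Y) z := by
  induction n generalizing Y with
  | zero => rfl
  | succ n ih =>
    rw [pow_succ, Equiv.Perm.mul_apply, gapStep_emb hY hz, ih ((length_micro Y).symm ▸ hY),
      Function.iterate_succ_apply]

/-! ### Renormalization -/

theorem smartF_sq_ahead {Y : Gap} (hY : 2 ≤ Y.2.1.length) :
    (smartF ^ 2) (mvS SQ.ahead (emb Y [])) = mvS SQ.ahead (emb (micro Y) []) := by
  obtain ⟨x, _ | ⟨d, _ | ⟨c, w⟩⟩, p⟩ := Y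
  · simp at hY
  · simp at hY
  rw [pow_two, Equiv.Perm.mul_apply]
  simp only [emb, List.append_nil, micro]
  by_cases hx : x.isR = true
  · rw [mvS_pos _ ⟨rfl, hx⟩, rotL_cons, List.cons_append, smartF_match, smartGate_zero]
    by_cases hy : (matchT x c).1.isR = true
    · simp only [hx, hy, if_true]
      rw [smartF_right hy (by simp), mvS_pos _ ⟨rfl, hy⟩]
      simp
    · simp only [hx, hy, if_true]
      simp only [Bool.false_eq_true, if_false]
      rw [smartF_left (by simpa using hy) (by simp), mvS_neg _ (by simp [hy]), ← List.cons_append,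
        rotL_symm_append]
      simp
  · rw [mvS_neg _ (by simp [hx]), smartF_match, smartGate_zero]
    by_cases hy : (matchT x d).1.isR = true
    · simp only [hx, hy, if_true]
      simp only [Bool.false_eq_true, if_false]
      rw [smartF_right hy (by simp), mvS_pos _ ⟨rfl, hy⟩]
    · simp only [hx, hy]
      simp only [Bool.false_eq_true, if_false]
      rw [smartF_left (by simpa using hy) (by simp), mvS_neg _ (by simp [hy])]

theorem smartF_pow_ahead {Y : Gap} (hY : 2 ≤ Y.2.1.length) (n : ℕ) :
    (smartF ^ (2 * n)) (mvS SQ.ahead (emb Y [])) = mvS SQ.ahead (emb (micro^[n] Y) []) := by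
  induction n generalizing Y with
  | zero => rfl
  | succ n ih =>
    rw [Nat.mul_succ, pow_add, Equiv.Perm.mul_apply, smartF_sq_ahead hY,
      ih ((length_micro Y).symm ▸ hY), Function.iterate_succ_apply]

/-- The main term of half the duration of a renormalized step. -/
def dur : ℕ → ℤ
  | 0 => 1
  | k + 1 => 3 * dur k + 1

theorem two_mul_dur (k : ℕ) : 2 * dur k + 1 = 3 ^ (k + 1) := by
  induction k with
  | zero => rfl
  | succ k ih =>
    rw [pow_succ, ← ih, dur]
    ring

/-- The length of the run of ones at the start of a list of digits, together with the following
digit. -/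
def run : List Letter → ℕ
  | [] => 0
  | j :: r => if j = 1 then run r + 1 else 1

theorem run_le (r : List Letter) : run r ≤ r.length := by
  induction r with
  | nil => exact le_rfl
  | cons j r ih =>
    rw [run, List.length_cons]
    split_ifs <;> omega

/-- The correction of half the duration of a renormalized step. -/
def delay (W : Win) (n : ℕ) : ℤ := W.corr + (n - 1) * W.turn

theorem renorm_succ_inv {k : ℕ} {Y : Gap} (hY : Good Y) {z : List Letter} (hz : z.length = k)
    (j : Letter) : (renorm (k + 1))⁻¹ (emb Y (z ++ [j])) = (renorm k)⁻¹ (emb (col Y j) z) := by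
  rw [← extract_emb hY hz, renorm, mul_inv_rev, Equiv.Perm.mul_apply]
  simp

theorem zpow_apply_of_apply {α : Type*} {F : Equiv.Perm α} {m n : ℤ} {a b c : α}
    (h : (F ^ m) a = b) (h' : (F ^ n) b = c) : (F ^ (m + n)) a = c := by
  rw [add_comm, zpow_add, Equiv.Perm.mul_apply, h, h']

theorem smartF_renorm (k : ℕ) {Y : Gap} (hY : Good Y) {z : List Letter} (hz : z.length = k) :
    (smartF ^ (2 * (dur k + delay (win Y) (run z.reverse)))) ((renorm k)⁻¹ (emb Y z)) =
      (renorm k)⁻¹ (emb (bigStep Y) z) := by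
  induction k generalizing Y z with
  | zero =>
    obtain rfl := List.length_eq_zero_iff.1 hz
    have h1 : 2 * (dur 0 + delay (win Y) (run ([] : List Letter).reverse)) =
        ((2 * (win Y).cnt : ℕ) : ℤ) := by
      simp only [dur, delay, List.reverse_nil, run, Win.turn]
      push_cast
      ring
    rw [h1, zpow_natCast, renorm, inv_inv, smartF_pow_ahead (by have := hY.length; omega)]
    rfl
  | succ k ih =>
    obtain ⟨z, j, rfl⟩ := List.eq_nil_or_concat z |>.resolve_left (by rintro rfl; simp at hz)
    rw [List.concat_eq_append] at hz ⊢
    have hz' : z.length = k := by simpa using hz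
    rw [renorm_succ_inv hY hz', renorm_succ_inv hY.bigStep hz', List.reverse_append]
    set n := run z.reverse with hn
    have hB := hY.bigStep
    obtain ⟨s0, s1, s2⟩ := hY.bigStep_col
    obtain ⟨c0, c1, c2⟩ := hY.corr_col
    obtain ⟨t0, t1, t2⟩ := hY.hol_col
    obtain ⟨s0', s1', -⟩ := hB.bigStep_col
    obtain ⟨c0', c1', -⟩ := hB.corr_col
    obtain ⟨t0', t1', t2'⟩ := hB.hol_col
    have u0 := (hY.col 0).hol_bigStep
    have u1 := (hY.col 1).hol_bigStep
    have u2 := (hY.col 2).hol_bigStep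
    have u0' := (hB.col 0).hol_bigStep
    have u1' := (hB.col 1).hol_bigStep
    have u := hY.hol_bigStep
    have i0 := ih (hY.col 0) hz'
    have i1 := ih (hY.col 1) hz'
    have i2 := ih (hY.col 2) hz'
    have i0' := ih (hB.col 0) hz'
    have i1' := ih (hB.col 1) hz'
    rw [s0] at u0 i0
    rw [s1] at u1 i1
    rw [s2] at u2 i2
    rw [s0'] at u0' i0'
    rw [s1'] at u1' i1'
    have T0 : (win (col Y 0)).turn = Y.1.hol := by linarith
    have T1 : (win (col Y 1)).turn = 1 - Y.1.hol := by linarith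
    have T2 : (win (col Y 2)).turn = -1 := by linarith
    have T0' : (win (col (bigStep Y) 0)).turn = Y.1.hol + (win Y).turn := by linarith
    have T1' : (win (col (bigStep Y) 1)).turn = 1 - (Y.1.hol + (win Y).turn) := by linarith
    rw [u] at c0' c1'
    obtain rfl | rfl | rfl : j = 0 ∨ j = 1 ∨ j = 2 := by clear hz; revert j; decide
    · convert zpow_apply_of_apply (zpow_apply_of_apply i0 i1) i2 using 3
      rw [← hn]
      simp only [delay, dur, List.reverse_cons, List.reverse_nil, List.nil_append,
        List.singleton_append, run, c0, c1, c2, T0, T1, T2]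
      simp
      ring
    · convert zpow_apply_of_apply (zpow_apply_of_apply i1 i2) i0' using 3
      rw [← hn]
      simp only [delay, dur, List.reverse_cons, List.reverse_nil, List.nil_append,
        List.singleton_append, run, c1, c2, c0', T1, T2, T0']
      simp [← hn]
      ring
    · convert zpow_apply_of_apply (zpow_apply_of_apply i2 i0') i1' using 3
      rw [← hn]
      simp only [delay, dur, List.reverse_cons, List.reverse_nil, List.nil_append,
        List.singleton_append, run, c2, c0', c1', T2, T0', T1']
      simp
      ring

/-- The cores at which the renormalization starts. -/
def base : Set Core := {c | ∃ Y, Good Y ∧ renorm 0 c = emb Y []}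

theorem exists_renorm (k : ℕ) {c : Core} (hc : c ∈ base) (hl : k + 4 ≤ c.len) :
    ∃ Y z, Good Y ∧ z.length = k ∧ renorm k c = emb Y z := by
  obtain ⟨n, hn⟩ := exists_prog_renorm
  induction k with
  | zero =>
    obtain ⟨Y, hY, h⟩ := hc
    exact ⟨Y, [], hY, rfl, h⟩
  | succ k ih =>
    obtain ⟨Y, z, hY, hz, h⟩ := ih (by omega)
    have h1 : Y.2.1.length + k = c.len := by
      rw [← (hn k).len, h, ← hz]
      simp [emb, Core.len]
    obtain ⟨Y', j, hY', rfl⟩ := hY.exists_col (by omega)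
    exact ⟨Y', z ++ [j], hY', by simp [hz],
      by rw [renorm, Equiv.Perm.mul_apply, h, extract_emb hY' hz]⟩

/-! ### The cost of the main terms of the durations -/

theorem forall₂_true (k : ℕ) {r : List Letter} (hr : r.length = k) :
    List.Forall₂ (fun (B : Letter → Prop) a => B a) (List.replicate k fun _ => True) r := by
  induction k generalizing r with
  | zero =>
    obtain rfl := List.length_eq_zero_iff.1 hr
    exact List.Forall₂.nil
  | succ k ih =>
    obtain ⟨a, r, rfl⟩ := List.exists_of_length_succ r hr
    exact List.Forall₂.cons trivial (ih (by simpa using hr))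

theorem run_pos {r : List Letter} (hr : r ≠ []) : 0 < run r := by
  obtain ⟨j, r, rfl⟩ := List.exists_cons_of_ne_nil hr
  rw [run]
  split_ifs <;> omega

theorem exists_run_pattern (k i : ℕ) (hi : i ≤ k) : ∃ l : List (Letter → Prop), l.length = k ∧
    ∀ r : List Letter, r.length = k → (List.Forall₂ (fun B a => B a) l r ↔ run r = i) := by
  induction k generalizing i with
  | zero =>
    refine ⟨[], rfl, fun r hr => ?_⟩
    obtain rfl := List.length_eq_zero_iff.1 hr
    simp [run]
    omega
  | succ k ih =>
    obtain _ | _ | i := i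
    · refine ⟨(fun _ => False) :: List.replicate k fun _ => True, by simp, fun r hr => ?_⟩
      obtain ⟨j, r, rfl⟩ := List.exists_of_length_succ r hr
      have := run_pos (List.cons_ne_nil j r)
      simp
      omega
    · refine ⟨(fun a => k = 0 ∨ a ≠ 1) :: List.replicate k fun _ => True, by simp,
        fun r hr => ?_⟩
      obtain ⟨j, r, rfl⟩ := List.exists_of_length_succ r hr
      have hr' : r.length = k := by simpa using hr
      have h0 : k = 0 ↔ run r = 0 := by
        constructor
        · rintro rfl
          obtain rfl := List.length_eq_zero_iff.1 hr'
          rfl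
        · intro h
          by_contra hk
          have := run_pos (r := r) (by rintro rfl; exact hk hr'.symm)
          omega
      rw [List.forall₂_cons, and_iff_left (forall₂_true k hr'), h0, run]
      split_ifs with hj
      · simp [hj]
      · simp [hj]
    · obtain ⟨l, hl, h⟩ := ih (i + 1) (by omega)
      refine ⟨(· = 1) :: l, by simp [hl], fun r hr => ?_⟩
      obtain ⟨j, r, rfl⟩ := List.exists_of_length_succ r hr
      rw [List.forall₂_cons, h r (by simpa using hr), run]
      split_ifs with hj
      · simp [hj]
      · simp [hj]

/-- The window and the run of digits of a core next to a zone of `k` digits. -/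
def zoneKey (k : ℕ) (c : Core) : Win × Fin (k + 1) :=
  (win (c.1.1, c.2.1.take (c.len - k), c.2.2),
    Fin.ofNat (k + 1) (run (c.2.1.drop (c.len - k)).reverse))

theorem zoneKey_emb {k : ℕ} {Y : Gap} {z : List Letter} (hz : z.length = k) :
    zoneKey k (emb Y z) = (win Y, Fin.ofNat (k + 1) (run z.reverse)) := by
  have h1 : (emb Y z).len - k = Y.2.1.length := by
    simp [emb, Core.len, hz]
  rw [zoneKey, h1]
  simp [emb]

theorem val_ofNat_run {k : ℕ} {z : List Letter} (hz : z.length = k) :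
    (Fin.ofNat (k + 1) (run z.reverse) : ℕ) = run z.reverse := by
  have := run_le z.reverse
  rw [List.length_reverse, hz] at this
  exact Nat.mod_eq_of_lt (by omega)

theorem exists_zone_pattern (k : ℕ) (i : Win × Fin (k + 1)) :
    ∃ S : Set Core, Ctl (5000 * (k + 5) ^ 2) S ∧ ∀ Y z, Good Y → z.length = k →
      (emb Y z ∈ S ↔ zoneKey k (emb Y z) = i) := by
  obtain ⟨⟨x, d, c, r, e⟩, i⟩ := i
  obtain ⟨l, hl, h⟩ := exists_run_pattern k i (by omega)
  set L : List (Letter → Prop) := (· = e) :: (l.reverse ++ [(· = d), (· = c), (· = r)]) with hL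
  have hLl : L.length = k + 4 := by simp [hL, hl]
  refine ⟨{y | ∃ a ∈ y.2.1.head?, y.1.1 = x} ∩ ⇑(mvT ^ (k + 1))⁻¹ ⁻¹' cellPat L,
    ((Ctl.head fun q _ => q.1 = x).inter
      ((ctl_cellPat L).preimage (prog_mvT.pow (k + 1)).inv)).mono ?_, ?_⟩
  · rw [hLl]
    nlinarith
  · intro Y z hY hz
    obtain ⟨x', d', c', r', e', M, p, rfl, hw, -⟩ := hY.exists_window
    rw [zoneKey_emb hz, hw]
    have h1 : (mvT ^ (k + 1))⁻¹ (emb (x', d' :: c' :: r' :: (M ++ [e']), p) z) =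
        ((x', 0), (e' :: (z ++ [d', c', r'])) ++ M, p - (k + 1 : ℕ)) := by
      rw [Equiv.Perm.inv_eq_iff_eq]
      have := mvT_pow_append (x', 0) (e' :: z) (d' :: c' :: r' :: M) (p - (k + 1 : ℕ))
      rw [List.length_cons, hz] at this
      simp only [List.append_assoc, List.cons_append, List.nil_append] at this ⊢
      rw [this]
      simp [emb]
    rw [Set.mem_inter_iff, Set.mem_preimage, h1, mem_cellPat _ _ _ _ _ (by simp [hLl, hz])]
    have h2 : List.Forall₂ (fun (B : Letter → Prop) a => B a) L (e' :: (z ++ [d', c', r'])) ↔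
        e' = e ∧ run z.reverse = i ∧ d' = d ∧ c' = c ∧ r' = r := by
      rw [hL, List.forall₂_cons, ← h z.reverse (by simp [hz])]
      have h3 : List.Forall₂ (fun (B : Letter → Prop) a => B a)
          (l.reverse ++ [(· = d), (· = c), (· = r)]) (z ++ [d', c', r']) ↔
          List.Forall₂ (fun (B : Letter → Prop) a => B a) l.reverse z ∧
          List.Forall₂ (fun (B : Letter → Prop) a => B a) [(· = d), (· = c), (· = r)]
            [d', c', r'] := by
        constructor
        · intro h4
          exact ⟨by simpa [hl, hz] using List.forall₂_take l.reverse.length h4,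
            by simpa [hl, hz] using List.forall₂_drop l.reverse.length h4⟩
        · rintro ⟨h4, h5⟩
          exact List.rel_append h4 h5
      rw [h3, ← List.forall₂_reverse_iff (l₁ := l), List.reverse_reverse]
      simp
    rw [h2]
    have h3 : Fin.ofNat (k + 1) (run z.reverse) = i ↔ run z.reverse = i := by
      rw [Fin.ext_iff, val_ofNat_run hz]
    simp only [Prod.mk.injEq, h3]
    simp [emb]
    tauto

theorem natAbs_delay_le (W : Win) (n : ℕ) : (delay W n).natAbs ≤ 2 * n + 3 := by
  have h : ∀ W : Win, |W.corr| ≤ 1 ∧ |W.turn| ≤ 2 := by decide +kernel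
  obtain ⟨h1, h2⟩ := h W
  rw [delay]
  rw [abs_le] at h1 h2
  zify
  rw [abs_le]
  constructor <;> nlinarith

theorem exists_wd_dur : ∃ K, ∀ (k n : ℕ) (E : Set Core), (∀ c ∈ E, c ∈ base ∧ k + 4 ≤ c.len) →
    Ctl n E → Wd (K * (k + 1) * (n + (k + 1) ^ 2)) (duckSwap (smartF ^ (2 * dur k)) E) := by
  obtain ⟨a, ha⟩ := exists_prog_renorm
  obtain ⟨b, hb⟩ := exists_prog_gapStep
  refine ⟨324 * (2 * (400 * 5 + 2 * a + 3 * b) + flipCost * (2 + 2 * 5000 * 25 + 4 * a)),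
    fun k n E hE hn => ?_⟩
  have hcnt : ∀ W : Win, W.cnt ≤ 3 := by decide +kernel
  have key := wd_duckSwap_of_key (F := smartF ^ (2 * dur k)) (E := E)
    (n := (2 * (400 * 5 + 2 * a + 3 * b) + flipCost * (2 + 2 * 5000 * 25 + 4 * a)) *
      (n + (k + 1) ^ 2)) (fun c => zoneKey k (renorm k c)) ?_
  · refine key.mono (le_of_eq ?_)
    simp only [Fintype.card_prod, Fintype.card_fin]
    have : Fintype.card Arrow = 4 := rfl
    rw [this]
    ring
  · intro i
    obtain ⟨S, hS, hmem⟩ := exists_zone_pattern k i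
    set δ := delay i.1 i.2 with hδ
    have hP := (((prog_smartF.zpow (-(2 * δ))).mul (ha k).inv).mul
      ((hb k).pow (Win.cnt i.1))).mul (ha k)
    have hC := hn.inter (hS.preimage (ha k))
    refine ((hP.wd_duckSwap (F := smartF ^ (2 * dur k)) (hC.congr
      (E' := {c | c ∈ E ∧ zoneKey k (renorm k c) = i}) ?_) ?_)).mono ?_
    · intro c _
      simp only [Set.mem_inter_iff, Set.mem_preimage, Set.mem_ofPred_eq]
      refine and_congr_right fun hc => ?_
      obtain ⟨Y, z, hY, hz, h⟩ := exists_renorm k (hE c hc).1 (hE c hc).2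
      rw [h, hmem Y z hY hz]
    · rintro c ⟨hc, hi⟩ -
      obtain ⟨Y, z, hY, hz, h⟩ := exists_renorm k (hE c hc).1 (hE c hc).2
      have h1 := smartF_renorm k hY hz
      rw [h, zoneKey_emb hz] at hi
      have hi1 : win Y = i.1 := by rw [← hi]
      have hi2 : run z.reverse = i.2 := by rw [← hi, val_ofNat_run hz]
      rw [hi1, hi2, ← hδ] at h1
      have h2 : (renorm k)⁻¹ (emb Y z) = c := by rw [Equiv.Perm.inv_eq_iff_eq, h]
      rw [Equiv.Perm.mul_apply, Equiv.Perm.mul_apply, Equiv.Perm.mul_apply, h,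
        gapStep_pow_emb (by have := hY.length; omega) hz, ← hi1, ← bigStep, ← h1, h2,
        ← Equiv.Perm.mul_apply, ← zpow_add]
      congr 2
      ring
    · have h1 : (-(2 * δ)).natAbs ≤ 10 * (k + 1) := by
        have := natAbs_delay_le i.1 i.2
        rw [← hδ] at this
        have := i.2.2
        omega
      have h2 := hcnt i.1
      have h5 : k + 1 ≤ n + (k + 1) ^ 2 := by nlinarith
      have h6 : (k + 1) ^ 2 ≤ n + (k + 1) ^ 2 := by omega
      have h7 : (k + 5) ^ 2 ≤ 25 * (n + (k + 1) ^ 2) := by nlinarith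
      have h8 : n ≤ n + (k + 1) ^ 2 := by omega
      generalize n + (k + 1) ^ 2 = T at h5 h6 h7 h8 ⊢
      calc _ ≤ 2 * (10 * T * 200 + a * T + 3 * (b * T) + a * T) +
            flipCost * (2 * T + 2 * (5000 * (25 * T) + 2 * (a * T))) := by
            gcongr
            exact h1.trans (by gcongr)
        _ = _ := by ring

/-! ### Periodicity -/

/-- The translation of the position of the head. -/
def Core.shift (s : ℤ) (c : Core) : Core := (c.1, c.2.1, c.2.2 + s)

theorem Core.shift_shift (s t : ℤ) (c : Core) : (c.shift s).shift t = c.shift (s + t) := by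
  simp [Core.shift, add_assoc]

theorem mvS_shift (A : SQ → Prop) [DecidablePred A] (s : ℤ) (c : Core) :
    mvS A (c.shift s) = Core.shift s (mvS A c) := by
  obtain ⟨q, v, p⟩ := c
  by_cases h : A q
  · simp [Core.shift, mvS_pos A h, add_right_comm]
  · simp [Core.shift, mvS_neg A h]

theorem gateS_shift (g : Equiv.Perm (SQ × Letter)) (s : ℤ) (c : Core) :
    gateS g (c.shift s) = Core.shift s (gateS g c) := by
  obtain ⟨q, _ | ⟨a, t⟩, p⟩ := c <;> rfl

theorem smartF_shift (s : ℤ) (c : Core) : smartF (c.shift s) = (smartF c).shift s := by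
  have h : ∀ (A : SQ → Prop) [DecidablePred A] (c : Core),
      (mvS A)⁻¹ (c.shift s) = Core.shift s ((mvS A)⁻¹ c) := fun A _ c => by
    rw [Equiv.Perm.inv_eq_iff_eq, mvS_shift, ← Equiv.Perm.mul_apply, mul_inv_cancel,
      Equiv.Perm.one_apply]
  simp only [smartF, Equiv.Perm.mul_apply, h, mvS_shift, gateS_shift]

theorem smartF_pow_shift (n : ℕ) (s : ℤ) (c : Core) :
    (smartF ^ n) (c.shift s) = ((smartF ^ n) c).shift s := by
  induction n with
  | zero => rfl
  | succ n ih => rw [pow_succ', Equiv.Perm.mul_apply, ih, smartF_shift, Equiv.Perm.mul_apply]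

theorem Good.shift {Y : Gap} (h : Good Y) (s : ℤ) : Good (Y.shift s) := ⟨h.valid, h.length⟩

theorem col_shift {Y : Gap} (s : ℤ) (j : Letter) : col (Y.shift s) j = (col Y j).shift s := by
  obtain ⟨x, _ | ⟨d, _ | ⟨c, w⟩⟩, p⟩ := Y
  · rfl
  · rfl
  · by_cases hx : x.outer = true
    · simp [col, hx, Gap.shift, sub_add_eq_add_sub]
    · simp [col, hx, Gap.shift]

theorem renorm_inv_shift {k : ℕ} {Y : Gap} (hY : Good Y) {z : List Letter} (hz : z.length = k)
    (s : ℤ) : (renorm k)⁻¹ (emb (Y.shift s) z) = ((renorm k)⁻¹ (emb Y z)).shift s := by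
  induction k generalizing Y z with
  | zero =>
    obtain rfl := List.length_eq_zero_iff.1 hz
    rw [renorm, inv_inv]
    exact mvS_shift _ s (emb Y [])
  | succ k ih =>
    obtain ⟨z, j, rfl⟩ := List.eq_nil_or_concat z |>.resolve_left (by rintro rfl; simp at hz)
    rw [List.concat_eq_append] at hz ⊢
    have hz' : z.length = k := by simpa using hz
    rw [renorm_succ_inv (hY.shift s) hz', renorm_succ_inv hY hz', col_shift, ih (hY.col j) hz']

/-- The total correction of `n` renormalized steps. -/
def corrSum : ℕ → Gap → ℤ
  | 0, _ => 0
  | n + 1, Y => (win Y).corr + corrSum n (bigStep Y)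

/-- The number of steps of the gap machine in `n` renormalized steps. -/
def cntSum : ℕ → Gap → ℕ
  | 0, _ => 0
  | n + 1, Y => (win Y).cnt + cntSum n (bigStep Y)

theorem bigStep_shift (s : ℤ) (Y : Gap) : bigStep (Y.shift s) = (bigStep Y).shift s :=
  micro_iterate_shift _ s Y

theorem bigStep_iterate_shift (n : ℕ) (s : ℤ) (Y : Gap) :
    bigStep^[n] (Y.shift s) = (bigStep^[n] Y).shift s := by
  induction n generalizing Y with
  | zero => rfl
  | succ n ih => rw [Function.iterate_succ_apply, bigStep_shift, ih, Function.iterate_succ_apply]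

theorem corrSum_shift (n : ℕ) (s : ℤ) (Y : Gap) : corrSum n (Y.shift s) = corrSum n Y := by
  induction n generalizing Y with
  | zero => rfl
  | succ n ih =>
    rw [corrSum, bigStep_shift, ih]
    rfl

theorem cntSum_shift (n : ℕ) (s : ℤ) (Y : Gap) : cntSum n (Y.shift s) = cntSum n Y := by
  induction n generalizing Y with
  | zero => rfl
  | succ n ih =>
    rw [cntSum, bigStep_shift, ih]
    rfl

theorem bigStep_iterate (n : ℕ) (Y : Gap) : bigStep^[n] Y = micro^[cntSum n Y] Y := by
  induction n generalizing Y with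
  | zero => rfl
  | succ n ih =>
    rw [Function.iterate_succ_apply, ih, cntSum, add_comm, Function.iterate_add_apply]
    rfl

theorem smartF_renorm_iterate (k n : ℕ) {Y : Gap} (hY : Good Y) {z : List Letter}
    (hz : z.length = k) :
    (smartF ^ (2 * (n * dur k + corrSum n Y + (run z.reverse - 1) * (n + corrSum n Y - cntSum n Y))))
      ((renorm k)⁻¹ (emb Y z)) = (renorm k)⁻¹ (emb (bigStep^[n] Y) z) := by
  induction n generalizing Y with
  | zero => simp [corrSum, cntSum]
  | succ n ih =>
    have h1 := smartF_renorm k hY hz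
    have h2 := ih hY.bigStep
    rw [← h1, ← Equiv.Perm.mul_apply, ← zpow_add] at h2
    rw [Function.iterate_succ_apply, ← h2]
    congr 2
    simp only [delay, Win.turn, corrSum, cntSum]
    push_cast
    ring

/-- Four cells make a full turn after `54` renormalized steps. -/
theorem bigStep_four (x : Arrow) (a b c d : Letter)
    (h : Win.valid (win (x, [a, b, c, d], 0)) = true) :
    (bigStep^[54] (x, [a, b, c, d], 0) = (x, [a, b, c, d], 1) ∨
      bigStep^[54] (x, [a, b, c, d], 0) = (x, [a, b, c, d], -1)) ∧
    corrSum 54 (x, [a, b, c, d], 0) = 27 ∧ cntSum 54 (x, [a, b, c, d], 0) = 81 := by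
  revert x a b c d
  decide +kernel

theorem exists_gap_turn {Y : Gap} (hY : Good Y) (h4 : Y.2.1.length = 4) :
    ∃ s : ℤ, bigStep^[54] Y = Y.shift s ∧ corrSum 54 Y = 27 ∧ cntSum 54 Y = 81 := by
  obtain ⟨x, u, p⟩ := Y
  obtain ⟨a, b, c, d, rfl⟩ : ∃ a b c d, u = [a, b, c, d] := by
    obtain _ | ⟨a, _ | ⟨b, _ | ⟨c, _ | ⟨d, _ | ⟨e, t⟩⟩⟩⟩⟩ := u <;> simp at h4
    exact ⟨a, b, c, d, rfl⟩
  have h0 : ((x, [a, b, c, d], p) : Gap) = Gap.shift p (x, [a, b, c, d], 0) := by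
    simp [Gap.shift]
  obtain ⟨h1, h2, h3⟩ := bigStep_four x a b c d hY.valid
  rw [h0, bigStep_iterate_shift, corrSum_shift, cntSum_shift]
  obtain h1 | h1 := h1
  · exact ⟨1, by rw [h1]; simp [Gap.shift, add_comm], h2, h3⟩
  · exact ⟨-1, by rw [h1]; simp [Gap.shift, add_comm], h2, h3⟩

theorem pow_mul_apply_shift {m : ℕ} {s : ℤ} {c : Core} (h : (smartF ^ m) c = c.shift s) (q : ℕ) :
    (smartF ^ (m * q)) c = c.shift (s * q) := by
  induction q with
  | zero => simp [Core.shift]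
  | succ q ih =>
    rw [Nat.mul_succ, add_comm, pow_add, Equiv.Perm.mul_apply, ih, smartF_pow_shift, h,
      Core.shift_shift]
    congr 1
    push_cast
    ring

theorem exists_turn {k : ℕ} {c : Core} (hc : c ∈ base) (hl : c.len = k + 4) :
    ∃ s : ℤ, (smartF ^ (2 * 3 ^ (k + 4))) c = c.shift s ∧
      ∀ q : ℕ, ((renorm k)⁻¹ * gapStep k ^ (81 * q) * renorm k) c = c.shift (s * q) := by
  obtain ⟨Y, z, hY, hz, h⟩ := exists_renorm k hc hl.ge
  obtain ⟨n, hn⟩ := exists_prog_renorm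
  have h4 : Y.2.1.length = 4 := by
    have h1 : Y.2.1.length + k = c.len := by
      rw [← (hn k).len, h, ← hz]
      simp [emb, Core.len]
    omega
  obtain ⟨s, hs, h27, h81⟩ := exists_gap_turn hY h4
  have hc' : (renorm k)⁻¹ (emb Y z) = c := by rw [Equiv.Perm.inv_eq_iff_eq, h]
  refine ⟨s, ?_, fun q => ?_⟩
  · have h1 := smartF_renorm_iterate k 54 hY hz
    rw [h27, h81, hs, renorm_inv_shift hY hz, hc'] at h1
    have h2 : 2 * (((54 : ℕ) : ℤ) * dur k + 27 +
        (run z.reverse - 1) * (((54 : ℕ) : ℤ) + 27 - ((81 : ℕ) : ℤ))) = (2 * 3 ^ (k + 4) : ℕ) := by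
      have := two_mul_dur k
      have h3 : (3 : ℤ) ^ (k + 4) = 27 * 3 ^ (k + 1) := by ring
      push_cast
      rw [h3, ← this]
      ring
    rwa [h2, zpow_natCast] at h1
  · have hq : micro^[81 * q] Y = Y.shift (s * q) := by
      induction q with
      | zero => simp [Gap.shift]
      | succ q ih =>
        have h1 : micro^[81] Y = Y.shift s := by rw [← h81, ← bigStep_iterate, hs]
        rw [Nat.mul_succ, add_comm, Function.iterate_add_apply, ih, micro_iterate_shift, h1]
        simp only [Gap.shift, Prod.mk.injEq, true_and]
        push_cast
        ring
    rw [Equiv.Perm.mul_apply, Equiv.Perm.mul_apply, h, gapStep_pow_emb (by omega) hz, hq,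
      renorm_inv_shift hY hz, hc']

theorem emb_nil (Y : Gap) : emb Y [] = ((Y.1, 0), Y.2.1, Y.2.2) := by simp [emb]

theorem exists_good_micro {Y : Gap} (h : 4 ≤ Y.2.1.length) : ∃ i < 3, Good (micro^[i] Y) := by
  obtain ⟨x, u, p⟩ := Y
  obtain ⟨d, c, r, e, M, rfl⟩ := exists_window h
  have key : ∃ i < 3, Win.valid (win (micro^[i] (x, d :: c :: r :: (M ++ [e]), p))) = true := by
    rw [show (∃ i < 3, Win.valid (win (micro^[i] (x, d :: c :: r :: (M ++ [e]), p))) = true) ↔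
      Win.valid (win (x, d :: c :: r :: (M ++ [e]), p)) = true ∨
      Win.valid (win (micro (x, d :: c :: r :: (M ++ [e]), p))) = true ∨
      Win.valid (win (micro (micro (x, d :: c :: r :: (M ++ [e]), p)))) = true from ?_]
    · cases x <;> fin_cases d <;> fin_cases c <;> first
        | (left; simp [win, Win.valid, Arrow.outer]; done)
        | (right; left; simp [win, Win.valid, Arrow.outer, micro, matchT, Arrow.isR,
            rotL_symm_cons]; done)
        | (right; right; simp [win, Win.valid, Arrow.outer, micro, matchT, Arrow.isR,
            rotL_symm_cons])
    · constructor
      · rintro ⟨i, hi, h⟩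
        interval_cases i
        · exact Or.inl h
        · exact Or.inr (Or.inl h)
        · exact Or.inr (Or.inr h)
      · rintro (h | h | h)
        · exact ⟨0, by omega, h⟩
        · exact ⟨1, by omega, h⟩
        · exact ⟨2, by omega, h⟩
  obtain ⟨i, hi, hv⟩ := key
  exact ⟨i, hi, hv, (length_micro_iterate i _).symm ▸ h⟩

theorem exists_pow_mem_base {c : Core} (h : 4 ≤ c.len) : ∃ i < 6, (smartF ^ i) c ∈ base := by
  have key : ∀ c : Core, 4 ≤ c.len → c.1.2 = 0 → ∃ i < 3, (smartF ^ (2 * i)) c ∈ base := by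
    intro c h hc
    obtain ⟨Y, hY⟩ : ∃ Y : Gap, c = mvS SQ.ahead (emb Y []) := by
      obtain ⟨⟨x, b⟩, v, p⟩ := c
      obtain rfl : b = 0 := hc
      by_cases hx : x.isR = true
      · refine ⟨(x, rotL.symm v, p - 1), ?_⟩
        rw [emb_nil, mvS_pos _ ⟨rfl, hx⟩]
        simp
      · refine ⟨(x, v, p), ?_⟩
        rw [emb_nil, mvS_neg _ (by simp [hx])]
    have hl : 4 ≤ Y.2.1.length := by
      rw [hY, (prog_mvS SQ.ahead).len] at h
      simpa [emb, Core.len] using h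
    obtain ⟨i, hi, hg⟩ := exists_good_micro hl
    refine ⟨i, hi, micro^[i] Y, hg, ?_⟩
    rw [hY, smartF_pow_ahead (by omega), renorm, ← Equiv.Perm.mul_apply, inv_mul_cancel,
      Equiv.Perm.one_apply]
  obtain hc | hc : c.1.2 = 0 ∨ c.1.2 = 1 := by omega
  · obtain ⟨i, hi, hb⟩ := key c h hc
    exact ⟨2 * i, by omega, hb⟩
  · obtain ⟨i, hi, hb⟩ := key (smartF c) (by rwa [prog_smartF.len]) (by
      obtain ⟨⟨x, b⟩, v, p⟩ := c
      obtain rfl : b = 1 := hc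
      have hv : v ≠ [] := by
        rintro rfl
        simp [Core.len] at h
      by_cases hx : x.isR = true
      · rw [smartF_right hx hv]
      · rw [smartF_left (by simpa using hx) hv])
    exact ⟨2 * i + 1, by omega, by rwa [pow_succ, Equiv.Perm.mul_apply]⟩

theorem smartF_pow_two (x : Arrow) (b : Fin 2) (a a' : Letter) :
    smartF^[36] ((x, b), [a, a'], 0) = ((x, b), [a, a'], 2) ∨
    smartF^[36] ((x, b), [a, a'], 0) = ((x, b), [a, a'], -2) := by
  revert x b a a'
  decide +kernel

theorem exists_period {c : Core} (h : c.len = 2 ∨ 4 ≤ c.len) :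
    ∃ s : ℤ, (smartF ^ (2 * 3 ^ c.len * c.len)) c = c.shift (s * c.len) := by
  obtain h | h := h
  · obtain ⟨⟨x, b⟩, v, p⟩ := c
    obtain ⟨a, a', rfl⟩ := List.length_eq_two.1 h
    have h0 : (((x, b), [a, a'], p) : Core) = Core.shift p ((x, b), [a, a'], 0) := by
      simp [Core.shift]
    rw [h, show 2 * 3 ^ 2 * 2 = 36 from rfl, h0, smartF_pow_shift, ← Equiv.Perm.iterate_eq_pow]
    obtain h1 | h1 := smartF_pow_two x b a a'
    · exact ⟨1, by rw [h1]; simp [Core.shift, add_comm]⟩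
    · exact ⟨-1, by rw [h1]; simp [Core.shift, add_comm]⟩
  · obtain ⟨i, -, hi⟩ := exists_pow_mem_base h
    have hl : ((smartF ^ i) c).len = c.len := (prog_smartF.pow i).len c
    obtain ⟨s, hs, -⟩ := exists_turn (k := c.len - 4) hi (by omega)
    rw [Nat.sub_add_cancel h] at hs
    refine ⟨s, (smartF ^ i).injective ?_⟩
    rw [← Equiv.Perm.mul_apply, ← pow_add, add_comm, pow_add, Equiv.Perm.mul_apply,
      pow_mul_apply_shift hs, smartF_pow_shift]

/-! ### Reduction to starts of renormalized steps -/

theorem lift_commute {P F : Equiv.Perm Core} (h : Commute F P) (D D' : Fin 2 → Bool) :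
    Commute (lift D F) (lift D' P) := by
  ext κ : 1
  obtain ⟨c, d⟩ := κ
  have h1 : F (P c) = P (F c) := Equiv.Perm.ext_iff.1 h c
  by_cases hd : D d.1 = true <;> by_cases hd' : D' d.1 = true <;> simp [lift_apply, hd, hd', h1]

theorem Prog.ctl_preimage {m : ℕ} {P : Equiv.Perm Core} (hP : Prog m P) (E : Set Core)
    (σ : Equiv.Perm Decor) :
    ctl (P ⁻¹' E) σ = (lift (fun _ => true) P)⁻¹ * ctl E σ * lift (fun _ => true) P := by
  classical
  rw [← lift_inv]
  ext κ : 1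
  obtain ⟨c, d⟩ := κ
  have h1 : (P c).2.1 ≠ [] ↔ c.2.1 ≠ [] := by
    have := hP.len c
    simp only [Core.len] at this
    rw [← List.length_pos_iff, ← List.length_pos_iff, this]
  simp [ctl, lift_apply, h1]

theorem Prog.wd_duckSwap_preimage {m n : ℕ} {P F : Equiv.Perm Core} (hP : Prog m P)
    (h : Commute F P) {E : Set Core} (hE : Wd n (duckSwap F E)) :
    Wd (n + 2 * m) (duckSwap F (P ⁻¹' E)) := by
  have h1 := lift_commute h (fun b => decide (b = 1)) fun _ => true
  have : duckSwap F (P ⁻¹' E) =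
      (lift (fun _ => true) P)⁻¹ * duckSwap F E * lift (fun _ => true) P := by
    rw [duckSwap, hP.ctl_preimage, duckSwap]
    generalize lift (fun b => decide (b = 1)) F = A at h1 ⊢
    generalize lift (fun _ => true) P = T at h1 ⊢
    have h2 : A * T⁻¹ = T⁻¹ * A := h1.inv_right
    have h3 : T * A⁻¹ = A⁻¹ * T := h1.inv_left.symm
    simp only [← mul_assoc, h2]
    simp only [mul_assoc, h3]
  rw [this]
  exact (((hP.wd _).inv.mul hE).mul (hP.wd _)).mono (by omega)

theorem exists_ctl_inter {E E' : Set Core} (h : ∃ n, Ctl n E) (h' : ∃ n, Ctl n E') :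
    ∃ n, Ctl n (E ∩ E') := by
  obtain ⟨⟨_, h⟩, _, h'⟩ := And.intro h h'
  exact ⟨_, h.inter h'⟩

theorem exists_ctl_compl {E : Set Core} (h : ∃ n, Ctl n E) : ∃ n, Ctl n Eᶜ := by
  obtain ⟨_, h⟩ := h
  exact ⟨_, h.compl⟩

theorem exists_ctl_base : ∃ n, Ctl n base := by
  have h1 : ∃ n, Ctl n {c : Core | ∃ a ∈ c.2.1.head?, c.1.2 = 0} :=
    ⟨_, Ctl.head fun q _ => q.2 = 0⟩
  have h2 : ∃ n, Ctl n {c : Core | ∃ a ∈ c.2.1.head?, c.1.1.outer = true ∧ a = 0} :=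
    ⟨_, Ctl.head fun q a => q.1.outer = true ∧ a = 0⟩
  have h3 : ∃ n, Ctl n ({c : Core | ∃ a ∈ c.2.1.head?, c.1.1.outer = false} ∩
      mvT ⁻¹' headSet (· = 0)) :=
    ⟨_, (Ctl.head fun q _ => q.1.outer = false).inter ((ctl_headSet _).preimage prog_mvT)⟩
  obtain ⟨n, hn⟩ := exists_ctl_inter ⟨_, ctl_len_ge 4⟩
    (exists_ctl_inter h1 (exists_ctl_inter (exists_ctl_compl h2) (exists_ctl_compl h3)))
  refine ⟨_, (hn.preimage (prog_mvS SQ.ahead).inv).congr fun c _ => ?_⟩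
  rw [Set.mem_preimage]
  have hb : c ∈ base ↔ ∃ Y, Good Y ∧ (mvS SQ.ahead)⁻¹ c = emb Y [] := Iff.rfl
  rw [hb]
  generalize (mvS SQ.ahead)⁻¹ c = c'
  obtain ⟨⟨x, b⟩, v, p⟩ := c'
  obtain hv | ⟨d, c, r, e, M, rfl⟩ := (Nat.lt_or_ge v.length 4).imp_right exists_window
  · refine iff_of_false ?_ ?_
    · rintro ⟨h, -⟩
      simp only [Set.mem_ofPred_eq, Core.len] at h
      omega
    · rintro ⟨Y, hY, h⟩
      have := hY.length
      simp only [emb, List.append_nil, Prod.mk.injEq] at h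
      rw [← h.2.1] at this
      omega
  · have h1 : (∃ Y, Good Y ∧ (((x, b), d :: c :: r :: (M ++ [e]), p) : Core) = emb Y []) ↔
        b = 0 ∧ Win.valid (x, d, c, r, e) = true := by
      constructor
      · rintro ⟨⟨y, u, p'⟩, hY, h⟩
        simp only [emb, List.append_nil, Prod.mk.injEq] at h
        obtain ⟨⟨rfl, rfl⟩, rfl, rfl⟩ := h
        exact ⟨rfl, (win_window x d c r e M p) ▸ hY.valid⟩
      · rintro ⟨rfl, h⟩
        exact ⟨(x, d :: c :: r :: (M ++ [e]), p), ⟨by rwa [win_window], by simp⟩, by simp [emb]⟩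
    rw [h1]
    by_cases hx : x.outer = true <;>
      simp [Core.len, Win.valid, hx, mvT_apply, headSet]

/-- The cores that first reach the start of a renormalized step after `i` steps. -/
def entry (i : ℕ) : Set Core := {c | (smartF ^ i) c ∈ base ∧ ∀ j < i, (smartF ^ j) c ∉ base}

theorem exists_ctl_entry (i : ℕ) : ∃ n, Ctl n (entry i) := by
  have h0 : ∀ j, ∃ n, Ctl n (⇑(smartF ^ j) ⁻¹' base) := fun j => by
    obtain ⟨n, hn⟩ := exists_ctl_base
    exact ⟨_, hn.preimage (prog_smartF.pow j)⟩
  have h1 : ∃ n, Ctl n {c | ∀ j < i, (smartF ^ j) c ∉ base} := by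
    induction i with
    | zero => exact ⟨1, by simpa using Ctl.univ⟩
    | succ i ih =>
      convert exists_ctl_inter ih (exists_ctl_compl (h0 i)) using 3
      ext c
      simp [le_iff_lt_or_eq, or_imp, forall_and]
  exact exists_ctl_inter (h0 i) h1

theorem exists_wd_of_base : ∃ N, ∀ (z : ℤ) (m n : ℕ) (Z : ℕ → Prop), (∀ L, Z L → 4 ≤ L) →
    Ctl n {c : Core | Z c.len} →
    (∀ E : Set Core, (∀ c ∈ E, c ∈ base ∧ Z c.len) → Ctl (2 * n + N) E →
      Wd m (duckSwap (smartF ^ z) E)) →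
    Wd (6 * m + N) (duckSwap (smartF ^ z) {c : Core | Z c.len}) := by
  choose N hN using exists_ctl_entry
  set B := ∑ i ∈ Finset.range 6, N i with hB
  refine ⟨2 * B + 12000, fun z m n Z hZ hn h => ?_⟩
  let key : Core → Fin 6 := fun c => Fin.ofNat 6 (sInf {i | (smartF ^ i) c ∈ base})
  refine (wd_duckSwap_of_key (n := m + 2 * 1000) key fun i => ?_).mono
    (by rw [Fintype.card_fin]; omega)
  have hE : {c | c ∈ {c : Core | Z c.len} ∧ key c = i} = {c : Core | Z c.len} ∩ entry i := by
    ext c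
    refine and_congr_right fun hc => ?_
    obtain ⟨j, hj, hjb⟩ := exists_pow_mem_base (hZ _ hc)
    have hlt : sInf {i | (smartF ^ i) c ∈ base} < 6 := (Nat.sInf_le hjb).trans_lt hj
    have hmem : sInf {i | (smartF ^ i) c ∈ base} ∈ {i | (smartF ^ i) c ∈ base} :=
      Nat.sInf_mem ⟨j, hjb⟩
    have hval : (key c).val = sInf {i | (smartF ^ i) c ∈ base} := Nat.mod_eq_of_lt hlt
    rw [Fin.ext_iff, hval]
    constructor
    · intro hi
      rw [← hi]
      exact ⟨hmem, fun l hl => Nat.notMem_of_lt_sInf hl⟩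
    · rintro ⟨h1, h2⟩
      refine le_antisymm (Nat.sInf_le h1) ?_
      by_contra! h3
      exact h2 _ h3 hmem
  rw [hE]
  have hpre : {c : Core | Z c.len} ∩ entry i =
      ⇑(smartF ^ i.val) ⁻¹' (⇑(smartF ^ i.val)⁻¹ ⁻¹' ({c : Core | Z c.len} ∩ entry i)) := by
    rw [← Set.preimage_comp]
    simp [Function.comp_def]
  have hP := prog_smartF.pow i.val
  rw [hpre]
  refine (hP.wd_duckSwap_preimage (F := smartF ^ z) (n := m) ?_ ?_).mono (by omega)
  · exact ((Commute.refl smartF).zpow_left z).pow_right _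
  · refine h _ ?_ (((hn.inter (hN i)).preimage hP.inv).mono ?_)
    · rintro c ⟨h1, h2⟩
      have h3 := h2.1
      rw [← Equiv.Perm.mul_apply, mul_inv_cancel, Equiv.Perm.one_apply] at h3
      rw [Set.mem_ofPred_eq, hP.inv.len] at h1
      exact ⟨h3, h1⟩
    · have h1 : N i ≤ B :=
        Finset.single_le_sum (f := N) (fun _ _ => Nat.zero_le _) (Finset.mem_range.2 i.2)
      have := i.2
      omega

/-! ### Powers on belts of prescribed lengths -/

open Classical in
theorem Ctl.acts {n : ℕ} {Z : ℕ → Prop} (hZ : Ctl n {c : Core | Z c.len}) (z : ℤ) :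
    Acts (400 * z.natAbs + 2 * flipCost * n) (fun L => if Z L then z else 0) :=
  (acts_of_duckSwap Z z ((prog_smartF.zpow z).wd_duckSwap hZ fun _ _ _ => rfl) hZ).mono
    (by rw [two_mul flipCost, add_mul]; omega)

open Classical in
theorem exists_acts_dur : ∃ K, ∀ (k n : ℕ) (Z : ℕ → Prop), (∀ L, Z L → k + 4 ≤ L) →
    Ctl n {c : Core | Z c.len} →
    Acts (K * ((k + 1) * (n + (k + 1) ^ 2))) (fun L => if Z L then 2 * dur k else 0) := by
  obtain ⟨K, hK⟩ := exists_wd_dur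
  obtain ⟨N, hN⟩ := exists_wd_of_base
  refine ⟨6 * (K * (N + 2)) + N + flipCost, fun k n Z hZ hn => ?_⟩
  refine (acts_of_duckSwap Z (2 * dur k) (hN _ _ n Z (fun L hL => by have := hZ L hL; omega) hn
    fun E hE hE' => hK k (2 * n + N) E (fun c hc => ⟨(hE c hc).1, hZ _ (hE c hc).2⟩) hE')
      hn).mono ?_
  have h1 : 1 ≤ (k + 1) ^ 2 := Nat.one_le_pow _ _ (by omega)
  generalize (k + 1) ^ 2 = s at *
  have h2 : 2 * n + N + s ≤ (N + 2) * (n + s) := by nlinarith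
  have h3 : n ≤ (k + 1) * (n + s) := by nlinarith
  have h4 : 1 ≤ (k + 1) * (n + s) := by nlinarith
  calc _ ≤ 6 * (K * (k + 1) * ((N + 2) * (n + s))) + N * ((k + 1) * (n + s)) +
        flipCost * ((k + 1) * (n + s)) := by
        gcongr
        exact Nat.le_mul_of_pos_right _ h4
    _ = _ := by ring

open Classical in
theorem exists_acts_pow : ∃ K, ∀ (k n : ℕ) (Z : ℕ → Prop), (∀ L, Z L → k + 4 ≤ L) →
    Ctl n {c : Core | Z c.len} →
    Acts (K * ((k + 1) * (n + (k + 1) ^ 2))) (fun L => if Z L then 2 * 3 ^ (k + 1) else 0) := by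
  obtain ⟨K, hK⟩ := exists_acts_dur
  refine ⟨2 * K + 800 + 2 * flipCost, fun k n Z hZ hn => ?_⟩
  have h := ((hK k n Z hZ hn).nsmul 2).add (hn.acts 2)
  convert h.mono ?_ using 1
  · funext L
    by_cases hL : Z L
    · simp only [hL, if_true, Pi.add_apply, Pi.smul_apply]
      rw [← two_mul_dur, nsmul_eq_mul]
      push_cast
      ring
    · simp [hL]
  · have h1 : 1 ≤ (k + 1) ^ 2 := Nat.one_le_pow _ _ (by omega)
    generalize (k + 1) ^ 2 = s at *
    have h3 : n ≤ (k + 1) * (n + s) := by nlinarith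
    have h4 : 1 ≤ (k + 1) * (n + s) := by nlinarith
    rw [show (2 : ℤ).natAbs = 2 from rfl]
    calc _ ≤ 2 * (K * ((k + 1) * (n + s))) + (800 * ((k + 1) * (n + s)) +
          2 * flipCost * ((k + 1) * (n + s))) := by
          gcongr ?_ + (?_ + _ * ?_) <;> omega
      _ = _ := by ring

theorem exists_acts_digit : ∃ K, ∀ i,
    Acts (K * (i + 1) ^ 3) (fun L => if 4 ≤ L ∧ i + 3 ≤ L then 2 * 3 ^ i else 0) := by
  obtain ⟨K, hK⟩ := exists_acts_pow
  have hge : ∀ i, Ctl (400 * (i + 4) ^ 2 + 1) {c : Core | 4 ≤ c.len ∧ i + 3 ≤ c.len} := fun i =>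
    ((ctl_len_ge (max 4 (i + 3))).congr (E' := {c : Core | 4 ≤ c.len ∧ i + 3 ≤ c.len})
      (fun c _ => by simp)).mono (by gcongr; omega)
  refine ⟨(800 + 2 * flipCost * 6401) + K * 6402, fun i => ?_⟩
  cases i with
  | zero =>
    convert ((hge 0).acts (Z := fun L => 4 ≤ L ∧ 0 + 3 ≤ L) 2).mono ?_ using 3
    · norm_num
    · rw [show (2 : ℤ).natAbs = 2 from rfl]
      norm_num
  | succ k =>
    convert (hK k _ (fun L => 4 ≤ L ∧ k + 1 + 3 ≤ L) (fun L hL => by omega) (hge (k + 1))).mono ?_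
      using 3
    have h1 : 400 * (k + 1 + 4) ^ 2 + 1 + (k + 1) ^ 2 ≤ 6402 * (k + 1 + 1) ^ 2 := by
      ring_nf
      omega
    calc _ ≤ K * ((k + 1 + 1) * (6402 * (k + 1 + 1) ^ 2)) := by gcongr; omega
      _ = K * 6402 * (k + 1 + 1) ^ 3 := by ring
      _ ≤ _ := by gcongr; omega

theorem exists_acts_top : ∃ K, ∀ j,
    Acts (K * (j + 1) ^ 3) (fun L => if L = j + 4 then 2 * 3 ^ (j + 1) else 0) := by
  obtain ⟨K, hK⟩ := exists_acts_pow
  refine ⟨K * 10001, fun j => ?_⟩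
  convert (hK j _ (fun L => L = j + 4) (fun L hL => by omega) (ctl_len_eq (j + 4))).mono ?_ using 3
  have h1 : 400 * (j + 4 + 1) ^ 2 + (j + 1) ^ 2 ≤ 10001 * (j + 1) ^ 2 := by
    ring_nf
    omega
  calc _ ≤ K * ((j + 1) * (10001 * (j + 1) ^ 2)) := by gcongr
    _ = _ := by ring

theorem exists_acts_turn : ∃ K, ∀ j q : ℕ, q ≤ j + 4 →
    Acts (K * (j + 1) ^ 3) (fun L => if L = j + 4 then 2 * 3 ^ (j + 4) * (q : ℤ) else 0) := by
  obtain ⟨a, ha⟩ := exists_prog_renorm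
  obtain ⟨b, hb⟩ := exists_prog_gapStep
  obtain ⟨N, hN⟩ := exists_wd_of_base
  refine ⟨6 * (2 * (2 * a + 324 * b) + flipCost * (20000 + N)) + N + flipCost * 10000,
    fun j q hq => ?_⟩
  have hz : 2 * 3 ^ (j + 4) * (q : ℤ) = (2 * 3 ^ (j + 4) * q : ℕ) := by push_cast; ring
  have hctl := ctl_len_eq (j + 4)
  have hP := ((ha j).inv.mul ((hb j).pow (81 * q))).mul (ha j)
  have hwd := hN (2 * 3 ^ (j + 4) * q : ℕ) _ _ (fun L => L = j + 4) (fun L hL => by omega) hctl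
    (fun E hE hE' => hP.wd_duckSwap hE' fun c hc _ => ?_)
  · rw [hz]
    convert (acts_of_duckSwap (fun L => L = j + 4) _ hwd hctl).mono ?_ using 3
    have h1 : 400 * (j + 4 + 1) ^ 2 ≤ 10000 * (j + 1) ^ 2 := by
      ring_nf
      omega
    have h2 : 81 * q ≤ 324 * (j + 1) := by omega
    have h3 : 1 ≤ (j + 1) ^ 3 := Nat.one_le_pow _ _ (by omega)
    have h4 : (j + 1) ^ 2 ≤ (j + 1) ^ 3 := Nat.pow_le_pow_right (by omega) (by omega)
    calc _ ≤ 6 * (2 * (a * (j + 1) ^ 3 + 324 * (j + 1) * (b * (j + 1)) + a * (j + 1) ^ 3) +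
          flipCost * (2 * (10000 * (j + 1) ^ 3) + N * (j + 1) ^ 3)) + N * (j + 1) ^ 3 +
          flipCost * (10000 * (j + 1) ^ 3) := by
          have h5 := h1.trans (Nat.mul_le_mul_left 10000 h4)
          gcongr
          · exact Nat.le_mul_of_pos_right _ h3
          · exact Nat.le_mul_of_pos_right _ h3
      _ = 6 * (2 * (2 * a * (j + 1) ^ 3 + 324 * b * (j + 1) ^ 2) +
          flipCost * ((20000 + N) * (j + 1) ^ 3)) + N * (j + 1) ^ 3 +
          flipCost * (10000 * (j + 1) ^ 3) := by ring
      _ ≤ 6 * (2 * (2 * a * (j + 1) ^ 3 + 324 * b * (j + 1) ^ 3) +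
          flipCost * ((20000 + N) * (j + 1) ^ 3)) + N * (j + 1) ^ 3 +
          flipCost * (10000 * (j + 1) ^ 3) := by gcongr
      _ = _ := by ring
  · obtain ⟨s, h1, h2⟩ := exists_turn (hE c hc).1 (hE c hc).2
    rw [h2, zpow_natCast, pow_mul_apply_shift h1]

/-! ### Assembling an arbitrary power -/

theorem Acts.sum {n : ℕ} {e : ℕ → ℕ → ℤ} (M : ℕ) (h : ∀ i < M, Acts n (e i)) :
    Acts (M * n) (∑ i ∈ Finset.range M, e i) := by
  induction M with
  | zero => simpa using Acts.zero
  | succ M ih =>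
    rw [Finset.sum_range_succ, Nat.succ_mul]
    exact (ih fun i hi => h i (by omega)).add (h M (by omega))

theorem confEq_symT_period {κ : Conf} (h : κ.1.len = 2 ∨ 4 ≤ κ.1.len) (t : ℕ) :
    ConfEq κ (symT (smartF ^ ((2 * 3 ^ κ.1.len * κ.1.len * t : ℕ) : ℤ)) κ) := by
  obtain ⟨c, d, g⟩ := κ
  rw [zpow_natCast]
  have key : ∀ c : Core, (c.len = 2 ∨ 4 ≤ c.len) → ∃ s : ℤ,
      (smartF ^ (2 * 3 ^ c.len * c.len * t)) c = c.shift (c.len * s) := fun c hc => by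
    obtain ⟨s, hs⟩ := exists_period hc
    exact ⟨s * t, by rw [pow_mul_apply_shift hs]; congr 1; ring⟩
  obtain rfl | rfl : d = 0 ∨ d = 1 := by omega
  · obtain ⟨s, hs⟩ := key c h
    rw [symT_zero, hs]
    refine ⟨rfl, rfl, ?_, rfl⟩
    simp [Core.shift, Core.len, Int.ModEq]
  · rw [symT_one]
    set b := ((smartF ^ (2 * 3 ^ c.len * c.len * t))⁻¹) c with hb
    have hbc : (smartF ^ (2 * 3 ^ c.len * c.len * t)) b = c := by
      rw [hb, ← Equiv.Perm.mul_apply, mul_inv_cancel, Equiv.Perm.one_apply]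
    have hl : b.len = c.len := (prog_smartF.pow _).inv.len c
    obtain ⟨s, hs⟩ := key b (hl ▸ h)
    rw [hl, hbc] at hs
    rw [hs]
    refine ⟨rfl, rfl, ?_, rfl⟩
    rw [← hl]
    simp [Core.shift, Core.len, Int.ModEq]

theorem sum_digits_lt (m M r : ℕ) :
    ∑ i ∈ Finset.range M, (if i < r then m / 3 ^ i % 3 * 3 ^ i else 0) = m % 3 ^ min M r := by
  induction M with
  | zero => simp [Nat.mod_one]
  | succ M ih =>
    rw [Finset.sum_range_succ, ih]
    split_ifs with h
    · rw [min_eq_left h.le, min_eq_left (by omega : M + 1 ≤ r), Nat.mod_pow_succ, mul_comm]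
    · rw [min_eq_right (by omega : r ≤ M), min_eq_right (by omega : r ≤ M + 1), add_zero]

/-- The exponents occurring in the power `2 * m`: the low digits, on all long belts. -/
def lowExp (m i : ℕ) : ℕ → ℤ :=
  (m / 3 ^ i % 3) • fun L => if 4 ≤ L ∧ i + 3 ≤ L then 2 * 3 ^ i else 0

/-- The exponents occurring in the power `2 * m`: the high digits, on belts of length `j + 4`. -/
def highExp (m j : ℕ) : ℕ → ℤ :=
  ((3 * (m / 3 ^ (j + 2) % 9)) • fun L => if L = j + 4 then 2 * 3 ^ (j + 1) else 0) +
    fun L => if L = j + 4 then 2 * 3 ^ (j + 4) * ((m / 3 ^ (j + 4) % (j + 4) : ℕ) : ℤ) else 0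

/-- The reduction of the power `n` on belts of length `L`. -/
noncomputable def redExp (n M : ℕ) : ℕ → ℤ :=
  (fun _ => ((n % 2 : ℕ) : ℤ)) + (fun L => if L < 4 then ((2 * (n / 2 % 18) : ℕ) : ℤ) else 0) +
    ∑ i ∈ Finset.range M, lowExp (n / 2) i + ∑ j ∈ Finset.range M, highExp (n / 2) j

theorem sum_lowExp (m M j : ℕ) (hm : m < 3 ^ M) :
    ∑ i ∈ Finset.range M, lowExp m i (j + 4) = 2 * ((m % 3 ^ (j + 2) : ℕ) : ℤ) := by
  have h := sum_digits_lt m M (j + 2)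
  rw [show m % 3 ^ min M (j + 2) = m % 3 ^ (j + 2) by
    rcases le_total M (j + 2) with h' | h'
    · rw [min_eq_left h', Nat.mod_eq_of_lt hm,
        Nat.mod_eq_of_lt (hm.trans_le (Nat.pow_le_pow_right (by omega) h'))]
    · rw [min_eq_right h']] at h
  rw [← h, Nat.cast_sum, Finset.mul_sum]
  refine Finset.sum_congr rfl fun i _ => ?_
  by_cases hi : i < j + 2
  · rw [lowExp, Pi.smul_apply, if_pos hi, if_pos (by omega), nsmul_eq_mul]
    push_cast
    ring
  · rw [lowExp, Pi.smul_apply, if_neg hi, if_neg (by omega)]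
    simp

theorem sum_highExp (m M j : ℕ) (hm : m < 3 ^ M) :
    ∑ i ∈ Finset.range M, highExp m i (j + 4) =
      2 * 3 ^ (j + 2) * ((m / 3 ^ (j + 2) % 9 : ℕ) : ℤ) +
        2 * 3 ^ (j + 4) * ((m / 3 ^ (j + 4) % (j + 4) : ℕ) : ℤ) := by
  have h0 : ∀ i, i ≠ j → highExp m i (j + 4) = 0 := fun i hi => by
    rw [highExp, Pi.add_apply, Pi.smul_apply, if_neg (by omega), if_neg (by omega)]
    simp
  have h1 : highExp m j (j + 4) = 2 * 3 ^ (j + 2) * ((m / 3 ^ (j + 2) % 9 : ℕ) : ℤ) +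
        2 * 3 ^ (j + 4) * ((m / 3 ^ (j + 4) % (j + 4) : ℕ) : ℤ) := by
    rw [highExp, Pi.add_apply, Pi.smul_apply, if_pos rfl, if_pos rfl, nsmul_eq_mul]
    push_cast
    ring
  by_cases hj : j < M
  · rw [Finset.sum_eq_single j (fun i _ hi => h0 i hi) (by simp [hj]), h1]
  · rw [Finset.sum_eq_zero fun i hi => h0 i (by rw [Finset.mem_range] at hi; omega)]
    have hm' : ∀ r, m / 3 ^ (j + r) = 0 := fun r =>
      Nat.div_eq_of_lt (hm.trans_le (Nat.pow_le_pow_right (by omega) (by omega)))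
    rw [hm', hm']
    simp

theorem exists_eq_redExp (n M L : ℕ) (hn : n < 3 ^ M) (hL : L = 2 ∨ 4 ≤ L) :
    ∃ t : ℕ, (n : ℤ) = ((2 * 3 ^ L * L * t : ℕ) : ℤ) + redExp n M L := by
  have hm : n / 2 < 3 ^ M := by omega
  simp only [redExp, Pi.add_apply, Finset.sum_apply]
  rcases hL with rfl | hL
  · refine ⟨n / 2 / 18, ?_⟩
    rw [Finset.sum_eq_zero fun i _ => ?_, Finset.sum_eq_zero fun i _ => ?_, if_pos (by omega)]
    · push_cast
      omega
    · rw [highExp, Pi.add_apply, Pi.smul_apply, if_neg (by omega), if_neg (by omega)]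
      simp
    · rw [lowExp, Pi.smul_apply, if_neg (by omega)]
      simp
  · obtain ⟨j, rfl⟩ := Nat.exists_eq_add_of_le' hL
    refine ⟨n / 2 / 3 ^ (j + 4) / (j + 4), ?_⟩
    rw [sum_lowExp _ _ _ hm, sum_highExp _ _ _ hm, if_neg (by omega)]
    have h1 : n / 2 / 3 ^ (j + 4) = n / 2 / 3 ^ (j + 2) / 9 := by
      rw [Nat.div_div_eq_div_mul _ (3 ^ (j + 2)), pow_add 3 j 2, pow_add 3 j 4, mul_assoc]
      norm_num
    have h2 := Nat.mod_add_div (n / 2) (3 ^ (j + 2))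
    have h3 := Nat.mod_add_div (n / 2 / 3 ^ (j + 2)) 9
    have h4 := Nat.mod_add_div (n / 2 / 3 ^ (j + 4)) (j + 4)
    have h5 := Nat.mod_add_div n 2
    rw [← h1] at h3
    have h6 : n = 2 * 3 ^ (j + 4) * (j + 4) * (n / 2 / 3 ^ (j + 4) / (j + 4)) +
        (n % 2 + 0 + 2 * (n / 2 % 3 ^ (j + 2)) + (2 * 3 ^ (j + 2) * (n / 2 / 3 ^ (j + 2) % 9) +
          2 * 3 ^ (j + 4) * (n / 2 / 3 ^ (j + 4) % (j + 4)))) := by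
      conv_lhs => rw [← h5, ← h2, ← h3, ← h4]
      ring
    exact_mod_cast h6

theorem exists_acts_redExp : ∃ K, ∀ n M, Acts (K * (M + 1) ^ 4) (redExp n M) := by
  obtain ⟨a, ha⟩ := exists_acts_digit
  obtain ⟨b, hb⟩ := exists_acts_top
  obtain ⟨d, hd⟩ := exists_acts_turn
  obtain ⟨u, hu⟩ : ∃ u, Ctl u {c : Core | True} :=
    ⟨_, Ctl.univ.congr fun c _ => by simp⟩
  obtain ⟨v, hv⟩ : ∃ v, Ctl v {c : Core | c.len < 4} :=
    ⟨_, (ctl_len_lt 4 fun _ => True).congr fun c _ => by simp⟩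
  refine ⟨400 + 2 * flipCost * u + (400 * 36 + 2 * flipCost * v) + 2 * a + (27 * b + d),
    fun n M => ?_⟩
  have hpow : ∀ i < M, (i + 1) ^ 3 ≤ (M + 1) ^ 3 := fun i hi => by gcongr
  have h1 : Acts (400 + 2 * flipCost * u) (fun _ => ((n % 2 : ℕ) : ℤ)) := by
    convert (hu.acts (Z := fun _ => True) ((n % 2 : ℕ) : ℤ)).mono ?_ using 2
    · simp
    · rw [Int.natAbs_natCast]
      have : n % 2 ≤ 1 := by omega
      gcongr
      omega
  have h2 : Acts (400 * 36 + 2 * flipCost * v)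
      (fun L => if L < 4 then ((2 * (n / 2 % 18) : ℕ) : ℤ) else 0) := by
    convert (hv.acts (Z := fun L => L < 4) ((2 * (n / 2 % 18) : ℕ) : ℤ)).mono ?_ using 3
    rw [Int.natAbs_natCast]
    gcongr
    omega
  have h3 : ∀ i < M, Acts (2 * (a * (M + 1) ^ 3)) (lowExp (n / 2) i) := fun i hi =>
    ((ha i).nsmul _).mono <| by
      have := hpow i hi
      gcongr
      omega
  have h4 : ∀ j < M, Acts (27 * (b * (M + 1) ^ 3) + d * (M + 1) ^ 3) (highExp (n / 2) j) :=
    fun j hj => (((hb j).nsmul _).add (hd j _ (Nat.mod_lt _ (by omega)).le)).mono <| by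
      have := hpow j hj
      gcongr
      omega
  refine (((h1.add h2).add (Acts.sum M h3)).add (Acts.sum M h4)).mono ?_
  have h5 : 1 ≤ (M + 1) ^ 4 := Nat.one_le_pow _ _ (by omega)
  have h6 : M * (M + 1) ^ 3 ≤ (M + 1) ^ 4 := by rw [pow_succ' _ 3]; gcongr; omega
  calc _ = (400 + 2 * flipCost * u + (400 * 36 + 2 * flipCost * v)) * 1 +
        2 * a * (M * (M + 1) ^ 3) + (27 * b + d) * (M * (M + 1) ^ 3) := by ring
    _ ≤ (400 + 2 * flipCost * u + (400 * 36 + 2 * flipCost * v)) * (M + 1) ^ 4 +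
        2 * a * (M + 1) ^ 4 + (27 * b + d) * (M + 1) ^ 4 := by gcongr
    _ = _ := by ring

theorem exists_perm_beltPower : ∃ K, ∀ n M, n < 3 ^ M →
    ∃ π : Equiv.Perm (ℤ → BSym QS Letter),
      π ∈ Subgroup.closure starGens ∧
      (∀ x : ℤ → BSym QS Letter, AllFiniteBlocks x →
        ActsAsBeltPower smartSymStep n x (π x)) ∧ wordNorm starGens π ≤ K * (M + 1) ^ 4 := by
  obtain ⟨K, hK⟩ := exists_acts_redExp
  refine ⟨K, fun n M hn => ?_⟩
  obtain ⟨Φ, h1, h2⟩ := hK n M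
  refine h1.exists_perm fun κ hκ hκ' => ?_
  have hL : κ.1.len = 2 ∨ 4 ≤ κ.1.len := by
    rw [Core.len]
    obtain ⟨r, hr⟩ := hκ
    omega
  obtain ⟨t, ht⟩ := exists_eq_redExp n M κ.1.len hn hL
  rw [smartT_pow, ht, symT_zpow_add, h2 κ (List.length_pos_iff.1 (by omega))]
  have hl := len_symT_smartF (redExp n M κ.1.len) κ
  have h := confEq_symT_period (κ := symT (smartF ^ redExp n M κ.1.len) κ) (hl.symm ▸ hL) t
  rwa [hl] at h

/-- **Theorem.** The automorphism `f_S` induced on the conveyor-belt full shift `Σ^ℤ` by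
the decorated symmetrized SMART machine `S` belongs to the finitely generated group
`G_* ≤ Aut(Σ^ℤ)`, and there is a constant `K > 0` such that for all `n ≥ 2` the word norm
of `(f_S)^n` in `G_*` is at most `K·(log₂ n)⁴`. -/
theorem smart_belt_distortion :
    (∃ π₁ : Equiv.Perm (ℤ → BSym QS Letter),
      π₁ ∈ Subgroup.closure (BeltGensStar QS Letter sgnQS setSgnQS) ∧
      ∀ x : ℤ → BSym QS Letter, AllFiniteBlocks x →
        ActsAsBeltPower smartSymStep 1 x (π₁ x)) ∧
    (∃ K : ℝ, 0 < K ∧ ∀ n : ℕ, 2 ≤ n →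
      ∃ π : Equiv.Perm (ℤ → BSym QS Letter),
        π ∈ Subgroup.closure (BeltGensStar QS Letter sgnQS setSgnQS) ∧
        (∀ x : ℤ → BSym QS Letter, AllFiniteBlocks x →
          ActsAsBeltPower smartSymStep n x (π x)) ∧
        (wordNorm (BeltGensStar QS Letter sgnQS setSgnQS) π : ℝ) ≤
          K * (Real.logb 2 n) ^ 4) := by
  obtain ⟨K, hK⟩ := exists_perm_beltPower
  refine ⟨?_, (K + 1) * 81, by positivity, fun n hn => ?_⟩
  · obtain ⟨π, h1, h2, -⟩ := hK 1 1 (by norm_num)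
    exact ⟨π, h1, h2⟩
  · obtain ⟨π, h1, h2, h3⟩ := hK n (Nat.log 2 n + 1)
      ((Nat.lt_pow_succ_log_self (by norm_num) n).trans_le (Nat.pow_le_pow_left (by norm_num) _))
    refine ⟨π, h1, h2, ?_⟩
    have hlog : (Nat.log 2 n : ℝ) ≤ Real.logb 2 n := Real.natLog_le_logb n 2
    have hone : (1 : ℝ) ≤ Real.logb 2 n := by
      rw [Real.le_logb_iff_rpow_le (by norm_num) (by positivity), Real.rpow_one]
      exact_mod_cast hn
    calc (wordNorm (BeltGensStar QS Letter sgnQS setSgnQS) π : ℝ)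
        ≤ ((K * (Nat.log 2 n + 1 + 1) ^ 4 : ℕ) : ℝ) := by exact_mod_cast h3
      _ = K * ((Nat.log 2 n : ℝ) + 1 + 1) ^ 4 := by push_cast; ring
      _ ≤ (K + 1) * (3 * Real.logb 2 n) ^ 4 := by
        gcongr
        · linarith
        · linarith
      _ = _ := by ring
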